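/- Threshold scattering bound (Theorem 1.2(i), spacetime-bound form): let u be a regular solution of the cubic–quintic NLS defined on all of ℝ, radial in x, with E(u(0,·)) = E^c(W) and ‖∇u(0,·)‖_{L²} < ‖∇W‖_{L²}. Then ∫_ℝ ∫_{ℝ³} |u(t,x)|¹⁰ dx dt < ∞. -/

import Mathlib

open MeasureTheory Complex
open scoped BigOperators ENNReal

noncomputable section

abbrev E3 := EuclideanSpace ℝ (Fin 3)

/-- The Aubin–Talenti ground state `W(x) = (1 + |x|²/3)^(-1/2)`. -/
def W (x : E3) : ℝ := (1 + ‖x‖ ^ 2 / 3) ^ (-(1 : ℝ) / 2)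

/-- `W` viewed as a complex-valued function. -/
def Wc (x : E3) : ℂ := (W x : ℂ)

/-- Standard basis vectors of ℝ³. -/
def e3 (i : Fin 3) : E3 := EuclideanSpace.single i 1

/-- Partial derivative of a real-valued function. -/
def pdR (i : Fin 3) (f : E3 → ℝ) (x : E3) : ℝ := fderiv ℝ f x (e3 i)

/-- Partial derivative of a complex-valued function. -/
def pdC (i : Fin 3) (f : E3 → ℂ) (x : E3) : ℂ := fderiv ℝ f x (e3 i)

/-- Squared gradient `|∇f|²` of a real-valued function. -/
def gradSqR (f : E3 → ℝ) (x : E3) : ℝ := ∑ i, (pdR i f x) ^ 2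

/-- Squared gradient `|∇f|²` of a complex-valued function. -/
def gradSqC (f : E3 → ℂ) (x : E3) : ℝ := ∑ i, ‖pdC i f x‖ ^ 2

/-- Laplacian of a real-valued function. -/
def lapR (f : E3 → ℝ) (x : E3) : ℝ := ∑ i, pdR i (pdR i f) x

/-- Laplacian of a complex-valued function. -/
def lapC (f : E3 → ℂ) (x : E3) : ℂ := ∑ i, pdC i (pdC i f) x

/-- Quintic (energy-critical) energy `E^c`. -/
def Ecrit (f : E3 → ℂ) : ℝ := ∫ x : E3, ((1:ℝ)/2 * gradSqC f x - 1/6 * ‖f x‖ ^ 6)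

/-- Cubic–quintic energy `E`. -/
def Ecq (f : E3 → ℂ) : ℝ :=
  ∫ x : E3, ((1:ℝ)/2 * gradSqC f x - 1/6 * ‖f x‖ ^ 6 + 1/4 * ‖f x‖ ^ 4)

/-- Regular solutions of the cubic–quintic NLS on an interval `I ⊆ ℝ`. -/
def IsRegularSolution (I : Set ℝ) (u : ℝ → E3 → ℂ) : Prop :=
  ContDiffOn ℝ (⊤ : ℕ∞) (fun p : ℝ × E3 => u p.1 p.2) (I ×ˢ Set.univ) ∧
  (∀ t ∈ I, ∀ x : E3, Complex.I * deriv (fun s => u s x) t + lapC (u t) x =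
      (‖u t x‖ : ℂ) ^ 2 * u t x - (‖u t x‖ : ℂ) ^ 4 * u t x) ∧
  (∀ J : Set ℝ, IsCompact J → J ⊆ I → ∀ n k : ℕ, ∃ C : ℝ, ∀ t ∈ J, ∀ x : E3,
      (1 + ‖x‖) ^ n * ‖iteratedFDeriv ℝ k (u t) x‖ ≤ C)

/-! ## A sharp weighted inequality on the half-line -/

theorem hasDerivAt_half_arcsin_add {x : ℝ} (h0 : -1 < x) (h1 : x < 1) :
    HasDerivAt (fun x : ℝ => (Real.arcsin x + x * √(1 - x ^ 2)) / 2) (√(1 - x ^ 2)) x := by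
  have hp : 0 < 1 - x ^ 2 := by nlinarith
  have hs : 0 < √(1 - x ^ 2) := Real.sqrt_pos.2 hp
  have hsq : √(1 - x ^ 2) ^ 2 = 1 - x ^ 2 := Real.sq_sqrt hp.le
  have ha := Real.hasDerivAt_arcsin (x := x) (by linarith) (by linarith)
  have hb : HasDerivAt (fun x : ℝ => 1 - x ^ 2) (-(2 * x)) x := by
    simpa using (hasDerivAt_pow 2 x).const_sub 1
  have hc := hb.sqrt hp.ne'
  have hd := (ha.add ((hasDerivAt_id x).mul hc)).div_const 2
  refine HasDerivAt.congr_deriv hd ?_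
  simp only [id]
  field_simp
  rw [hsq]; ring

theorem continuous_half_arcsin_add :
    Continuous (fun x : ℝ => (Real.arcsin x + x * √(1 - x ^ 2)) / 2) := by
  have := Real.continuous_arcsin
  fun_prop

theorem weighted_pointwise {r G G' e q m s : ℝ} (hr : 0 < r) (hG : 0 ≤ G) (he : 0 ≤ e)
    (hle : (r * G' + G) ^ 2 ≤ 4 * r * G * e) (hm : 0 < m) (hq : q ^ 2 = 1 - (G / m) ^ 2)
    (hs : s ^ 2 = 1) :
    G' / 2 + s * (G' * q / 2) ≤ e - G ^ 3 / r / (4 * m ^ 2) := by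
  rcases hG.eq_or_lt with h | h
  · subst h
    have : r * G' = 0 := by nlinarith [sq_nonneg (r * G')]
    have : G' = 0 := by
      rcases mul_eq_zero.1 this with h | h
      · linarith
      · exact h
    subst this; simpa using he
  · have hid : G ^ 3 / r / (4 * m ^ 2) * (4 * r * G) = G ^ 2 * (G / m) ^ 2 := by
      field_simp
    have key : (G' / 2 + s * (G' * q / 2) + G ^ 3 / r / (4 * m ^ 2)) * (4 * r * G)
        ≤ e * (4 * r * G) := by
      have e1 : (G / m) ^ 2 = 1 - q ^ 2 := by linarith
      rw [add_mul, hid, e1]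
      have : 0 ≤ (r * G' - s * (G * q)) ^ 2 := sq_nonneg _
      have h2 : (s * (G * q)) ^ 2 = G ^ 2 * q ^ 2 := by rw [mul_pow, hs]; ring
      nlinarith
    have := le_of_mul_le_mul_right key (by positivity)
    linarith

theorem weighted_lower_bound {G G' e : ℝ → ℝ} {m r0 : ℝ} (hG0 : ∀ r, 0 ≤ r → 0 ≤ G r)
    (hd : ∀ r, 0 < r → HasDerivAt G (G' r) r)
    (hle : ∀ r, 0 < r → (r * G' r + G r) ^ 2 ≤ 4 * r * G r * e r)
    (he : ∀ r, 0 < r → 0 ≤ e r) (hei : IntegrableOn e (Set.Ioi 0))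
    (hN : IntegrableOn (fun r => G r ^ 3 / r) (Set.Ioi 0)) (hc : ContinuousOn G (Set.Ici 0))
    (h00 : G 0 = 0) (hlim : Filter.Tendsto G Filter.atTop (nhds 0))
    (hm : ∀ r, 0 ≤ r → G r < m) (hr0 : 0 ≤ r0) :
    (∫ r in Set.Ioi 0, G r ^ 3 / r) / (4 * m ^ 2)
      + m * ((Real.arcsin (G r0 / m) + G r0 / m * √(1 - (G r0 / m) ^ 2)) / 2)
      ≤ ∫ r in Set.Ioi 0, e r := by
  set Ψ : ℝ → ℝ := fun x => (Real.arcsin x + x * √(1 - x ^ 2)) / 2 with hΨ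
  have hm0 : 0 < m := by have := hm 0 le_rfl; rwa [h00] at this
  have hΨ0 : Ψ 0 = 0 := by simp [hΨ]
  have hΨc : Continuous Ψ := continuous_half_arcsin_add
  set φ : ℝ → ℝ := fun r => e r - G r ^ 3 / r / (4 * m ^ 2) with hφ
  have hφi : IntegrableOn φ (Set.Ioi 0) := hei.sub (hN.div_const _)
  have hφint : ∫ r in Set.Ioi 0, φ r = (∫ r in Set.Ioi 0, e r)
      - (∫ r in Set.Ioi 0, G r ^ 3 / r) / (4 * m ^ 2) := by
    rw [hφ, integral_sub hei (hN.div_const _), integral_div]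
  have hTc : ∀ s : ℝ, ContinuousOn (fun r => G r / 2 + s * (m * Ψ (G r / m) / 2)) (Set.Ici 0) := by
    intro s
    have h1 : ContinuousOn (fun r => Ψ (G r / m)) (Set.Ici 0) :=
      hΨc.comp_continuousOn (hc.div_const m)
    exact (hc.div_const 2).add (((h1.const_smul m).div_const 2).const_smul s)
  have hTd : ∀ s r : ℝ, 0 < r → HasDerivAt (fun r => G r / 2 + s * (m * Ψ (G r / m) / 2))
      (G' r / 2 + s * (G' r * √(1 - (G r / m) ^ 2) / 2)) r := by
    intro s r hr
    have hlt : G r / m < 1 := (div_lt_one hm0).2 (hm r hr.le)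
    have hgt : -1 < G r / m := lt_of_lt_of_le (by norm_num) (div_nonneg (hG0 r hr.le) hm0.le)
    have h1 := (hasDerivAt_half_arcsin_add hgt hlt).comp r ((hd r hr).div_const m)
    have h2 := ((hd r hr).div_const 2).add (((h1.const_mul m).div_const 2).const_mul s)
    refine HasDerivAt.congr_deriv h2 ?_
    field_simp
  have hpt : ∀ s r : ℝ, s ^ 2 = 1 → 0 < r →
      G' r / 2 + s * (G' r * √(1 - (G r / m) ^ 2) / 2) ≤ φ r := by
    intro s r hs hr
    refine weighted_pointwise hr (hG0 r hr.le) (he r hr) (hle r hr) hm0 (Real.sq_sqrt ?_) hs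
    have hlt : G r / m < 1 := (div_lt_one hm0).2 (hm r hr.le)
    have hgt : 0 ≤ G r / m := div_nonneg (hG0 r hr.le) hm0.le
    nlinarith
  have hstep : ∀ s a b : ℝ, s ^ 2 = 1 → 0 ≤ a → a ≤ b →
      (G b / 2 + s * (m * Ψ (G b / m) / 2)) - (G a / 2 + s * (m * Ψ (G a / m) / 2))
        ≤ ∫ r in a..b, φ r := by
    intro s a b hs ha hab
    refine intervalIntegral.sub_le_integral_of_hasDeriv_right_of_le hab
      ((hTc s).mono (fun x hx => ha.trans hx.1))
      (fun x hx => (hTd s x (ha.trans_lt hx.1)).hasDerivWithinAt) ?_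
      (fun x hx => hpt s x hs (ha.trans_lt hx.1))
    rw [integrableOn_Icc_iff_integrableOn_Ioc]
    exact hφi.mono_set (fun x hx => ha.trans_lt hx.1)
  have hfin : ∀ R, r0 ≤ R → m * Ψ (G r0 / m) + (G R / 2 + (-1) * (m * Ψ (G R / m) / 2))
      ≤ ∫ r in (0:ℝ)..R, φ r := by
    intro R hR
    have h1 := hstep 1 0 r0 (by norm_num) le_rfl hr0
    have h2 := hstep (-1) r0 R (by norm_num) hr0 hR
    rw [h00] at h1
    have h3 : ∫ r in (0:ℝ)..R, φ r = (∫ r in (0:ℝ)..r0, φ r) + ∫ r in r0..R, φ r := by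
      refine (intervalIntegral.integral_add_adjacent_intervals ?_ ?_).symm
      · rw [intervalIntegrable_iff_integrableOn_Ioc_of_le hr0]
        exact hφi.mono_set (fun x hx => hx.1)
      · rw [intervalIntegrable_iff_integrableOn_Ioc_of_le hR]
        exact hφi.mono_set (fun x hx => hr0.trans_lt hx.1)
    rw [h3]
    simp only [zero_div, hΨ0] at h1
    linarith
  have hT1 : Filter.Tendsto (fun R => m * Ψ (G r0 / m) + (G R / 2 + (-1) * (m * Ψ (G R / m) / 2)))
      Filter.atTop (nhds (m * Ψ (G r0 / m) + (0 / 2 + (-1) * (m * Ψ (0 / m) / 2)))) := by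
    have hcc : Continuous (fun g : ℝ => m * Ψ (G r0 / m) + (g / 2 + (-1) * (m * Ψ (g / m) / 2))) := by
      fun_prop
    exact (hcc.tendsto 0).comp hlim
  have hT2 := intervalIntegral_tendsto_integral_Ioi 0 hφi Filter.tendsto_id
  have := le_of_tendsto_of_tendsto hT1 hT2 ((Filter.eventually_ge_atTop r0).mono hfin)
  simp only [zero_div, hΨ0] at this
  rw [hφint] at this
  change _ + m * Ψ (G r0 / m) ≤ _
  linarith

theorem amgm_cube {x y : ℝ} (hx : 0 ≤ x) (hy : 0 ≤ y) : 27 * x * y ^ 2 ≤ (x + 2 * y) ^ 3 := by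
  nlinarith [mul_nonneg hx (sq_nonneg (x - y)), mul_nonneg hy (sq_nonneg (x - y))]

/-- The one-dimensional form of the sharp radial Sobolev inequality. -/
theorem weighted_sobolev {G G' e : ℝ → ℝ} (hG0 : ∀ r, 0 ≤ r → 0 ≤ G r)
    (hd : ∀ r, 0 < r → HasDerivAt G (G' r) r)
    (hle : ∀ r, 0 < r → (r * G' r + G r) ^ 2 ≤ 4 * r * G r * e r)
    (he : ∀ r, 0 < r → 0 ≤ e r) (hei : IntegrableOn e (Set.Ioi 0))
    (hN : IntegrableOn (fun r => G r ^ 3 / r) (Set.Ioi 0)) (hc : ContinuousOn G (Set.Ici 0))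
    (h00 : G 0 = 0) (hlim : Filter.Tendsto G Filter.atTop (nhds 0)) :
    27 * Real.pi ^ 2 / 256 * (∫ r in Set.Ioi 0, G r ^ 3 / r) ≤ (∫ r in Set.Ioi 0, e r) ^ 3 := by
  have hE : 0 ≤ ∫ r in Set.Ioi 0, e r := setIntegral_nonneg measurableSet_Ioi he
  have hNn : 0 ≤ ∫ r in Set.Ioi 0, G r ^ 3 / r := setIntegral_nonneg measurableSet_Ioi
    (fun r hr => div_nonneg (pow_nonneg (hG0 r (le_of_lt hr)) 3) (le_of_lt hr))
  by_cases hz : ∀ r, 0 < r → G r = 0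
  · have : ∫ r in Set.Ioi 0, G r ^ 3 / r = 0 := by
      rw [setIntegral_congr_fun measurableSet_Ioi (g := fun _ => (0:ℝ))]
      · simp
      · intro r hr
        simp [hz r hr]
    rw [this]; simpa using pow_nonneg hE 3
  push Not at hz
  obtain ⟨r1, hr1, hr1G⟩ := hz
  have hr1pos : 0 < G r1 := lt_of_le_of_ne (hG0 r1 hr1.le) (Ne.symm hr1G)
  obtain ⟨r0, hr0, hmax⟩ : ∃ r0 ∈ Set.Ici (0:ℝ), IsMaxOn G (Set.Ici 0) r0 := by
    refine hc.exists_isMaxOn' isClosed_Ici (x₀ := r1) hr1.le ?_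
    have h1 : ∀ᶠ r in Filter.atTop, G r ≤ G r1 := (hlim.eventually (gt_mem_nhds hr1pos)).mono
      (fun x hx => le_of_lt hx)
    obtain ⟨K, hK⟩ := Filter.eventually_atTop.1 h1
    rw [Filter.eventually_inf_principal]
    have : ∀ᶠ x : ℝ in Filter.cocompact ℝ, x ∈ (Set.Icc 0 (max 0 K))ᶜ :=
      (isCompact_Icc).compl_mem_cocompact
    filter_upwards [this] with x hx hx0
    refine hK x ?_
    by_contra hlt
    push Not at hlt
    exact hx ⟨hx0, hlt.le.trans (le_max_right _ _)⟩
  set m0 := G r0 with hm0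
  have hm0pos : 0 < m0 := hr1pos.trans_le (hmax hr1.le)
  have hlow : ∀ m, m0 < m → (∫ r in Set.Ioi 0, G r ^ 3 / r) / (4 * m ^ 2)
      + m * ((Real.arcsin (m0 / m) + m0 / m * √(1 - (m0 / m) ^ 2)) / 2)
      ≤ ∫ r in Set.Ioi 0, e r := fun m hm =>
    weighted_lower_bound hG0 hd hle he hei hN hc h00 hlim
      (fun r hr => lt_of_le_of_lt (hmax hr) hm) hr0
  have hcont : ContinuousAt (fun m => (∫ r in Set.Ioi 0, G r ^ 3 / r) / (4 * m ^ 2)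
      + m * ((Real.arcsin (m0 / m) + m0 / m * √(1 - (m0 / m) ^ 2)) / 2)) m0 := by
    have h1 : ContinuousAt (fun m => m0 / m) m0 := by fun_prop (disch := exact hm0pos.ne')
    have h2 : ContinuousAt (fun m => (Real.arcsin (m0 / m) + m0 / m * √(1 - (m0 / m) ^ 2)) / 2) m0 :=
      continuous_half_arcsin_add.continuousAt.comp_of_eq h1 rfl
    refine ContinuousAt.add (ContinuousAt.div continuousAt_const (by fun_prop) (by positivity)) ?_
    exact continuousAt_id.mul h2
  have hkey := le_of_tendsto (hcont.tendsto.mono_left nhdsWithin_le_nhds)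
    (Filter.eventually_of_mem (self_mem_nhdsWithin (a := m0) (s := Set.Ioi m0)) hlow)
  rw [div_self hm0pos.ne'] at hkey
  norm_num at hkey
  set N := ∫ r in Set.Ioi 0, G r ^ 3 / r
  have h3 := amgm_cube (x := N / (4 * m0 ^ 2)) (y := Real.pi * m0 / 8) (by positivity)
    (by positivity)
  have h4 : 27 * (N / (4 * m0 ^ 2)) * (Real.pi * m0 / 8) ^ 2 = 27 * Real.pi ^ 2 / 256 * N := by
    field_simp; ring
  rw [← h4]
  refine h3.trans (pow_le_pow_left₀ (by positivity) ?_ 3)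
  linarith

/-! ## Rapidly decaying time-dependent functions on the half-line -/

/-- Jointly continuous functions on `ℝ × [0, ∞)` decaying faster than any polynomial in the second
variable, locally uniformly in the first. -/
def RapidDecay (f : ℝ → ℝ → ℝ) : Prop :=
  ContinuousOn (fun p : ℝ × ℝ => f p.1 p.2) (Set.univ ×ˢ Set.Ici 0) ∧
  ∀ (T : ℝ) (n : ℕ), ∃ C : ℝ, 0 ≤ C ∧ ∀ t r : ℝ, |t| ≤ T → 0 ≤ r → (1 + r) ^ n * |f t r| ≤ C

/-- Continuous weights of polynomial growth on `[0, ∞)`. -/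
def PolyWeight (w : ℝ → ℝ) : Prop :=
  ContinuousOn w (Set.Ici 0) ∧ ∃ (n : ℕ) (C : ℝ), 0 ≤ C ∧ ∀ r : ℝ, 0 ≤ r → |w r| ≤ C * (1 + r) ^ n

namespace RapidDecay

variable {f g : ℝ → ℝ → ℝ}

theorem add (hf : RapidDecay f) (hg : RapidDecay g) : RapidDecay (fun t r => f t r + g t r) := by
  refine ⟨hf.1.add hg.1, fun T n => ?_⟩
  obtain ⟨C, hC, h1⟩ := hf.2 T n
  obtain ⟨D, hD, h2⟩ := hg.2 T n
  refine ⟨C + D, by positivity, fun t r ht hr => ?_⟩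
  calc (1 + r) ^ n * |f t r + g t r| ≤ (1 + r) ^ n * (|f t r| + |g t r|) := by
        gcongr; exact abs_add_le _ _
    _ ≤ C + D := by rw [mul_add]; exact add_le_add (h1 t r ht hr) (h2 t r ht hr)

theorem neg (hf : RapidDecay f) : RapidDecay (fun t r => -f t r) := by
  refine ⟨hf.1.neg, fun T n => ?_⟩
  simpa only [abs_neg] using hf.2 T n

theorem sub (hf : RapidDecay f) (hg : RapidDecay g) : RapidDecay (fun t r => f t r - g t r) := by
  simpa only [sub_eq_add_neg] using hf.add hg.neg

theorem weight (hf : RapidDecay f) {w : ℝ → ℝ} (hw : PolyWeight w) :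
    RapidDecay (fun t r => w r * f t r) := by
  obtain ⟨hwc, m, D, hD, hw⟩ := hw
  refine ⟨(hwc.comp continuousOn_snd (fun p hp => hp.2)).mul hf.1, fun T n => ?_⟩
  obtain ⟨C, hC, h1⟩ := hf.2 T (n + m)
  refine ⟨D * C, by positivity, fun t r ht hr => ?_⟩
  calc (1 + r) ^ n * |w r * f t r| = (1 + r) ^ n * (|w r| * |f t r|) := by rw [abs_mul]
    _ ≤ (1 + r) ^ n * (D * (1 + r) ^ m * |f t r|) := by gcongr; exact hw r hr
    _ = D * ((1 + r) ^ (n + m) * |f t r|) := by rw [pow_add]; ring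
    _ ≤ D * C := by gcongr; exact h1 t r ht hr

theorem mul (hf : RapidDecay f) (hg : RapidDecay g) : RapidDecay (fun t r => f t r * g t r) := by
  refine ⟨hf.1.mul hg.1, fun T n => ?_⟩
  obtain ⟨C, hC, h1⟩ := hf.2 T n
  obtain ⟨D, hD, h2⟩ := hg.2 T 0
  refine ⟨C * D, by positivity, fun t r ht hr => ?_⟩
  have h3 := h2 t r ht hr
  rw [pow_zero, one_mul] at h3
  rw [abs_mul, ← mul_assoc]
  exact mul_le_mul (h1 t r ht hr) h3 (abs_nonneg _) hC

theorem const_mul (hf : RapidDecay f) (c : ℝ) : RapidDecay (fun t r => c * f t r) :=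
  hf.weight ⟨continuousOn_const, 0, |c|, abs_nonneg _, by simp⟩

theorem pow (hf : RapidDecay f) (n : ℕ) : RapidDecay (fun t r => f t r ^ (n + 1)) := by
  induction n with
  | zero => simpa using hf
  | succ n ih => simpa only [pow_succ (f _ _) (n + 1)] using ih.mul hf

theorem congr (hf : RapidDecay f) (h : ∀ t r, 0 ≤ r → g t r = f t r) : RapidDecay g := by
  refine ⟨hf.1.congr (fun p hp => h p.1 p.2 hp.2), fun T n => ?_⟩
  obtain ⟨C, hC, h1⟩ := hf.2 T n
  exact ⟨C, hC, fun t r ht hr => by rw [h t r hr]; exact h1 t r ht hr⟩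

theorem continuousOn (hf : RapidDecay f) (t : ℝ) : ContinuousOn (f t) (Set.Ici 0) :=
  hf.1.comp (f := fun r : ℝ => (t, r)) (by fun_prop) (fun r hr => ⟨trivial, hr⟩)

theorem aestronglyMeasurable (hf : RapidDecay f) (t : ℝ) :
    AEStronglyMeasurable (f t) (volume.restrict (Set.Ioi 0)) :=
  ((hf.continuousOn t).mono Set.Ioi_subset_Ici_self).aestronglyMeasurable measurableSet_Ioi

theorem exists_bound (hf : RapidDecay f) (T : ℝ) :
    ∃ C : ℝ, 0 ≤ C ∧ ∀ t r : ℝ, |t| ≤ T → 0 ≤ r → |f t r| ≤ C * (1 + r ^ 2)⁻¹ := by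
  obtain ⟨C, hC, h⟩ := hf.2 T 2
  refine ⟨C, hC, fun t r ht hr => ?_⟩
  rw [← div_eq_mul_inv, le_div_iff₀ (by positivity), mul_comm]
  refine le_trans ?_ (h t r ht hr)
  gcongr
  nlinarith

theorem integrableOn (hf : RapidDecay f) (t : ℝ) : IntegrableOn (f t) (Set.Ioi 0) := by
  obtain ⟨C, -, h⟩ := hf.exists_bound |t|
  refine Integrable.mono' ((integrable_inv_one_add_sq.const_mul C).integrableOn)
    (hf.aestronglyMeasurable t) ?_
  refine (ae_restrict_iff' measurableSet_Ioi).2 (ae_of_all _ fun r hr => ?_)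
  exact h t r le_rfl (le_of_lt hr)

theorem tendsto_zero (hf : RapidDecay f) (t : ℝ) :
    Filter.Tendsto (f t) Filter.atTop (nhds 0) := by
  obtain ⟨C, hC, h⟩ := hf.2 |t| 1
  have h0 : Filter.Tendsto (fun r : ℝ => C / r) Filter.atTop (nhds 0) :=
    Filter.Tendsto.const_div_atTop Filter.tendsto_id C
  refine squeeze_zero_norm' ?_ h0
  filter_upwards [Filter.eventually_gt_atTop 0] with r hr
  rw [Real.norm_eq_abs, le_div_iff₀ hr, mul_comm]
  refine le_trans ?_ (h t r le_rfl hr.le)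
  gcongr
  linarith

theorem hasDerivAt_integral {f' : ℝ → ℝ → ℝ} (hf : RapidDecay f) (hf' : RapidDecay f')
    (hd : ∀ t r, 0 < r → HasDerivAt (fun s => f s r) (f' t r) t) (t : ℝ) :
    HasDerivAt (fun s => ∫ r in Set.Ioi 0, f s r) (∫ r in Set.Ioi 0, f' t r) t := by
  obtain ⟨C, hC, h⟩ := hf'.exists_bound (|t| + 1)
  refine (hasDerivAt_integral_of_dominated_loc_of_deriv_le
    (bound := fun r => C * (1 + r ^ 2)⁻¹) (s := Metric.ball t 1) (Metric.ball_mem_nhds t one_pos)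
    (Filter.Eventually.of_forall fun s => hf.aestronglyMeasurable s) (hf.integrableOn t)
    (hf'.aestronglyMeasurable t) ?_ ((integrable_inv_one_add_sq.const_mul C).integrableOn) ?_).2
  · refine (ae_restrict_iff' measurableSet_Ioi).2 (ae_of_all _ fun r hr s hs => ?_)
    refine h s r ?_ (le_of_lt hr)
    have h1 : |s - t| < 1 := by simpa [Real.dist_eq] using hs
    have h2 := abs_add_le (s - t) t
    rw [sub_add_cancel] at h2
    linarith
  · exact (ae_restrict_iff' measurableSet_Ioi).2 (ae_of_all _ fun r hr s _ => hd s r hr)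

theorem integral_deriv_eq {f' : ℝ → ℝ → ℝ} (hf : RapidDecay f) (hf' : RapidDecay f')
    (hd : ∀ t r, 0 < r → HasDerivAt (f t) (f' t r) r) (t : ℝ) :
    ∫ r in Set.Ioi 0, f' t r = -f t 0 := by
  have := integral_Ioi_of_hasDerivAt_of_tendsto
    (((hf.continuousOn t) 0 Set.self_mem_Ici)) (fun r hr => hd t r hr)
    (hf'.integrableOn t) (hf.tendsto_zero t)
  simpa using this

end RapidDecay

theorem polyWeight_id : PolyWeight (fun r => r) :=
  ⟨continuousOn_id, 1, 1, zero_le_one, fun r hr => by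
    rw [abs_of_nonneg hr, one_mul, pow_one]; linarith⟩

theorem polyWeight_of_bounded {w : ℝ → ℝ} (hc : ContinuousOn w (Set.Ici 0)) (C : ℝ) (hC : 0 ≤ C)
    (h : ∀ r, 0 ≤ r → |w r| ≤ C) : PolyWeight w :=
  ⟨hc, 0, C, hC, fun r hr => by simpa using h r hr⟩

theorem PolyWeight.mul {w z : ℝ → ℝ} (hw : PolyWeight w) (hz : PolyWeight z) :
    PolyWeight (fun r => w r * z r) := by
  obtain ⟨hc, n, C, hC, h⟩ := hw
  obtain ⟨hc', m, D, hD, h'⟩ := hz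
  refine ⟨hc.mul hc', n + m, C * D, by positivity, fun r hr => ?_⟩
  rw [abs_mul, pow_add]
  calc |w r| * |z r| ≤ (C * (1 + r) ^ n) * (D * (1 + r) ^ m) :=
        mul_le_mul (h r hr) (h' r hr) (abs_nonneg _) (by positivity)
    _ = _ := by ring

theorem PolyWeight.pow {w : ℝ → ℝ} (hw : PolyWeight w) (n : ℕ) :
    PolyWeight (fun r => w r ^ (n + 1)) := by
  induction n with
  | zero => simpa using hw
  | succ n ih => simpa only [pow_succ (w _) (n + 1)] using ih.mul hw

theorem polyWeight_const (c : ℝ) : PolyWeight (fun _ => c) :=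
  polyWeight_of_bounded continuousOn_const |c| (abs_nonneg _) (fun _ _ => le_rfl)

/-! ## Radial solutions in polar form -/

/-- The radial profile `f + i g` of a solution of the cubic–quintic equation together with its
radial derivatives.  The evolution is recorded for `r (f + i g)` and its radial derivative. -/
structure RadialFlow where
  /-- real part -/
  f : ℝ → ℝ → ℝ
  /-- first radial derivative of the real part -/
  f1 : ℝ → ℝ → ℝ
  /-- second radial derivative of the real part -/
  f2 : ℝ → ℝ → ℝ
  /-- third radial derivative of the real part -/
  f3 : ℝ → ℝ → ℝ
  /-- imaginary part -/
  g : ℝ → ℝ → ℝ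
  /-- first radial derivative of the imaginary part -/
  g1 : ℝ → ℝ → ℝ
  /-- second radial derivative of the imaginary part -/
  g2 : ℝ → ℝ → ℝ
  /-- third radial derivative of the imaginary part -/
  g3 : ℝ → ℝ → ℝ
  rf : RapidDecay f
  rf1 : RapidDecay f1
  rf2 : RapidDecay f2
  rf3 : RapidDecay f3
  rg : RapidDecay g
  rg1 : RapidDecay g1
  rg2 : RapidDecay g2
  rg3 : RapidDecay g3
  hf : ∀ t r, HasDerivAt (f t) (f1 t r) r
  hf1 : ∀ t r, HasDerivAt (f1 t) (f2 t r) r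
  hf2 : ∀ t r, HasDerivAt (f2 t) (f3 t r) r
  hg : ∀ t r, HasDerivAt (g t) (g1 t r) r
  hg1 : ∀ t r, HasDerivAt (g1 t) (g2 t r) r
  hg2 : ∀ t r, HasDerivAt (g2 t) (g3 t r) r
  f_even : ∀ t r, f t (-r) = f t r
  g_even : ∀ t r, g t (-r) = g t r
  f_dt : ∀ t r, 0 < r → HasDerivAt (fun s => r * f s r)
    (-((2 * g1 t r + r * g2 t r)
      - ((f t r ^ 2 + g t r ^ 2) - (f t r ^ 2 + g t r ^ 2) ^ 2) * (r * g t r))) t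
  g_dt : ∀ t r, 0 < r → HasDerivAt (fun s => r * g s r)
    ((2 * f1 t r + r * f2 t r)
      - ((f t r ^ 2 + g t r ^ 2) - (f t r ^ 2 + g t r ^ 2) ^ 2) * (r * f t r)) t
  f1_dt : ∀ t r, 0 < r → HasDerivAt (fun s => f s r + r * f1 s r)
    (-((3 * g2 t r + r * g3 t r)
      - ((1 - 2 * (f t r ^ 2 + g t r ^ 2)) * (2 * (f t r * f1 t r + g t r * g1 t r)) * (r * g t r)
        + ((f t r ^ 2 + g t r ^ 2) - (f t r ^ 2 + g t r ^ 2) ^ 2) * (g t r + r * g1 t r)))) t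
  g1_dt : ∀ t r, 0 < r → HasDerivAt (fun s => g s r + r * g1 s r)
    ((3 * f2 t r + r * f3 t r)
      - ((1 - 2 * (f t r ^ 2 + g t r ^ 2)) * (2 * (f t r * f1 t r + g t r * g1 t r)) * (r * f t r)
        + ((f t r ^ 2 + g t r ^ 2) - (f t r ^ 2 + g t r ^ 2) ^ 2) * (f t r + r * f1 t r))) t

namespace RadialFlow

variable (S : RadialFlow)

/-- `r f` -/
def a (t r : ℝ) : ℝ := r * S.f t r
/-- `r g` -/
def b (t r : ℝ) : ℝ := r * S.g t r
/-- derivative of `r f` -/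
def a1 (t r : ℝ) : ℝ := S.f t r + r * S.f1 t r
/-- derivative of `r g` -/
def b1 (t r : ℝ) : ℝ := S.g t r + r * S.g1 t r
/-- second derivative of `r f` -/
def a2 (t r : ℝ) : ℝ := 2 * S.f1 t r + r * S.f2 t r
/-- second derivative of `r g` -/
def b2 (t r : ℝ) : ℝ := 2 * S.g1 t r + r * S.g2 t r
/-- third derivative of `r f` -/
def a3 (t r : ℝ) : ℝ := 3 * S.f2 t r + r * S.f3 t r
/-- third derivative of `r g` -/
def b3 (t r : ℝ) : ℝ := 3 * S.g2 t r + r * S.g3 t r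
/-- squared modulus of the profile -/
def q (t r : ℝ) : ℝ := S.f t r ^ 2 + S.g t r ^ 2
/-- radial derivative of the squared modulus -/
def q1 (t r : ℝ) : ℝ := 2 * (S.f t r * S.f1 t r + S.g t r * S.g1 t r)

theorem ra : RapidDecay S.a := S.rf.weight polyWeight_id
theorem rb : RapidDecay S.b := S.rg.weight polyWeight_id
theorem ra1 : RapidDecay S.a1 := S.rf.add (S.rf1.weight polyWeight_id)
theorem rb1 : RapidDecay S.b1 := S.rg.add (S.rg1.weight polyWeight_id)
theorem ra2 : RapidDecay S.a2 := (S.rf1.const_mul 2).add (S.rf2.weight polyWeight_id)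
theorem rb2 : RapidDecay S.b2 := (S.rg1.const_mul 2).add (S.rg2.weight polyWeight_id)
theorem ra3 : RapidDecay S.a3 := (S.rf2.const_mul 3).add (S.rf3.weight polyWeight_id)
theorem rb3 : RapidDecay S.b3 := (S.rg2.const_mul 3).add (S.rg3.weight polyWeight_id)
theorem rq : RapidDecay S.q := (S.rf.pow 1).add (S.rg.pow 1)
theorem rq1 : RapidDecay S.q1 := ((S.rf.mul S.rf1).add (S.rg.mul S.rg1)).const_mul 2

theorem q_nonneg (t r : ℝ) : 0 ≤ S.q t r := by unfold q; positivity

theorem a_sq_add (t r : ℝ) : S.a t r ^ 2 + S.b t r ^ 2 = r ^ 2 * S.q t r := by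
  unfold a b q; ring

theorem dr_a (t r : ℝ) : HasDerivAt (S.a t) (S.a1 t r) r := by
  refine ((hasDerivAt_id r).mul (S.hf t r)).congr_deriv ?_
  simp [a1]
theorem dr_b (t r : ℝ) : HasDerivAt (S.b t) (S.b1 t r) r := by
  refine ((hasDerivAt_id r).mul (S.hg t r)).congr_deriv ?_
  simp [b1]
theorem dr_a1 (t r : ℝ) : HasDerivAt (S.a1 t) (S.a2 t r) r := by
  refine ((S.hf t r).add ((hasDerivAt_id r).mul (S.hf1 t r))).congr_deriv ?_
  simp [a2]; ring
theorem dr_b1 (t r : ℝ) : HasDerivAt (S.b1 t) (S.b2 t r) r := by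
  refine ((S.hg t r).add ((hasDerivAt_id r).mul (S.hg1 t r))).congr_deriv ?_
  simp [b2]; ring
theorem dr_a2 (t r : ℝ) : HasDerivAt (S.a2 t) (S.a3 t r) r := by
  refine (((S.hf1 t r).const_mul 2).add ((hasDerivAt_id r).mul (S.hf2 t r))).congr_deriv ?_
  simp [a3]; ring
theorem dr_b2 (t r : ℝ) : HasDerivAt (S.b2 t) (S.b3 t r) r := by
  refine (((S.hg1 t r).const_mul 2).add ((hasDerivAt_id r).mul (S.hg2 t r))).congr_deriv ?_
  simp [b3]; ring
theorem dr_q (t r : ℝ) : HasDerivAt (S.q t) (S.q1 t r) r := by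
  refine (((S.hf t r).pow 2).add ((S.hg t r).pow 2)).congr_deriv ?_
  simp [q1]; ring

theorem dt_a (t r : ℝ) (hr : 0 < r) : HasDerivAt (fun s => S.a s r)
    (-(S.b2 t r - (S.q t r - S.q t r ^ 2) * S.b t r)) t := S.f_dt t r hr
theorem dt_b (t r : ℝ) (hr : 0 < r) : HasDerivAt (fun s => S.b s r)
    (S.a2 t r - (S.q t r - S.q t r ^ 2) * S.a t r) t := S.g_dt t r hr
theorem dt_a1 (t r : ℝ) (hr : 0 < r) : HasDerivAt (fun s => S.a1 s r)
    (-(S.b3 t r - ((1 - 2 * S.q t r) * S.q1 t r * S.b t r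
      + (S.q t r - S.q t r ^ 2) * S.b1 t r))) t := S.f1_dt t r hr
theorem dt_b1 (t r : ℝ) (hr : 0 < r) : HasDerivAt (fun s => S.b1 s r)
    (S.a3 t r - ((1 - 2 * S.q t r) * S.q1 t r * S.a t r
      + (S.q t r - S.q t r ^ 2) * S.a1 t r)) t := S.g1_dt t r hr

theorem f1_zero (t : ℝ) : S.f1 t 0 = 0 := by
  have h1 := S.hf t 0
  have h2 : HasDerivAt (fun r => S.f t (-r)) (S.f1 t 0 * (-1)) 0 := by
    have h3 : HasDerivAt (S.f t) (S.f1 t 0) (-0) := by simpa using S.hf t 0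
    exact h3.comp (0 : ℝ) (hasDerivAt_neg 0)
  simp only [S.f_even] at h2
  have := h1.unique h2
  linarith

theorem g1_zero (t : ℝ) : S.g1 t 0 = 0 := by
  have h1 := S.hg t 0
  have h2 : HasDerivAt (fun r => S.g t (-r)) (S.g1 t 0 * (-1)) 0 := by
    have h3 : HasDerivAt (S.g t) (S.g1 t 0) (-0) := by simpa using S.hg t 0
    exact h3.comp (0 : ℝ) (hasDerivAt_neg 0)
  simp only [S.g_even] at h2
  have := h1.unique h2
  linarith

/-! ### Densities -/

/-- mass density -/
def rho (t r : ℝ) : ℝ := S.a t r ^ 2 + S.b t r ^ 2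
/-- kinetic density -/
def kin (t r : ℝ) : ℝ := S.a1 t r ^ 2 + S.b1 t r ^ 2
/-- momentum density -/
def mom (t r : ℝ) : ℝ := S.a t r * S.b1 t r - S.b t r * S.a1 t r
/-- quartic density -/
def d4 (t r : ℝ) : ℝ := r ^ 2 * S.q t r ^ 2
/-- sextic density -/
def d6 (t r : ℝ) : ℝ := r ^ 2 * S.q t r ^ 3

theorem rrho : RapidDecay S.rho := (S.ra.pow 1).add (S.rb.pow 1)
theorem rkin : RapidDecay S.kin := (S.ra1.pow 1).add (S.rb1.pow 1)
theorem rmom : RapidDecay S.mom := (S.ra.mul S.rb1).sub (S.rb.mul S.ra1)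
theorem rd4 : RapidDecay S.d4 := (S.rq.pow 1).weight (polyWeight_id.pow 1)
theorem rd6 : RapidDecay S.d6 := (S.rq.pow 2).weight (polyWeight_id.pow 1)

theorem rho_nonneg (t r : ℝ) : 0 ≤ S.rho t r := by unfold rho; positivity
theorem kin_nonneg (t r : ℝ) : 0 ≤ S.kin t r := by unfold kin; positivity
theorem d4_nonneg (t r : ℝ) : 0 ≤ S.d4 t r := by unfold d4; positivity
/-- mass -/
def mass (t : ℝ) : ℝ := ∫ r in Set.Ioi 0, S.rho t r
/-- kinetic energy (times two) -/
def B (t : ℝ) : ℝ := ∫ r in Set.Ioi 0, S.kin t r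
/-- quartic integral -/
def L4 (t : ℝ) : ℝ := ∫ r in Set.Ioi 0, S.d4 t r
/-- sextic integral -/
def L6 (t : ℝ) : ℝ := ∫ r in Set.Ioi 0, S.d6 t r

theorem dt_rho (t r : ℝ) (hr : 0 < r) : HasDerivAt (fun s => S.rho s r)
    (2 * (S.a2 t r * S.b t r - S.b2 t r * S.a t r)) t := by
  refine (((S.dt_a t r hr).pow 2).add ((S.dt_b t r hr).pow 2)).congr_deriv ?_
  simp; ring

theorem dr_mom (t r : ℝ) : HasDerivAt (S.mom t)
    (S.a t r * S.b2 t r - S.b t r * S.a2 t r) r := by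
  refine (((S.dr_a t r).mul (S.dr_b1 t r)).sub ((S.dr_b t r).mul (S.dr_a1 t r))).congr_deriv ?_
  ring

theorem dr_rho (t r : ℝ) : HasDerivAt (S.rho t)
    (2 * (S.a t r * S.a1 t r + S.b t r * S.b1 t r)) r := by
  refine (((S.dr_a t r).pow 2).add ((S.dr_b t r).pow 2)).congr_deriv ?_
  simp; ring

theorem rdt_rho : RapidDecay fun t r => 2 * (S.a2 t r * S.b t r - S.b2 t r * S.a t r) :=
  ((S.ra2.mul S.rb).sub (S.rb2.mul S.ra)).const_mul 2

theorem hasDerivAt_mass (t : ℝ) : HasDerivAt S.mass 0 t := by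
  have h := S.rrho.hasDerivAt_integral S.rdt_rho S.dt_rho t
  refine h.congr_deriv ?_
  have h2 := (S.rmom.const_mul (-2)).integral_deriv_eq S.rdt_rho
    (fun t r _ => ((S.dr_mom t r).const_mul (-2)).congr_deriv (by ring)) t
  rw [h2]; simp [mom, a, b]

theorem mass_eq (t : ℝ) : S.mass t = S.mass 0 :=
  is_const_of_deriv_eq_zero (fun t => (S.hasDerivAt_mass t).differentiableAt)
    (fun t => (S.hasDerivAt_mass t).deriv) t 0

/-- energy density -/
def en (t r : ℝ) : ℝ := 1 / 2 * S.kin t r + (1 / 4 * S.d4 t r - 1 / 6 * S.d6 t r)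

theorem ren : RapidDecay S.en :=
  (S.rkin.const_mul _).add ((S.rd4.const_mul _).sub (S.rd6.const_mul _))

/-- energy flux -/
def enFlux (t r : ℝ) : ℝ := S.b1 t r * (S.a2 t r - (S.q t r - S.q t r ^ 2) * S.a t r)
  - S.a1 t r * (S.b2 t r - (S.q t r - S.q t r ^ 2) * S.b t r)

/-- derivative of the energy flux -/
def enFlux' (t r : ℝ) : ℝ :=
  S.b1 t r * (S.a3 t r - ((1 - 2 * S.q t r) * S.q1 t r * S.a t r
      + (S.q t r - S.q t r ^ 2) * S.a1 t r))
  - S.a1 t r * (S.b3 t r - ((1 - 2 * S.q t r) * S.q1 t r * S.b t r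
      + (S.q t r - S.q t r ^ 2) * S.b1 t r))
  + (S.q t r - S.q t r ^ 2) * (S.b t r * S.a2 t r - S.a t r * S.b2 t r)

theorem rF : RapidDecay fun t r => S.q t r - S.q t r ^ 2 := S.rq.sub (S.rq.pow 1)

theorem rF1 : RapidDecay fun t r => (1 - 2 * S.q t r) * S.q1 t r :=
  (S.rq1.sub ((S.rq.mul S.rq1).const_mul 2)).congr (fun t r _ => by ring)

theorem renFlux : RapidDecay S.enFlux :=
  (S.rb1.mul (S.ra2.sub (S.rF.mul S.ra))).sub (S.ra1.mul (S.rb2.sub (S.rF.mul S.rb)))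

theorem renFlux' : RapidDecay S.enFlux' :=
  ((S.rb1.mul (S.ra3.sub ((S.rF1.mul S.ra).add (S.rF.mul S.ra1)))).sub
    (S.ra1.mul (S.rb3.sub ((S.rF1.mul S.rb).add (S.rF.mul S.rb1))))).add
    (S.rF.mul ((S.rb.mul S.ra2).sub (S.ra.mul S.rb2)))

theorem dr_F (t r : ℝ) : HasDerivAt (fun r => S.q t r - S.q t r ^ 2)
    ((1 - 2 * S.q t r) * S.q1 t r) r := by
  refine ((S.dr_q t r).sub ((S.dr_q t r).pow 2)).congr_deriv ?_
  simp; ring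

theorem dr_enFlux (t r : ℝ) : HasDerivAt (S.enFlux t) (S.enFlux' t r) r := by
  refine (((S.dr_b1 t r).mul ((S.dr_a2 t r).sub ((S.dr_F t r).mul (S.dr_a t r)))).sub
    ((S.dr_a1 t r).mul ((S.dr_b2 t r).sub ((S.dr_F t r).mul (S.dr_b t r))))).congr_deriv ?_
  unfold enFlux'
  simp only [Pi.sub_apply, Pi.mul_apply]; ring

theorem dt_q (t r : ℝ) (hr : 0 < r) : HasDerivAt (fun s => S.q s r)
    (2 * (S.a2 t r * S.b t r - S.b2 t r * S.a t r) / r ^ 2) t := by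
  have h := (S.dt_rho t r hr).div_const (r ^ 2)
  refine h.congr_of_eventuallyEq (Filter.Eventually.of_forall fun s => ?_)
  simp only [rho, a_sq_add]
  field_simp

theorem dt_en (t r : ℝ) (hr : 0 < r) : HasDerivAt (fun s => S.en s r) (S.enFlux' t r) t := by
  have hk := (((S.dt_a1 t r hr).pow 2).add ((S.dt_b1 t r hr).pow 2)).const_mul (1 / 2)
  have h4 := (((S.dt_q t r hr).pow 2).const_mul (r ^ 2)).const_mul (1 / 4)
  have h6 := (((S.dt_q t r hr).pow 3).const_mul (r ^ 2)).const_mul (1 / 6)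
  refine (hk.add (h4.sub h6)).congr_deriv ?_
  unfold enFlux'
  simp
  field_simp
  ring

theorem integral_en (t : ℝ) : ∫ r in Set.Ioi 0, S.en t r
    = 1 / 2 * S.B t + (1 / 4 * S.L4 t - 1 / 6 * S.L6 t) := by
  have h1 := (S.rkin.const_mul (1 / 2)).integrableOn t
  have h2 := (S.rd4.const_mul (1 / 4)).integrableOn t
  have h3 := (S.rd6.const_mul (1 / 6)).integrableOn t
  have : ∫ r in Set.Ioi 0, S.en t r = (∫ r in Set.Ioi 0, 1 / 2 * S.kin t r) +
      ((∫ r in Set.Ioi 0, 1 / 4 * S.d4 t r) - ∫ r in Set.Ioi 0, 1 / 6 * S.d6 t r) := by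
    rw [← integral_sub h2 h3]
    exact integral_add h1 (h2.sub h3)
  rw [this]
  simp only [integral_const_mul]; rfl

theorem hasDerivAt_energy (t : ℝ) :
    HasDerivAt (fun t => ∫ r in Set.Ioi 0, S.en t r) 0 t := by
  refine (S.ren.hasDerivAt_integral S.renFlux' S.dt_en t).congr_deriv ?_
  rw [S.renFlux.integral_deriv_eq S.renFlux' (fun t r _ => S.dr_enFlux t r)]
  simp [enFlux, a, b, a2, b2, f1_zero, g1_zero]

theorem energy_eq (t : ℝ) : 1 / 2 * S.B t + (1 / 4 * S.L4 t - 1 / 6 * S.L6 t)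
    = 1 / 2 * S.B 0 + (1 / 4 * S.L4 0 - 1 / 6 * S.L6 0) := by
  rw [← integral_en, ← integral_en]
  exact is_const_of_deriv_eq_zero (fun t => (S.hasDerivAt_energy t).differentiableAt)
    (fun t => (S.hasDerivAt_energy t).deriv) t 0

theorem hasDerivAt_B (t : ℝ) : ∃ B', HasDerivAt S.B B' t := by
  have hr : RapidDecay fun t r =>
      2 * (S.a1 t r * (-(S.b3 t r - ((1 - 2 * S.q t r) * S.q1 t r * S.b t r
      + (S.q t r - S.q t r ^ 2) * S.b1 t r))) + S.b1 t r *
      (S.a3 t r - ((1 - 2 * S.q t r) * S.q1 t r * S.a t r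
      + (S.q t r - S.q t r ^ 2) * S.a1 t r))) :=
    ((S.ra1.mul (S.rb3.sub ((S.rF1.mul S.rb).add (S.rF.mul S.rb1))).neg).add
      (S.rb1.mul (S.ra3.sub ((S.rF1.mul S.ra).add (S.rF.mul S.ra1))))).const_mul 2
  refine ⟨_, S.rkin.hasDerivAt_integral hr (fun t r h => ?_) t⟩
  refine (((S.dt_a1 t r h).pow 2).add ((S.dt_b1 t r h).pow 2)).congr_deriv ?_
  simp; ring

theorem continuous_B : Continuous S.B :=
  continuous_iff_continuousAt.2 fun t => (S.hasDerivAt_B t).choose_spec.continuousAt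

end RadialFlow

/-! ## The localized virial identity -/

/-- reciprocal of the slowly growing weight `1 + r / R` -/
def hinv (R r : ℝ) : ℝ := (1 + r / R)⁻¹

theorem one_add_div_pos {R r : ℝ} (hR : 0 < R) (hr : 0 ≤ r) : 0 < 1 + r / R := by positivity

theorem hinv_pos {R r : ℝ} (hR : 0 < R) (hr : 0 ≤ r) : 0 < hinv R r :=
  inv_pos.2 (one_add_div_pos hR hr)

theorem hinv_le_one {R r : ℝ} (hR : 0 < R) (hr : 0 ≤ r) : hinv R r ≤ 1 := by
  refine inv_le_one_of_one_le₀ ?_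
  have : 0 ≤ r / R := by positivity
  linarith

theorem hasDerivAt_hinv {R r : ℝ} (hR : 0 < R) (hr : 0 ≤ r) :
    HasDerivAt (hinv R) (-(hinv R r ^ 2 / R)) r := by
  have h := (((hasDerivAt_id r).div_const R).const_add 1).inv (one_add_div_pos hR hr).ne'
  refine h.congr_deriv ?_
  simp only [hinv, id]
  field_simp

theorem polyWeight_hinv {R : ℝ} (hR : 0 < R) : PolyWeight (hinv R) :=
  polyWeight_of_bounded (fun r hr => (hasDerivAt_hinv hR hr).continuousAt.continuousWithinAt) 1
    zero_le_one (fun r hr => by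
      rw [abs_of_pos (hinv_pos hR hr)]; exact hinv_le_one hR hr)

/-- the Laplacian of the virial weight -/
def lapw (R r : ℝ) : ℝ := hinv R r ^ 2 + 2 * hinv R r

theorem lapw_nonneg {R r : ℝ} (hR : 0 < R) (hr : 0 ≤ r) : 0 ≤ lapw R r := by
  have := hinv_pos hR hr; unfold lapw; positivity

theorem polyWeight_lapw {R : ℝ} (hR : 0 < R) : PolyWeight (lapw R) := by
  refine polyWeight_of_bounded ((((polyWeight_hinv hR).pow 1).1).add
    ((polyWeight_const 2).mul (polyWeight_hinv hR)).1) 3 (by norm_num) (fun r hr => ?_)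
  have h0 := hinv_pos hR hr
  have h1 := hinv_le_one hR hr
  rw [abs_of_nonneg (lapw_nonneg hR hr)]
  unfold lapw; nlinarith

namespace RadialFlow

variable (S : RadialFlow)

/-- time derivative of the momentum density -/
def momt (t r : ℝ) : ℝ := S.a t r * S.a3 t r + S.b t r * S.b3 t r - S.a1 t r * S.a2 t r
  - S.b1 t r * S.b2 t r - (1 - 2 * S.q t r) * S.q1 t r * S.rho t r

theorem rmomt : RapidDecay S.momt :=
  ((((S.ra.mul S.ra3).add (S.rb.mul S.rb3)).sub (S.ra1.mul S.ra2)).sub (S.rb1.mul S.rb2)).sub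
    (S.rF1.mul S.rrho)

theorem dt_mom (t r : ℝ) (hr : 0 < r) : HasDerivAt (fun s => S.mom s r) (S.momt t r) t := by
  refine (((S.dt_a t r hr).mul (S.dt_b1 t r hr)).sub
    ((S.dt_b t r hr).mul (S.dt_a1 t r hr))).congr_deriv ?_
  unfold momt rho
  ring

/-- real part of the derivative of `v / h` -/
def w1 (R t r : ℝ) : ℝ := hinv R r * S.a1 t r - hinv R r ^ 2 / R * S.a t r
/-- imaginary part of the derivative of `v / h` -/
def z1 (R t r : ℝ) : ℝ := hinv R r * S.b1 t r - hinv R r ^ 2 / R * S.b t r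
/-- localized kinetic density -/
def kt (R t r : ℝ) : ℝ := S.w1 R t r ^ 2 + S.z1 R t r ^ 2

theorem kt_nonneg (R t r : ℝ) : 0 ≤ S.kt R t r := by unfold kt; positivity

theorem rw1 {R : ℝ} (hR : 0 < R) : RapidDecay (S.w1 R) :=
  (S.ra1.weight (polyWeight_hinv hR)).sub
    ((S.ra.weight (((polyWeight_hinv hR).pow 1).mul (polyWeight_const R⁻¹))))

theorem rz1 {R : ℝ} (hR : 0 < R) : RapidDecay (S.z1 R) :=
  (S.rb1.weight (polyWeight_hinv hR)).sub
    ((S.rb.weight (((polyWeight_hinv hR).pow 1).mul (polyWeight_const R⁻¹))))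

theorem rkt {R : ℝ} (hR : 0 < R) : RapidDecay (S.kt R) :=
  ((S.rw1 hR).pow 1).add ((S.rz1 hR).pow 1)

/-- localized kinetic energy -/
def K (R t : ℝ) : ℝ := ∫ r in Set.Ioi 0, S.kt R t r

/-- density of the virial time derivative -/
def gv (R t r : ℝ) : ℝ := S.kt R t r + hinv R r ^ 4 / (2 * R ^ 2) * S.rho t r
  + lapw R r * (1 / 4 * S.d4 t r - 1 / 3 * S.d6 t r)

theorem rgv {R : ℝ} (hR : 0 < R) : RapidDecay (S.gv R) :=
  ((S.rkt hR).add (S.rrho.weight (((polyWeight_hinv hR).pow 3).mul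
    (polyWeight_const (2 * R ^ 2)⁻¹)))).add
    (((S.rd4.const_mul _).sub (S.rd6.const_mul _)).weight (polyWeight_lapw hR))

/-- virial flux -/
def vFlux (R t r : ℝ) : ℝ :=
  r * hinv R r * (2 / 3 * S.d6 t r - 1 / 2 * S.d4 t r)
  + r * hinv R r * (S.a t r * S.a2 t r + S.b t r * S.b2 t r - S.kin t r)
  - hinv R r ^ 2 * (S.a t r * S.a1 t r + S.b t r * S.b1 t r)
  + hinv R r ^ 3 / R * S.rho t r

theorem polyWeight_drift {R : ℝ} (hR : 0 < R) : PolyWeight (fun r => r * hinv R r) :=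
  polyWeight_id.mul (polyWeight_hinv hR)

theorem rvFlux {R : ℝ} (hR : 0 < R) : RapidDecay (S.vFlux R) :=
  (((((S.rd6.const_mul _).sub (S.rd4.const_mul _)).weight (polyWeight_drift hR)).add
    ((((S.ra.mul S.ra2).add (S.rb.mul S.rb2)).sub S.rkin).weight (polyWeight_drift hR))).sub
    (((S.ra.mul S.ra1).add (S.rb.mul S.rb1)).weight ((polyWeight_hinv hR).pow 1))).add
    (S.rrho.weight (((polyWeight_hinv hR).pow 2).mul (polyWeight_const R⁻¹)))

theorem dr_d4 (t r : ℝ) : HasDerivAt (S.d4 t)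
    (2 * r * S.q t r ^ 2 + r ^ 2 * (2 * S.q t r * S.q1 t r)) r := by
  refine ((hasDerivAt_pow 2 r).mul ((S.dr_q t r).pow 2)).congr_deriv ?_
  simp

theorem dr_d6 (t r : ℝ) : HasDerivAt (S.d6 t)
    (2 * r * S.q t r ^ 3 + r ^ 2 * (3 * S.q t r ^ 2 * S.q1 t r)) r := by
  refine ((hasDerivAt_pow 2 r).mul ((S.dr_q t r).pow 3)).congr_deriv ?_
  simp

theorem dr_vFlux {R : ℝ} (hR : 0 < R) (t r : ℝ) (hr : 0 < r) :
    HasDerivAt (S.vFlux R t) (r * hinv R r * S.momt t r - 2 * S.gv R t r) r := by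
  have hh := hasDerivAt_hinv hR hr.le
  have hA := (hasDerivAt_id r).mul hh
  have hkin : HasDerivAt (S.kin t) (2 * (S.a1 t r * S.a2 t r + S.b1 t r * S.b2 t r)) r := by
    refine (((S.dr_a1 t r).pow 2).add ((S.dr_b1 t r).pow 2)).congr_deriv ?_
    simp; ring
  have h1 := hA.mul (((S.dr_d6 t r).const_mul (2 / 3)).sub ((S.dr_d4 t r).const_mul (1 / 2)))
  have h2 := hA.mul ((((S.dr_a t r).mul (S.dr_a2 t r)).add
    ((S.dr_b t r).mul (S.dr_b2 t r))).sub hkin)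
  have h3 := (hh.pow 2).mul (((S.dr_a t r).mul (S.dr_a1 t r)).add ((S.dr_b t r).mul (S.dr_b1 t r)))
  have h4 := ((hh.pow 3).div_const R).mul (S.dr_rho t r)
  refine (((h1.add h2).sub h3).add h4).congr_deriv ?_
  have hrel : r * hinv R r / R = 1 - hinv R r := by
    unfold hinv; have := (one_add_div_pos hR hr.le).ne'; field_simp; ring
  have hrel2 : r * (hinv R r ^ 2 / R) = hinv R r - hinv R r ^ 2 := by
    linear_combination hinv R r * hrel
  unfold momt gv kt w1 z1 kin lapw d4 d6 rho
  have hq := S.a_sq_add t r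
  simp only [Pi.mul_apply, Pi.sub_apply, Pi.add_apply, Pi.pow_apply, id]
  norm_num only [Nat.cast_ofNat]
  linear_combination (-(2 / 3 * (r ^ 2 * S.q t r ^ 3) - 1 / 2 * (r ^ 2 * S.q t r ^ 2)
    + (S.a t r * S.a2 t r + S.b t r * S.b2 t r - (S.a1 t r ^ 2 + S.b1 t r ^ 2)))) * hrel2
    + (r * hinv R r * ((1 - 2 * S.q t r) * S.q1 t r)) * hq

/-- the localized virial quantity -/
def V (R t : ℝ) : ℝ := ∫ r in Set.Ioi 0, r * hinv R r * S.mom t r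

theorem hasDerivAt_V {R : ℝ} (hR : 0 < R) (t : ℝ) :
    HasDerivAt (S.V R) (2 * ∫ r in Set.Ioi 0, S.gv R t r) t := by
  have h1 := S.rmom.weight (polyWeight_drift hR)
  have h2 := S.rmomt.weight (polyWeight_drift hR)
  refine (h1.hasDerivAt_integral h2 (fun t r hr => (S.dt_mom t r hr).const_mul _) t).congr_deriv ?_
  have h3 := (S.rgv hR).const_mul 2
  have h4 := (S.rvFlux hR).integral_deriv_eq (h2.sub h3) (fun t r hr => S.dr_vFlux hR t r hr) t
  rw [integral_sub (h2.integrableOn t) (h3.integrableOn t), integral_const_mul] at h4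
  have h5 : S.vFlux R t 0 = 0 := by simp [vFlux, a, b, rho]
  rw [h5] at h4
  linarith

/-- the virial weight -/
def vw (R r : ℝ) : ℝ := R * r - R ^ 2 * Real.log (1 + r / R)

theorem hasDerivAt_vw {R r : ℝ} (hR : 0 < R) (hr : 0 ≤ r) :
    HasDerivAt (vw R) (r * hinv R r) r := by
  have hp := one_add_div_pos hR hr
  have h := ((hasDerivAt_id r).const_mul R).sub
    (((((hasDerivAt_id r).div_const R).const_add 1).log hp.ne').const_mul (R ^ 2))
  refine h.congr_deriv ?_
  simp only [id, hinv]
  field_simp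
  ring

theorem vw_zero (R : ℝ) : vw R 0 = 0 := by simp [vw]

theorem continuousOn_vw {R : ℝ} (hR : 0 < R) : ContinuousOn (vw R) (Set.Ici 0) :=
  fun _ hr => (hasDerivAt_vw hR hr).continuousAt.continuousWithinAt

theorem vw_monotone {R : ℝ} (hR : 0 < R) : MonotoneOn (vw R) (Set.Ici 0) := by
  refine monotoneOn_of_deriv_nonneg (convex_Ici 0) (continuousOn_vw hR)
    (fun r hr => ?_) (fun r hr => ?_)
  · rw [interior_Ici] at hr
    exact (hasDerivAt_vw hR (le_of_lt hr)).differentiableAt.differentiableWithinAt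
  · rw [interior_Ici] at hr
    rw [(hasDerivAt_vw hR (le_of_lt hr)).deriv]
    have := hinv_pos hR (le_of_lt hr)
    have h2 : 0 < r := hr
    positivity

theorem vw_nonneg {R r : ℝ} (hR : 0 < R) (hr : 0 ≤ r) : 0 ≤ vw R r := by
  have := vw_monotone hR (Set.self_mem_Ici) hr hr
  rwa [vw_zero] at this

theorem polyWeight_vw {R : ℝ} (hR : 0 < R) : PolyWeight (vw R) := by
  refine ⟨continuousOn_vw hR, 1, R, hR.le, fun r hr => ?_⟩
  rw [abs_of_nonneg (vw_nonneg hR hr)]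
  have : 0 ≤ r / R := by positivity
  have : 0 ≤ Real.log (1 + r / R) := Real.log_nonneg (by linarith)
  unfold vw
  nlinarith [mul_nonneg (sq_nonneg R) this]

/-- Morawetz-type weight tends to infinity -/
theorem tendsto_vw {R : ℝ} (hR : 0 < R) : Filter.Tendsto (vw R) Filter.atTop Filter.atTop := by
  have h1 : Filter.Tendsto (fun r : ℝ => 1 + r / R) Filter.atTop Filter.atTop :=
    Filter.tendsto_atTop_add_const_left _ _ (Filter.tendsto_id.atTop_div_const hR)
  have h2 : Filter.Tendsto (fun x : ℝ => x - Real.log x) Filter.atTop Filter.atTop := by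
    refine Filter.tendsto_atTop_mono' _ ?_ (Filter.tendsto_id.atTop_div_const (two_pos))
    filter_upwards [Filter.eventually_gt_atTop 0] with x hx
    have := Real.log_le_sub_one_of_pos (x := x / 2) (by positivity)
    rw [Real.log_div hx.ne' two_ne_zero] at this
    have h3 := Real.log_two_lt_d9
    simp only [id]
    linarith
  have h3 := ((h2.comp h1).const_mul_atTop (sq_pos_of_pos hR))
  refine Filter.tendsto_atTop_mono' _ ?_ (Filter.tendsto_atTop_add_const_right _ (-R ^ 2) h3)
  filter_upwards with r
  simp only [Function.comp, vw]
  field_simp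
  ring_nf
  exact le_rfl

theorem hasDerivAt_Y {R : ℝ} (hR : 0 < R) (t : ℝ) :
    HasDerivAt (fun t => ∫ r in Set.Ioi 0, vw R r * S.rho t r) (2 * S.V R t) t := by
  have h1 := S.rrho.weight (polyWeight_vw hR)
  have h2 := S.rdt_rho.weight (polyWeight_vw hR)
  refine (h1.hasDerivAt_integral h2 (fun t r hr => (S.dt_rho t r hr).const_mul _) t).congr_deriv ?_
  have h3 := (S.rmom.weight (polyWeight_drift hR)).const_mul 2
  have h4 : RapidDecay (fun t r => -2 * (vw R r * S.mom t r)) :=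
    (S.rmom.weight (polyWeight_vw hR)).const_mul (-2)
  have h5 := h4.integral_deriv_eq (h2.sub h3) (fun t r hr => by
    refine (((hasDerivAt_vw hR hr.le).mul (S.dr_mom t r)).const_mul (-2)).congr_deriv ?_
    ring) t
  rw [integral_sub (h2.integrableOn t) (h3.integrableOn t), integral_const_mul] at h5
  simp only [vw_zero, zero_mul, mul_zero, neg_zero] at h5
  unfold V
  linarith

theorem K_le_B {R : ℝ} (hR : 0 < R) (t : ℝ) : S.K R t ≤ S.B t := by
  have h1 : RapidDecay (fun t r => hinv R r ^ 3 / R * S.rho t r) :=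
    S.rrho.weight (((polyWeight_hinv hR).pow 2).mul (polyWeight_const R⁻¹))
  have h2 : RapidDecay (fun t r => -(3 * hinv R r ^ 4 / R ^ 2) * S.rho t r
      + hinv R r ^ 3 / R * (2 * (S.a t r * S.a1 t r + S.b t r * S.b1 t r))) := by
    refine RapidDecay.add ?_ ?_
    · exact (S.rrho.weight (((polyWeight_hinv hR).pow 3).mul (polyWeight_const
        (-3 / R ^ 2)))).congr (fun t r _ => by ring)
    · exact (((S.ra.mul S.ra1).add (S.rb.mul S.rb1)).const_mul 2).weight
        (((polyWeight_hinv hR).pow 2).mul (polyWeight_const R⁻¹))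
  have h3 := h1.integral_deriv_eq h2 (fun t r hr => by
    have hh := hasDerivAt_hinv hR hr.le
    refine (((hh.pow 3).div_const R).mul (S.dr_rho t r)).congr_deriv ?_
    simp; ring) t
  have h4 : S.K R t ≤ ∫ r in Set.Ioi 0, (S.kin t r - (-(3 * hinv R r ^ 4 / R ^ 2) * S.rho t r
      + hinv R r ^ 3 / R * (2 * (S.a t r * S.a1 t r + S.b t r * S.b1 t r)))) := by
    refine setIntegral_mono_on ((S.rkt hR).integrableOn t) ((S.rkin.sub h2).integrableOn t)
      measurableSet_Ioi (fun r hr => ?_)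
    have hr' : (0:ℝ) ≤ r := le_of_lt hr
    have h5 := hinv_pos hR hr'
    have h6 := hinv_le_one hR hr'
    have h7 : 0 ≤ (1 - hinv R r ^ 2) * S.kin t r :=
      mul_nonneg (by nlinarith) (S.kin_nonneg t r)
    have h8 : 0 ≤ hinv R r ^ 4 / R ^ 2 * S.rho t r :=
      mul_nonneg (by positivity) (S.rho_nonneg t r)
    have h9 : S.kin t r - (-(3 * hinv R r ^ 4 / R ^ 2) * S.rho t r
      + hinv R r ^ 3 / R * (2 * (S.a t r * S.a1 t r + S.b t r * S.b1 t r))) - S.kt R t r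
      = (1 - hinv R r ^ 2) * S.kin t r + 2 * (hinv R r ^ 4 / R ^ 2 * S.rho t r) := by
      unfold kt w1 z1 kin rho; ring
    linarith
  rw [integral_sub (S.rkin.integrableOn t) (h2.integrableOn t), h3] at h4
  have h5 : S.rho t 0 = 0 := by simp [rho, a, b]
  rw [h5] at h4
  simpa [B] using h4

end RadialFlow

/-! ## Variational trapping -/

/-- the radial kinetic energy of the ground state -/
def sob : ℝ := 3 * √3 * Real.pi / 16

theorem sob_pos : 0 < sob := by unfold sob; positivity

theorem sob_sq : sob ^ 2 = 27 * Real.pi ^ 2 / 256 := by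
  unfold sob
  have : √3 ^ 2 = (3:ℝ) := Real.sq_sqrt (by norm_num)
  rw [div_pow, mul_pow, mul_pow, this]; ring

theorem hasDerivAt_pair {p s : ℝ → ℝ} {w z r : ℝ} (hr : 0 < r)
    (hp : HasDerivAt (fun r => r * p r) w r) (hs : HasDerivAt (fun r => r * s r) z r) :
    HasDerivAt (fun r => r * (p r ^ 2 + s r ^ 2))
      ((2 * (r * p r * w + r * s r * z) - r * (p r ^ 2 + s r ^ 2)) / r) r := by
  have h := ((hp.pow 2).add (hs.pow 2)).div (hasDerivAt_id r) hr.ne'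
  have h2 : HasDerivAt (fun r => r * (p r ^ 2 + s r ^ 2)) _ r := h.congr_of_eventuallyEq (by
    filter_upwards [lt_mem_nhds hr] with x hx
    simp only [Pi.add_apply, Pi.pow_apply, id, Pi.div_apply]
    field_simp)
  refine h2.congr_deriv ?_
  simp only [Pi.add_apply, Pi.pow_apply, id]
  field_simp
  norm_num
  ring

theorem pair_le {p s w z e r : ℝ} (hr : 0 < r)
    (hle : (r * p * w + r * s * z) ^ 2 ≤ ((r * p) ^ 2 + (r * s) ^ 2) * e) :
    (r * ((2 * (r * p * w + r * s * z) - r * (p ^ 2 + s ^ 2)) / r) + r * (p ^ 2 + s ^ 2)) ^ 2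
      ≤ 4 * r * (r * (p ^ 2 + s ^ 2)) * e := by
  rw [mul_div_cancel₀ _ hr.ne']
  nlinarith

theorem sobolev_pair {p s w z e : ℝ → ℝ}
    (hp : ∀ r, 0 < r → HasDerivAt (fun r => r * p r) (w r) r)
    (hs : ∀ r, 0 < r → HasDerivAt (fun r => r * s r) (z r) r)
    (hpc : ContinuousOn p (Set.Ici 0)) (hsc : ContinuousOn s (Set.Ici 0))
    (hle : ∀ r, 0 < r → (r * p r * w r + r * s r * z r) ^ 2
      ≤ ((r * p r) ^ 2 + (r * s r) ^ 2) * e r)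
    (he : ∀ r, 0 < r → 0 ≤ e r) (hei : IntegrableOn e (Set.Ioi 0))
    (hN : IntegrableOn (fun r => r ^ 2 * (p r ^ 2 + s r ^ 2) ^ 3) (Set.Ioi 0))
    (hlim : Filter.Tendsto (fun r => r * (p r ^ 2 + s r ^ 2)) Filter.atTop (nhds 0)) :
    sob ^ 2 * (∫ r in Set.Ioi 0, r ^ 2 * (p r ^ 2 + s r ^ 2) ^ 3) ≤ (∫ r in Set.Ioi 0, e r) ^ 3 := by
  have heq : Set.EqOn (fun r => r ^ 2 * (p r ^ 2 + s r ^ 2) ^ 3)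
      (fun r => (r * (p r ^ 2 + s r ^ 2)) ^ 3 / r) (Set.Ioi 0) := by
    intro r hr
    have : (0:ℝ) < r := hr
    simp only
    field_simp
  rw [sob_sq, setIntegral_congr_fun measurableSet_Ioi heq]
  exact weighted_sobolev (G := fun r => r * (p r ^ 2 + s r ^ 2))
    (fun r hr => mul_nonneg hr (by positivity))
    (fun r hr => hasDerivAt_pair hr (hp r hr) (hs r hr)) (fun r hr => pair_le hr (hle r hr)) he hei
    (hN.congr_fun heq measurableSet_Ioi) (continuousOn_id.mul ((hpc.pow 2).add (hsc.pow 2)))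
    (by simp) hlim

theorem le_integral_of_weighted {G G' e : ℝ → ℝ} (hG0 : ∀ r, 0 ≤ r → 0 ≤ G r)
    (hd : ∀ r, 0 < r → HasDerivAt G (G' r) r)
    (hle : ∀ r, 0 < r → (r * G' r + G r) ^ 2 ≤ 4 * r * G r * e r)
    (he : ∀ r, 0 < r → 0 ≤ e r) (hei : IntegrableOn e (Set.Ioi 0))
    (hc : ContinuousOn G (Set.Ici 0)) (h00 : G 0 = 0) (r : ℝ) (hr : 0 ≤ r) :
    G r ≤ ∫ r in Set.Ioi 0, e r := by
  have h1 : G r - G 0 ≤ ∫ x in (0:ℝ)..r, e x := by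
    refine intervalIntegral.sub_le_integral_of_hasDeriv_right_of_le hr
      (hc.mono (fun x hx => hx.1)) (fun x hx => (hd x hx.1).hasDerivWithinAt) ?_ (fun x hx => ?_)
    · rw [integrableOn_Icc_iff_integrableOn_Ioc]
      exact hei.mono_set (fun x hx => hx.1)
    · have hx0 : 0 < x := hx.1
      have hl := hle x hx0
      rcases (hG0 x hx0.le).eq_or_lt with h | h
      · rw [← h] at hl
        have h2 : x * G' x = 0 := by nlinarith [sq_nonneg (x * G' x)]
        rcases mul_eq_zero.1 h2 with h3 | h3
        · linarith
        · rw [h3]; exact he x hx0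
      · have h4 : (x * G' x) * (4 * G x) ≤ (x * e x) * (4 * G x) := by
          nlinarith [sq_nonneg (x * G' x - G x)]
        have h5 := le_of_mul_le_mul_right h4 (by positivity)
        exact le_of_mul_le_mul_left h5 hx0
  rw [h00, sub_zero] at h1
  refine h1.trans ?_
  rw [intervalIntegral.integral_of_le hr]
  exact setIntegral_mono_set hei ((ae_restrict_iff' measurableSet_Ioi).2 (ae_of_all _ he))
    (ae_of_all _ (fun x hx => hx.1))

namespace RadialFlow

variable (S : RadialFlow)

theorem rrq : RapidDecay (fun t r => r * S.q t r) := S.rq.weight polyWeight_id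

theorem integral_d6_le {e : ℝ → ℝ} (t : ℝ)
    (hle : ∀ r, 0 < r → (S.a t r * S.a1 t r + S.b t r * S.b1 t r) ^ 2 ≤ S.rho t r * e r)
    (he : ∀ r, 0 < r → 0 ≤ e r) (hei : IntegrableOn e (Set.Ioi 0)) :
    sob ^ 2 * S.L6 t ≤ (∫ r in Set.Ioi 0, e r) ^ 3 :=
  sobolev_pair (p := S.f t) (s := S.g t) (fun r _ => S.dr_a t r) (fun r _ => S.dr_b t r)
    (S.rf.continuousOn t) (S.rg.continuousOn t) hle he hei (S.rd6.integrableOn t)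
    (S.rrq.tendsto_zero t)

theorem cauchy_schwarz_pair (a b c d : ℝ) :
    (a * c + b * d) ^ 2 ≤ (a ^ 2 + b ^ 2) * (c ^ 2 + d ^ 2) := by
  nlinarith [sq_nonneg (a * d - b * c)]

theorem L6_le (t : ℝ) : sob ^ 2 * S.L6 t ≤ S.B t ^ 3 :=
  S.integral_d6_le t (fun _ _ => cauchy_schwarz_pair _ _ _ _) (fun r _ => S.kin_nonneg t r)
    (S.rkin.integrableOn t)

theorem mul_q_le_B (t r : ℝ) (hr : 0 ≤ r) : r * S.q t r ≤ S.B t :=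
  le_integral_of_weighted (fun r hr => mul_nonneg hr (S.q_nonneg t r))
    (fun r hr => hasDerivAt_pair hr (S.dr_a t r) (S.dr_b t r))
    (fun r hr => pair_le hr (cauchy_schwarz_pair _ _ _ _)) (fun r _ => S.kin_nonneg t r)
    (S.rkin.integrableOn t) (S.rrq.continuousOn t) (by simp) r hr

theorem dr_loc_a {R : ℝ} (hR : 0 < R) (t r : ℝ) (hr : 0 < r) :
    HasDerivAt (fun r => r * (hinv R r * S.f t r)) (S.w1 R t r) r := by
  have h := (hasDerivAt_hinv hR hr.le).mul (S.dr_a t r)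
  have h2 : HasDerivAt (fun r => r * (hinv R r * S.f t r)) _ r :=
    h.congr_of_eventuallyEq (Filter.Eventually.of_forall fun x => by
      simp only [a, Pi.mul_apply]; ring)
  refine h2.congr_deriv ?_
  unfold w1; ring

theorem dr_loc_b {R : ℝ} (hR : 0 < R) (t r : ℝ) (hr : 0 < r) :
    HasDerivAt (fun r => r * (hinv R r * S.g t r)) (S.z1 R t r) r := by
  have h := (hasDerivAt_hinv hR hr.le).mul (S.dr_b t r)
  have h2 : HasDerivAt (fun r => r * (hinv R r * S.g t r)) _ r :=
    h.congr_of_eventuallyEq (Filter.Eventually.of_forall fun x => by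
      simp only [b, Pi.mul_apply]; ring)
  refine h2.congr_deriv ?_
  unfold z1; ring

theorem rlocf {R : ℝ} (hR : 0 < R) : RapidDecay (fun t r => hinv R r * S.f t r) :=
  S.rf.weight (polyWeight_hinv hR)

theorem rlocg {R : ℝ} (hR : 0 < R) : RapidDecay (fun t r => hinv R r * S.g t r) :=
  S.rg.weight (polyWeight_hinv hR)

theorem rlocq {R : ℝ} (hR : 0 < R) :
    RapidDecay (fun t r => (hinv R r * S.f t r) ^ 2 + (hinv R r * S.g t r) ^ 2) :=
  ((S.rlocf hR).pow 1).add ((S.rlocg hR).pow 1)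

theorem locq_eq (R t r : ℝ) : (hinv R r * S.f t r) ^ 2 + (hinv R r * S.g t r) ^ 2
    = hinv R r ^ 2 * S.q t r := by unfold q; ring

theorem loc_q_le {R : ℝ} (hR : 0 < R) (t r : ℝ) (hr : 0 ≤ r) :
    r * (hinv R r ^ 2 * S.q t r) ≤ S.K R t := by
  have := le_integral_of_weighted
    (G := fun r => r * ((hinv R r * S.f t r) ^ 2 + (hinv R r * S.g t r) ^ 2))
    (fun r hr => mul_nonneg hr (by positivity))
    (fun r hr => hasDerivAt_pair hr (S.dr_loc_a hR t r hr) (S.dr_loc_b hR t r hr))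
    (fun r hr => pair_le hr (cauchy_schwarz_pair _ _ _ _)) (fun r _ => S.kt_nonneg R t r)
    ((S.rkt hR).integrableOn t) (((S.rlocq hR).weight polyWeight_id).continuousOn t) (by simp) r hr
  simp only [locq_eq] at this
  exact this

theorem loc_L6_le {R : ℝ} (hR : 0 < R) (t : ℝ) :
    sob ^ 2 * (∫ r in Set.Ioi 0, hinv R r ^ 6 * S.d6 t r) ≤ S.K R t ^ 3 := by
  have h := sobolev_pair (fun r hr => S.dr_loc_a hR t r hr) (fun r hr => S.dr_loc_b hR t r hr)
    ((S.rlocf hR).continuousOn t) ((S.rlocg hR).continuousOn t)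
    (fun r _ => cauchy_schwarz_pair _ _ _ _) (fun r _ => S.kt_nonneg R t r)
    ((S.rkt hR).integrableOn t) ((((S.rlocq hR).pow 2).weight (polyWeight_id.pow 1)).integrableOn t)
    (((S.rlocq hR).weight polyWeight_id).tendsto_zero t)
  refine le_trans (le_of_eq ?_) h
  congr 2
  ext r
  rw [locq_eq]; unfold d6; ring

theorem rho_le (t r : ℝ) (hr : 0 ≤ r) : S.rho t r ≤ S.mass t + S.B t := by
  have hi : IntegrableOn (fun x => S.rho t x + S.kin t x) (Set.Ioi 0) :=
    (S.rrho.add S.rkin).integrableOn t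
  have h1 : S.rho t r - S.rho t 0 ≤ ∫ x in (0:ℝ)..r, (S.rho t x + S.kin t x) := by
    refine intervalIntegral.sub_le_integral_of_hasDeriv_right_of_le hr
      ((S.rrho.continuousOn t).mono (fun x hx => hx.1))
      (fun x _ => (S.dr_rho t x).hasDerivWithinAt) ?_ (fun x hx => ?_)
    · rw [integrableOn_Icc_iff_integrableOn_Ioc]
      exact hi.mono_set (fun x hx => hx.1)
    · unfold rho kin
      nlinarith [sq_nonneg (S.a t x - S.a1 t x), sq_nonneg (S.b t x - S.b1 t x)]
  have h0 : S.rho t 0 = 0 := by simp [rho, a, b]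
  rw [h0, sub_zero, intervalIntegral.integral_of_le hr] at h1
  refine h1.trans ?_
  unfold mass B
  rw [← integral_add (S.rrho.integrableOn t) (S.rkin.integrableOn t)]
  exact setIntegral_mono_set hi ((ae_restrict_iff' measurableSet_Ioi).2 (ae_of_all _ fun x _ =>
    add_nonneg (S.rho_nonneg t x) (S.kin_nonneg t x))) (ae_of_all _ (fun x hx => hx.1))

theorem mass_nonneg (t : ℝ) : 0 ≤ S.mass t :=
  setIntegral_nonneg measurableSet_Ioi (fun r _ => S.rho_nonneg t r)
theorem B_nonneg (t : ℝ) : 0 ≤ S.B t :=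
  setIntegral_nonneg measurableSet_Ioi (fun r _ => S.kin_nonneg t r)
theorem L4_nonneg (t : ℝ) : 0 ≤ S.L4 t :=
  setIntegral_nonneg measurableSet_Ioi (fun r _ => S.d4_nonneg t r)
theorem K_nonneg (R t : ℝ) : 0 ≤ S.K R t :=
  setIntegral_nonneg measurableSet_Ioi (fun r _ => S.kt_nonneg R t r)

/-- threshold energy and subcritical gradient -/
def Threshold : Prop :=
  1 / 2 * S.B 0 + (1 / 4 * S.L4 0 - 1 / 6 * S.L6 0) = sob / 3 ∧ S.B 0 < sob

theorem q_ae_zero_of_L4 (t : ℝ) (h : S.L4 t = 0) :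
    ∀ᵐ r ∂(volume.restrict (Set.Ioi (0:ℝ))), S.q t r = 0 := by
  have h1 := (setIntegral_eq_zero_iff_of_nonneg_ae (μ := volume) (s := Set.Ioi (0:ℝ))
    (ae_of_all _ fun r => S.d4_nonneg t r) (S.rd4.integrableOn t)).1 h
  have h2 := ae_restrict_mem (μ := volume) (measurableSet_Ioi (a := (0:ℝ)))
  filter_upwards [h1, h2] with r hr hr0
  have hr0' : (0:ℝ) < r := hr0
  simpa [d4, hr0'.ne'] using hr

theorem q_ae_zero_of_mass (t : ℝ) (h : S.mass t = 0) :
    ∀ᵐ r ∂(volume.restrict (Set.Ioi (0:ℝ))), S.a t r = 0 ∧ S.b t r = 0 := by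
  have h1 := (setIntegral_eq_zero_iff_of_nonneg_ae (μ := volume) (s := Set.Ioi (0:ℝ))
    (ae_of_all _ fun r => S.rho_nonneg t r) (S.rrho.integrableOn t)).1 h
  filter_upwards [h1] with r hr
  have h2 : S.a t r ^ 2 + S.b t r ^ 2 = 0 := hr
  constructor <;> nlinarith [sq_nonneg (S.a t r), sq_nonneg (S.b t r)]

variable {S}

namespace Threshold

theorem energy (h : S.Threshold) (t : ℝ) :
    1 / 2 * S.B t + (1 / 4 * S.L4 t - 1 / 6 * S.L6 t) = sob / 3 := by
  rw [S.energy_eq t]; exact h.1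

theorem B_ne (h : S.Threshold) (t : ℝ) : S.B t ≠ sob := by
  intro hB
  have h1 := h.energy t
  have h2 := S.L6_le t
  have hs := sob_pos
  rw [hB] at h1 h2
  have h3 : S.L6 t ≤ sob := by
    have : sob ^ 2 * S.L6 t ≤ sob ^ 2 * sob := by linarith [pow_succ sob 2]
    exact le_of_mul_le_mul_left this (by positivity)
  have h4 : S.L4 t = 0 := le_antisymm (by linarith) (S.L4_nonneg t)
  have h5 : S.L6 t = 0 := by
    have := S.q_ae_zero_of_L4 t h4
    unfold L6
    refine integral_eq_zero_of_ae ?_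
    filter_upwards [this] with r hr
    simp [d6, hr]
  rw [h4, h5] at h1
  linarith

theorem B_lt (h : S.Threshold) (t : ℝ) : S.B t < sob := by
  by_contra hlt
  push Not at hlt
  have := mem_range_of_exists_le_of_exists_ge S.continuous_B ⟨0, h.2.le⟩ ⟨t, hlt⟩
  obtain ⟨s, hs⟩ := this
  exact h.B_ne s hs

theorem L6_le_sob (h : S.Threshold) (t : ℝ) : S.L6 t ≤ sob := by
  have h2 := S.L6_le t
  have hs := sob_pos
  have h3 : S.B t ^ 3 ≤ sob ^ 3 := pow_le_pow_left₀ (S.B_nonneg t) (h.B_lt t).le 3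
  have : sob ^ 2 * S.L6 t ≤ sob ^ 2 * sob := by linarith [pow_succ sob 2]
  exact le_of_mul_le_mul_left this (by positivity)

theorem L4_le (h : S.Threshold) (t : ℝ) : S.L4 t ≤ 2 * sob := by
  have h1 := h.energy t
  have h2 := h.L6_le_sob t
  have := S.B_nonneg t
  linarith

theorem mass_pos (h : S.Threshold) : 0 < S.mass 0 := by
  refine lt_of_le_of_ne (S.mass_nonneg 0) (fun h0 => ?_)
  have h1 := S.q_ae_zero_of_mass 0 h0.symm
  have hr : RapidDecay (fun t r => S.a t r * S.a1 t r + S.b t r * S.b1 t r) :=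
    (S.ra.mul S.ra1).add (S.rb.mul S.rb1)
  have hr2 : RapidDecay (fun t r => S.a t r * S.a2 t r + S.b t r * S.b2 t r) :=
    (S.ra.mul S.ra2).add (S.rb.mul S.rb2)
  have h2 := hr.integral_deriv_eq (S.rkin.add hr2) (fun t r _ => by
    refine (((S.dr_a t r).mul (S.dr_a1 t r)).add ((S.dr_b t r).mul (S.dr_b1 t r))).congr_deriv ?_
    unfold kin; ring) 0
  rw [integral_add (S.rkin.integrableOn 0) (hr2.integrableOn 0)] at h2
  have h3 : ∫ r in Set.Ioi 0, (S.a 0 r * S.a2 0 r + S.b 0 r * S.b2 0 r) = 0 := by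
    refine integral_eq_zero_of_ae ?_
    filter_upwards [h1] with r hr
    simp [hr.1, hr.2]
  have h4 : S.L4 0 = 0 := by
    refine integral_eq_zero_of_ae ?_
    have h2 := ae_restrict_mem (μ := volume) (measurableSet_Ioi (a := (0:ℝ)))
    filter_upwards [h1, h2] with r hr hr0
    have hr0' : (0:ℝ) < r := hr0
    have h5 := S.a_sq_add 0 r
    rw [hr.1, hr.2] at h5
    have : S.q 0 r = 0 := by
      have : r ^ 2 * S.q 0 r = 0 := by linarith
      exact (mul_eq_zero.1 this).resolve_left (by positivity)
    simp [d4, this]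
  have h5 : S.L6 0 = 0 := by
    have := S.q_ae_zero_of_L4 0 h4
    refine integral_eq_zero_of_ae ?_
    filter_upwards [this] with r hr
    simp [d6, hr]
  have h6 : S.B 0 = 0 := by
    rw [h3] at h2
    have : S.a 0 0 = 0 := by simp [a]
    have hb : S.b 0 0 = 0 := by simp [b]
    rw [this, hb, add_zero, zero_mul, zero_mul, add_zero, neg_zero] at h2
    exact h2
  have h7 := h.1
  have := sob_pos
  rw [h4, h5, h6] at h7
  linarith

end Threshold

end RadialFlow

/-! ## Virial monotonicity and its consequences -/

theorem hinv_antitone {R r s : ℝ} (hR : 0 < R) (hr : 0 ≤ r) (h : r ≤ s) : hinv R s ≤ hinv R r := by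
  unfold hinv
  have := one_add_div_pos hR hr
  gcongr

theorem lapw_antitone {R r s : ℝ} (hR : 0 < R) (hr : 0 ≤ r) (h : r ≤ s) : lapw R s ≤ lapw R r := by
  have h1 := hinv_antitone hR hr h
  have h2 := hinv_pos hR (hr.trans h)
  unfold lapw
  gcongr

theorem lapw_pos {R r : ℝ} (hR : 0 < R) (hr : 0 ≤ r) : 0 < lapw R r := by
  have := hinv_pos hR hr; unfold lapw; positivity

theorem drift_le {R r : ℝ} (hR : 0 < R) (hr : 0 ≤ r) : r * hinv R r ≤ R := by
  unfold hinv
  have := one_add_div_pos hR hr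
  rw [← div_eq_mul_inv, div_le_iff₀ this, mul_add, mul_div_cancel₀ _ hR.ne']
  linarith

theorem virial_pointwise {R r q c : ℝ} (hR : 0 < R) (hr : 0 ≤ r) (hq : 0 ≤ q) (hc : r * q ≤ c)
    (hRc : 13 * c ≤ R) :
    (lapw R r / 3 - hinv R r ^ 6) * q ≤ 1 / 8 * lapw R r := by
  have hH := hinv_pos hR hr
  have hH1 := hinv_le_one hR hr
  set H := hinv R r with hHdef
  have hs : 0 ≤ r / R := by positivity
  set s := r / R with hsdef
  have hrel : H * (1 + s) = 1 := by
    rw [hHdef, hinv]; exact inv_mul_cancel₀ (one_add_div_pos hR hr).ne'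
  have hsq : s * q ≤ 1 / 13 := by
    rw [hsdef, div_mul_eq_mul_div, div_le_iff₀ hR]; linarith
  have hl : lapw R r = H ^ 2 * (3 + 2 * s) := by
    unfold lapw; rw [← hHdef]
    linear_combination (-2 * H) * hrel
  have h4 : 1 - H ^ 4 ≤ 4 * s := by
    have e1 : 1 - H = s * H := by linarith
    have e2 : (1 + H) * (1 + H ^ 2) ≤ 4 := by nlinarith
    have e3 : 1 - H ^ 4 = (s * H) * ((1 + H) * (1 + H ^ 2)) := by rw [← e1]; ring
    rw [e3]
    have e4 : s * H ≤ s := by nlinarith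
    have e5 : 0 ≤ s * H := by positivity
    nlinarith
  have e6 : lapw R r / 3 - H ^ 6 ≤ H ^ 2 * (14 / 3 * s) := by
    rw [hl]; nlinarith [sq_nonneg H]
  calc (lapw R r / 3 - H ^ 6) * q ≤ H ^ 2 * (14 / 3 * s) * q := by gcongr
    _ = H ^ 2 * (14 / 3) * (s * q) := by ring
    _ ≤ H ^ 2 * (14 / 3) * (1 / 13) := by gcongr
    _ ≤ 1 / 8 * lapw R r := by rw [hl]; nlinarith [sq_nonneg H, mul_nonneg (sq_nonneg H) hs]

namespace RadialFlow

variable {S : RadialFlow}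

/-- weighted quartic integral controlled by the virial identity -/
def I4 (S : RadialFlow) (R t : ℝ) : ℝ := ∫ r in Set.Ioi 0, lapw R r * S.d4 t r

theorem I4_nonneg {R : ℝ} (hR : 0 < R) (t : ℝ) : 0 ≤ S.I4 R t :=
  setIntegral_nonneg measurableSet_Ioi (fun r hr =>
    mul_nonneg (lapw_nonneg hR (le_of_lt hr)) (S.d4_nonneg t r))

namespace Threshold

theorem gv_lower (h : S.Threshold) {R : ℝ} (hR : 13 * sob ≤ R) (t : ℝ) :
    S.K R t * ((sob - S.B t) / sob) + 1 / 8 * S.I4 R t ≤ ∫ r in Set.Ioi 0, S.gv R t r := by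
  have hs := sob_pos
  have hR0 : 0 < R := by linarith
  have r1 : RapidDecay (fun t r => hinv R r ^ 6 * S.d6 t r) :=
    S.rd6.weight ((polyWeight_hinv hR0).pow 5)
  have r2 : RapidDecay (fun t r => 1 / 8 * (lapw R r * S.d4 t r)) :=
    (S.rd4.weight (polyWeight_lapw hR0)).const_mul _
  have r3 := ((S.rkt hR0).sub r1).add r2
  have h1 : ∫ r in Set.Ioi 0, (S.kt R t r - hinv R r ^ 6 * S.d6 t r
      + 1 / 8 * (lapw R r * S.d4 t r)) ≤ ∫ r in Set.Ioi 0, S.gv R t r := by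
    refine setIntegral_mono_on (r3.integrableOn t) ((S.rgv hR0).integrableOn t)
      measurableSet_Ioi (fun r hr => ?_)
    have hr' : (0:ℝ) ≤ r := le_of_lt hr
    have hv := virial_pointwise hR0 hr' (S.q_nonneg t r)
      ((S.mul_q_le_B t r hr').trans (h.B_lt t).le) hR
    have hv2 := mul_le_mul_of_nonneg_right hv (S.d4_nonneg t r)
    have e1 : S.d6 t r = S.q t r * S.d4 t r := by unfold d6 d4; ring
    have e2 : 0 ≤ hinv R r ^ 4 / (2 * R ^ 2) * S.rho t r :=
      mul_nonneg (by positivity) (S.rho_nonneg t r)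
    unfold gv
    rw [e1]
    nlinarith
  have h2 : ∫ r in Set.Ioi 0, (S.kt R t r - hinv R r ^ 6 * S.d6 t r
      + 1 / 8 * (lapw R r * S.d4 t r)) = S.K R t
      - (∫ r in Set.Ioi 0, hinv R r ^ 6 * S.d6 t r) + 1 / 8 * S.I4 R t := by
    rw [integral_add (((S.rkt hR0).sub r1).integrableOn t) (r2.integrableOn t),
      integral_sub ((S.rkt hR0).integrableOn t) (r1.integrableOn t), integral_const_mul]
    rfl
  rw [h2] at h1
  refine le_trans ?_ h1
  have h3 := S.loc_L6_le hR0 t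
  set J := ∫ r in Set.Ioi 0, hinv R r ^ 6 * S.d6 t r
  have hK0 := S.K_nonneg R t
  have hKB := S.K_le_B hR0 t
  have hB := h.B_lt t
  have h4 : J ≤ S.K R t * (S.B t / sob) := by
    have e1 : S.K R t ^ 3 ≤ S.K R t * (S.B t * sob) := by
      rw [pow_succ', pow_two]
      gcongr
      · exact S.B_nonneg t
      · exact hKB.trans hB.le
    have e2 : sob ^ 2 * J ≤ sob ^ 2 * (S.K R t * (S.B t / sob)) := by
      refine (h3.trans e1).trans (le_of_eq ?_)
      field_simp
    exact le_of_mul_le_mul_left e2 (by positivity)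
  have h5 : S.K R t * ((sob - S.B t) / sob) = S.K R t - S.K R t * (S.B t / sob) := by
    field_simp
  rw [h5]
  linarith

theorem gv_nonneg (h : S.Threshold) {R : ℝ} (hR : 13 * sob ≤ R) (t : ℝ) :
    0 ≤ ∫ r in Set.Ioi 0, S.gv R t r := by
  have hs := sob_pos
  refine le_trans ?_ (h.gv_lower hR t)
  have h1 := S.I4_nonneg (R := R) (by linarith) t
  have h2 := h.B_lt t
  have h3 : 0 ≤ (sob - S.B t) / sob := div_nonneg (by linarith) hs.le
  have := mul_nonneg (S.K_nonneg R t) h3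
  linarith

theorem V_monotone (h : S.Threshold) {R : ℝ} (hR : 13 * sob ≤ R) : Monotone (S.V R) := by
  have hR0 : 0 < R := by linarith [sob_pos]
  refine monotone_of_deriv_nonneg (fun t => (S.hasDerivAt_V hR0 t).differentiableAt) (fun t => ?_)
  rw [(S.hasDerivAt_V hR0 t).deriv]
  have := h.gv_nonneg hR t
  positivity

theorem V_le (h : S.Threshold) {R : ℝ} (hR : 0 < R) (t : ℝ) :
    S.V R t ≤ R * ((S.mass 0 + sob) / 2) := by
  have r1 := (S.rmom.weight (polyWeight_drift hR))
  have r2 := (S.rrho.add S.rkin).const_mul (R / 2)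
  have h1 : S.V R t ≤ ∫ r in Set.Ioi 0, R / 2 * (S.rho t r + S.kin t r) := by
    refine setIntegral_mono_on (r1.integrableOn t) (r2.integrableOn t)
      measurableSet_Ioi (fun r hr => ?_)
    have hr' : (0:ℝ) < r := hr
    have h2 := drift_le hR hr'.le
    have h3 : 0 ≤ r * hinv R r := mul_nonneg hr'.le (hinv_pos hR hr'.le).le
    have h4 : S.mom t r ≤ (S.rho t r + S.kin t r) / 2 := by
      unfold mom rho kin
      nlinarith [sq_nonneg (S.a t r - S.b1 t r), sq_nonneg (S.b t r + S.a1 t r)]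
    have h5 := S.rho_nonneg t r
    have h6 := S.kin_nonneg t r
    calc r * hinv R r * S.mom t r ≤ r * hinv R r * ((S.rho t r + S.kin t r) / 2) := by gcongr
      _ ≤ R * ((S.rho t r + S.kin t r) / 2) := by gcongr
      _ = _ := by ring
  rw [integral_const_mul, integral_add (S.rrho.integrableOn t) (S.rkin.integrableOn t)] at h1
  have h2 : S.V R t ≤ R / 2 * (S.mass t + S.B t) := h1
  have h3 := h.B_lt t
  rw [S.mass_eq t] at h2
  have : R / 2 * (S.mass 0 + S.B t) ≤ R / 2 * (S.mass 0 + sob) := by gcongr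
  linarith

theorem exists_V_pos (h : S.Threshold) {R : ℝ} (hR : 13 * sob ≤ R) : ∃ T, 0 < S.V R T := by
  have hR0 : 0 < R := by linarith [sob_pos]
  by_contra hcon
  push Not at hcon
  set Y : ℝ → ℝ := fun t => ∫ r in Set.Ioi 0, vw R r * S.rho t r with hY
  have hYa : Antitone Y := by
    refine antitone_of_deriv_nonpos (fun t => (S.hasDerivAt_Y hR0 t).differentiableAt) (fun t => ?_)
    rw [(S.hasDerivAt_Y hR0 t).deriv]
    have := hcon t
    linarith
  have hM := h.mass_pos
  obtain ⟨l, hl0, hl⟩ : ∃ l, 0 < l ∧ 2 * Y 0 / S.mass 0 + 1 ≤ vw R l :=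
    (((tendsto_vw hR0).eventually_ge_atTop _).and
      (Filter.eventually_gt_atTop 0)).exists.imp fun l hl => ⟨hl.2, hl.1⟩
  have hY0 : 0 ≤ Y 0 := setIntegral_nonneg measurableSet_Ioi (fun r hr =>
    mul_nonneg (vw_nonneg hR0 (le_of_lt hr)) (S.rho_nonneg 0 r))
  have hvl : 0 < vw R l := by
    have : 0 ≤ 2 * Y 0 / S.mass 0 := by positivity
    linarith
  have hm := lapw_pos hR0 hl0.le
  set κ := l ^ 3 / S.mass 0 with hκ
  have hκ0 : 0 < κ := by positivity
  set c := lapw R l * S.mass 0 / (4 * κ) with hc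
  have hc0 : 0 < c := by positivity
  have hI : ∀ t, 0 ≤ t → c ≤ S.I4 R t := by
    intro t ht
    have r1 : RapidDecay (fun t r => (vw R l)⁻¹ * (vw R r * S.rho t r)) :=
      (S.rrho.weight (polyWeight_vw hR0)).const_mul _
    have r2 : RapidDecay (fun t r => κ / lapw R l * (lapw R r * S.d4 t r)) :=
      (S.rd4.weight (polyWeight_lapw hR0)).const_mul _
    have i3 : IntegrableOn (Set.indicator (Set.Ioc 0 l) (fun _ => l ^ 2 / (4 * κ)))
        (Set.Ioi (0:ℝ)) := by
      refine Integrable.integrableOn ((integrable_indicator_iff measurableSet_Ioc).2 ?_)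
      exact integrableOn_const (by simp)
    have hle : S.mass t ≤ ∫ r in Set.Ioi 0, ((vw R l)⁻¹ * (vw R r * S.rho t r)
        + κ / lapw R l * (lapw R r * S.d4 t r)
        + Set.indicator (Set.Ioc 0 l) (fun _ => l ^ 2 / (4 * κ)) r) := by
      refine setIntegral_mono_on (S.rrho.integrableOn t) (((r1.add r2).integrableOn t).add i3)
        measurableSet_Ioi (fun r hr => ?_)
      have hr' : (0:ℝ) < r := hr
      have p1 : 0 ≤ (vw R l)⁻¹ * (vw R r * S.rho t r) :=
        mul_nonneg (by positivity) (mul_nonneg (vw_nonneg hR0 hr'.le) (S.rho_nonneg t r))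
      have p2 : 0 ≤ κ / lapw R l * (lapw R r * S.d4 t r) :=
        mul_nonneg (by positivity) (mul_nonneg (lapw_nonneg hR0 hr'.le) (S.d4_nonneg t r))
      by_cases hrl : r ≤ l
      · rw [Set.indicator_of_mem (show r ∈ Set.Ioc 0 l from ⟨hr, hrl⟩)]
        have p3 : κ * S.d4 t r ≤ κ / lapw R l * (lapw R r * S.d4 t r) := by
          rw [div_mul_eq_mul_div κ, le_div_iff₀ hm]
          have := lapw_antitone hR0 hr'.le hrl
          have := mul_le_mul_of_nonneg_left this (mul_nonneg hκ0.le (S.d4_nonneg t r))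
          linarith
        have p4 : S.rho t r ≤ κ * S.d4 t r + l ^ 2 / (4 * κ) := by
          have e1 : S.rho t r = r ^ 2 * S.q t r := S.a_sq_add t r
          have e2 : S.q t r ≤ κ * S.q t r ^ 2 + 1 / (4 * κ) := by
            rw [← sub_nonneg]
            have : κ * S.q t r ^ 2 + 1 / (4 * κ) - S.q t r
                = (2 * κ * S.q t r - 1) ^ 2 / (4 * κ) := by
              field_simp; ring
            rw [this]; positivity
          have e3 : r ^ 2 * (1 / (4 * κ)) ≤ l ^ 2 / (4 * κ) := by
            rw [mul_one_div]; gcongr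
          have e4 := mul_le_mul_of_nonneg_left e2 (sq_nonneg r)
          rw [e1]; unfold d4
          linarith
        linarith
      · rw [Set.indicator_of_notMem (fun hx => hrl hx.2)]
        push Not at hrl
        have p3 : S.rho t r ≤ (vw R l)⁻¹ * (vw R r * S.rho t r) := by
          rw [← mul_assoc]
          refine le_mul_of_one_le_left (S.rho_nonneg t r) ?_
          rw [inv_mul_eq_div, one_le_div hvl]
          exact vw_monotone hR0 hl0.le hr'.le hrl.le
        linarith
    have e3 : ∫ r in Set.Ioi 0, Set.indicator (Set.Ioc 0 l) (fun _ => l ^ 2 / (4 * κ)) r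
        = S.mass 0 / 4 := by
      have hsub : Set.Ioi (0 : ℝ) ∩ Set.Ioc 0 l = Set.Ioc 0 l :=
        Set.inter_eq_right.2 (fun x hx => hx.1)
      rw [setIntegral_indicator measurableSet_Ioc, hsub, setIntegral_const]
      simp only [Real.volume_real_Ioc_of_le hl0.le, smul_eq_mul, hκ]
      field_simp
      ring
    rw [integral_add ((r1.add r2).integrableOn t) i3,
      integral_add (r1.integrableOn t) (r2.integrableOn t), integral_const_mul,
      integral_const_mul, e3, S.mass_eq t] at hle
    have e4 : (vw R l)⁻¹ * Y t ≤ S.mass 0 / 2 := by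
      rw [inv_mul_eq_div, div_le_iff₀ hvl]
      have h1 := hYa ht
      have h2 : 2 * Y 0 / S.mass 0 ≤ vw R l := by linarith
      rw [div_le_iff₀ hM] at h2
      linarith
    have e5 : S.mass 0 / 4 ≤ κ / lapw R l * S.I4 R t := by
      have h1 : S.mass 0 ≤ (vw R l)⁻¹ * Y t + κ / lapw R l * S.I4 R t + S.mass 0 / 4 := hle
      linarith
    rw [hc, div_le_iff₀ (by positivity)]
    rw [div_mul_eq_mul_div, le_div_iff₀ hm] at e5
    linarith
  have hmono : MonotoneOn (fun t => S.V R t - c / 4 * t) (Set.Ici 0) := by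
    have hd : ∀ t, HasDerivAt (fun t => S.V R t - c / 4 * t)
        (2 * (∫ r in Set.Ioi 0, S.gv R t r) - c / 4 * 1) t := fun t =>
      (S.hasDerivAt_V hR0 t).sub ((hasDerivAt_id t).const_mul (c / 4))
    refine monotoneOn_of_deriv_nonneg (convex_Ici 0)
      (fun t _ => (hd t).continuousAt.continuousWithinAt)
      (fun t _ => (hd t).differentiableAt.differentiableWithinAt) (fun t ht => ?_)
    rw [interior_Ici] at ht
    rw [(hd t).deriv]
    have h1 := h.gv_lower hR t
    have h2 := hI t (le_of_lt ht)
    have h3 : 0 ≤ S.K R t * ((sob - S.B t) / sob) :=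
      mul_nonneg (S.K_nonneg R t) (div_nonneg (by linarith [h.B_lt t]) sob_pos.le)
    linarith
  have hT : 0 ≤ (1 + |S.V R 0|) * (4 / c) := by positivity
  have hfin := hmono Set.self_mem_Ici hT hT
  have h1 := hcon ((1 + |S.V R 0|) * (4 / c))
  have h2 : c / 4 * ((1 + |S.V R 0|) * (4 / c)) = 1 + |S.V R 0| := by field_simp
  simp only [mul_zero, sub_zero, h2] at hfin
  linarith [neg_abs_le (S.V R 0)]

theorem B_gap (h : S.Threshold) {R t v : ℝ} (hR : 0 < R) (hv : 0 < v) (hV : v ≤ S.V R t) :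
    S.B t ≤ sob - min (v ^ 2 / (R ^ 2 * S.mass 0)) (sob / 4) := by
  have hM := h.mass_pos
  have hs := sob_pos
  set l : ℝ := -(S.V R t / (R ^ 2 * S.mass 0)) with hl
  have r2 : RapidDecay (fun t r => 2 * l * (r * hinv R r * S.mom t r)) :=
    (S.rmom.weight (polyWeight_drift hR)).const_mul _
  have r3 : RapidDecay (fun t r => l ^ 2 * ((r * hinv R r) ^ 2 * S.rho t r)) :=
    (S.rrho.weight ((polyWeight_drift hR).pow 1)).const_mul _
  have re := (S.rkin.add r2).add r3
  have hid : ∀ r, S.kin t r + 2 * l * (r * hinv R r * S.mom t r)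
      + l ^ 2 * ((r * hinv R r) ^ 2 * S.rho t r)
      = (S.a1 t r - l * (r * hinv R r) * S.b t r) ^ 2
        + (S.b1 t r + l * (r * hinv R r) * S.a t r) ^ 2 := by
    intro r; unfold kin mom rho; ring
  have h1 := S.integral_d6_le t (e := fun r => S.kin t r + 2 * l * (r * hinv R r * S.mom t r)
      + l ^ 2 * ((r * hinv R r) ^ 2 * S.rho t r)) (fun r _ => by
      rw [hid]
      have := cauchy_schwarz_pair (S.a t r) (S.b t r) (S.a1 t r - l * (r * hinv R r) * S.b t r)
        (S.b1 t r + l * (r * hinv R r) * S.a t r)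
      refine le_trans (le_of_eq ?_) this
      ring) (fun r _ => by rw [hid]; positivity) (re.integrableOn t)
  have h0 : 0 ≤ ∫ r in Set.Ioi 0, (S.kin t r + 2 * l * (r * hinv R r * S.mom t r)
      + l ^ 2 * ((r * hinv R r) ^ 2 * S.rho t r)) :=
    setIntegral_nonneg measurableSet_Ioi (fun r _ => by rw [hid]; positivity)
  have hQ : ∫ r in Set.Ioi 0, (r * hinv R r) ^ 2 * S.rho t r ≤ R ^ 2 * S.mass 0 := by
    rw [← S.mass_eq t]
    unfold mass
    rw [← integral_const_mul]
    refine setIntegral_mono_on ((S.rrho.weight ((polyWeight_drift hR).pow 1)).integrableOn t)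
      ((S.rrho.const_mul _).integrableOn t) measurableSet_Ioi (fun r hr => ?_)
    have hr' : (0:ℝ) < r := hr
    have h2 := drift_le hR hr'.le
    have h3 : 0 ≤ r * hinv R r := mul_nonneg hr'.le (hinv_pos hR hr'.le).le
    have := S.rho_nonneg t r
    gcongr
  rw [integral_add ((S.rkin.add r2).integrableOn t) (r3.integrableOn t),
    integral_add (S.rkin.integrableOn t) (r2.integrableOn t), integral_const_mul,
    integral_const_mul] at h1 h0
  change sob ^ 2 * S.L6 t ≤ (S.B t + 2 * l * S.V R t + l ^ 2 * _) ^ 3 at h1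
  change 0 ≤ (S.B t + 2 * l * S.V R t + l ^ 2 * _) at h0
  set Q := ∫ r in Set.Ioi 0, (r * hinv R r) ^ 2 * S.rho t r
  set β := min (v ^ 2 / (R ^ 2 * S.mass 0)) (sob / 4) with hβ
  have hβ0 : 0 < β := lt_min (by positivity) (by positivity)
  have hβ4 : β ≤ sob / 4 := min_le_right _ _
  have h2 : S.B t + 2 * l * S.V R t + l ^ 2 * Q ≤ S.B t - β := by
    have e1 : l ^ 2 * Q ≤ l ^ 2 * (R ^ 2 * S.mass 0) := by gcongr
    have e2 : 2 * l * S.V R t + l ^ 2 * (R ^ 2 * S.mass 0)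
        = -(S.V R t ^ 2 / (R ^ 2 * S.mass 0)) := by
      rw [hl]; field_simp; ring
    have e3 : β ≤ S.V R t ^ 2 / (R ^ 2 * S.mass 0) := by
      refine (min_le_left _ _).trans ?_
      gcongr
    linarith
  have h3 : sob ^ 2 * S.L6 t ≤ (S.B t - β) ^ 3 := h1.trans (pow_le_pow_left₀ h0 h2 3)
  have h4 := h.energy t
  have h5 := S.L4_nonneg t
  have h6 := h.B_lt t
  have h7 : sob ^ 2 * (3 * S.B t - 2 * sob) ≤ (S.B t - β) ^ 3 := by
    refine le_trans ?_ h3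
    gcongr
    linarith
  by_contra hlt
  push Not at hlt
  set d := sob - S.B t with hd
  have hd0 : 0 < d := by linarith
  have hB : S.B t = sob - d := by rw [hd]; ring
  rw [hB] at h7
  have hdβ : d < β := by linarith
  have e1 : sob * β ≤ (d + β) ^ 2 := by
    have : 3 * sob * (sob * β) ≤ 3 * sob * (d + β) ^ 2 := by
      nlinarith [pow_pos (add_pos hd0 hβ0) 3]
    exact le_of_mul_le_mul_left this (by positivity)
  nlinarith

/-- The localized kinetic energy is eventually controlled by the derivative of a bounded
monotone function. -/
theorem exists_morawetz (h : S.Threshold) : ∃ (R C T0 Vm : ℝ) (V V' : ℝ → ℝ), 0 < R ∧ 0 ≤ C ∧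
    (∀ t, HasDerivAt V (V' t) t) ∧ (∀ t, 0 ≤ V' t) ∧ (∀ t, V t ≤ Vm) ∧
    ∀ t, T0 ≤ t → S.K R t ≤ C * V' t := by
  have hs := sob_pos
  have hR : 0 < 13 * sob := by positivity
  obtain ⟨T0, hT0⟩ := h.exists_V_pos (R := 13 * sob) le_rfl
  set β := min (S.V (13 * sob) T0 ^ 2 / ((13 * sob) ^ 2 * S.mass 0)) (sob / 4) with hβ
  have hM := h.mass_pos
  have hβ0 : 0 < β := lt_min (by positivity) (by positivity)
  refine ⟨13 * sob, sob / (2 * β), T0, _, S.V (13 * sob), _, hR, by positivity,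
    fun t => S.hasDerivAt_V hR t, fun t => ?_, fun t => h.V_le hR t, fun t ht => ?_⟩
  · have := h.gv_nonneg (R := 13 * sob) le_rfl t
    positivity
  · have h1 := h.B_gap hR hT0 (h.V_monotone (R := 13 * sob) le_rfl ht)
    have h2 := h.gv_lower (R := 13 * sob) le_rfl t
    have h3 := S.I4_nonneg hR t
    have h4 := S.K_nonneg (13 * sob) t
    have h5 : S.K (13 * sob) t * (β / sob) ≤ ∫ r in Set.Ioi 0, S.gv (13 * sob) t r := by
      refine le_trans ?_ h2
      have : S.K (13 * sob) t * (β / sob) ≤ S.K (13 * sob) t * ((sob - S.B t) / sob) := by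
        gcongr
        linarith
      linarith
    have h6 : S.K (13 * sob) t = sob / β * (S.K (13 * sob) t * (β / sob)) := by
      field_simp
    rw [h6]
    calc sob / β * (S.K (13 * sob) t * (β / sob))
        ≤ sob / β * ∫ r in Set.Ioi 0, S.gv (13 * sob) t r := by gcongr
      _ = _ := by ring

end Threshold

end RadialFlow

/-! ## Complex rapidly decaying families -/

/-- Complex families on `[0, ∞)` that decay rapidly in `r`, locally uniformly in `t`. -/
def CDecay (f : ℝ → ℝ → ℂ) : Prop :=
  ContinuousOn (fun p : ℝ × ℝ => f p.1 p.2) (Set.univ ×ˢ Set.Ici 0) ∧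
  ∀ (T : ℝ) (n : ℕ), ∃ C : ℝ, 0 ≤ C ∧ ∀ t r : ℝ, |t| ≤ T → 0 ≤ r → (1 + r) ^ n * ‖f t r‖ ≤ C

/-- Complex kernels on `[0, ∞)` of polynomial growth in `r`, locally uniformly in `t`. -/
def PolyKernel (k : ℝ → ℝ → ℂ) : Prop :=
  ContinuousOn (fun p : ℝ × ℝ => k p.1 p.2) (Set.univ ×ˢ Set.Ici 0) ∧
  ∀ T : ℝ, ∃ (n : ℕ) (C : ℝ), 0 ≤ C ∧ ∀ t r : ℝ, |t| ≤ T → 0 ≤ r → ‖k t r‖ ≤ C * (1 + r) ^ n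

theorem RapidDecay.complex {p q : ℝ → ℝ → ℝ} (hp : RapidDecay p) (hq : RapidDecay q) :
    CDecay (fun t r => (p t r : ℂ) + (q t r : ℂ) * I) := by
  refine ⟨?_, fun T n => ?_⟩
  · exact (continuous_ofReal.comp_continuousOn hp.1).add
      ((continuous_ofReal.comp_continuousOn hq.1).mul continuousOn_const)
  · obtain ⟨C, hC, h1⟩ := hp.2 T n
    obtain ⟨D, hD, h2⟩ := hq.2 T n
    refine ⟨C + D, by positivity, fun t r ht hr => ?_⟩
    have h3 : ‖(p t r : ℂ) + (q t r : ℂ) * I‖ ≤ |p t r| + |q t r| := by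
      refine (norm_add_le _ _).trans (le_of_eq ?_)
      simp
    calc (1 + r) ^ n * ‖(p t r : ℂ) + (q t r : ℂ) * I‖
        ≤ (1 + r) ^ n * (|p t r| + |q t r|) := by gcongr
      _ = (1 + r) ^ n * |p t r| + (1 + r) ^ n * |q t r| := by ring
      _ ≤ C + D := add_le_add (h1 t r ht hr) (h2 t r ht hr)

namespace CDecay

variable {f g k : ℝ → ℝ → ℂ}

theorem add (hf : CDecay f) (hg : CDecay g) : CDecay (fun t r => f t r + g t r) := by
  refine ⟨hf.1.add hg.1, fun T n => ?_⟩
  obtain ⟨C, hC, h1⟩ := hf.2 T n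
  obtain ⟨D, hD, h2⟩ := hg.2 T n
  refine ⟨C + D, by positivity, fun t r ht hr => ?_⟩
  calc (1 + r) ^ n * ‖f t r + g t r‖ ≤ (1 + r) ^ n * (‖f t r‖ + ‖g t r‖) := by
        gcongr; exact norm_add_le _ _
    _ = (1 + r) ^ n * ‖f t r‖ + (1 + r) ^ n * ‖g t r‖ := by ring
    _ ≤ C + D := add_le_add (h1 t r ht hr) (h2 t r ht hr)

theorem kernel_mul (hf : CDecay f) (hk : PolyKernel k) : CDecay (fun t r => k t r * f t r) := by
  refine ⟨hk.1.mul hf.1, fun T n => ?_⟩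
  obtain ⟨m, D, hD, hw⟩ := hk.2 T
  obtain ⟨C, hC, h1⟩ := hf.2 T (n + m)
  refine ⟨D * C, by positivity, fun t r ht hr => ?_⟩
  calc (1 + r) ^ n * ‖k t r * f t r‖ = (1 + r) ^ n * (‖k t r‖ * ‖f t r‖) := by rw [norm_mul]
    _ ≤ (1 + r) ^ n * (D * (1 + r) ^ m * ‖f t r‖) := by gcongr; exact hw t r ht hr
    _ = D * ((1 + r) ^ (n + m) * ‖f t r‖) := by ring
    _ ≤ D * C := by gcongr; exact h1 t r ht hr

theorem const_mul (hf : CDecay f) (c : ℂ) : CDecay (fun t r => c * f t r) :=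
  hf.kernel_mul ⟨continuousOn_const, fun _ => ⟨0, ‖c‖, norm_nonneg _, by simp⟩⟩

theorem congr (hf : CDecay f) (h : ∀ t r, 0 ≤ r → g t r = f t r) : CDecay g := by
  refine ⟨hf.1.congr (fun p hp => h p.1 p.2 hp.2), fun T n => ?_⟩
  obtain ⟨C, hC, h1⟩ := hf.2 T n
  exact ⟨C, hC, fun t r ht hr => by rw [h t r hr]; exact h1 t r ht hr⟩

theorem norm (hf : CDecay f) : RapidDecay (fun t r => ‖f t r‖) := by
  refine ⟨hf.1.norm, fun T n => ?_⟩
  simpa only [abs_norm] using hf.2 T n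

theorem aestronglyMeasurable (hf : CDecay f) (t : ℝ) :
    AEStronglyMeasurable (f t) (volume.restrict (Set.Ioi 0)) :=
  ((hf.1.comp (f := fun r : ℝ => (t, r)) (s := Set.Ici 0) (by fun_prop)
    (fun r hr => ⟨trivial, hr⟩)).mono Set.Ioi_subset_Ici_self).aestronglyMeasurable
    measurableSet_Ioi

theorem integrableOn (hf : CDecay f) (t : ℝ) : IntegrableOn (f t) (Set.Ioi 0) :=
  (integrable_norm_iff (hf.aestronglyMeasurable t)).1 (hf.norm.integrableOn t)

theorem hasDerivAt_integral {f' : ℝ → ℝ → ℂ} (hf : CDecay f) (hf' : CDecay f')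
    (hd : ∀ t r, 0 < r → HasDerivAt (fun s => f s r) (f' t r) t) (t : ℝ) :
    HasDerivAt (fun s => ∫ r in Set.Ioi 0, f s r) (∫ r in Set.Ioi 0, f' t r) t := by
  obtain ⟨C, hC, h⟩ := hf'.norm.exists_bound (|t| + 1)
  refine (hasDerivAt_integral_of_dominated_loc_of_deriv_le
    (bound := fun r => C * (1 + r ^ 2)⁻¹) (s := Metric.ball t 1) (Metric.ball_mem_nhds t one_pos)
    (Filter.Eventually.of_forall fun s => hf.aestronglyMeasurable s) (hf.integrableOn t)
    (hf'.aestronglyMeasurable t) ?_ ((integrable_inv_one_add_sq.const_mul C).integrableOn) ?_).2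
  · refine (ae_restrict_iff' measurableSet_Ioi).2 (ae_of_all _ fun r hr s hs => ?_)
    rw [Metric.mem_ball, Real.dist_eq] at hs
    have := h s r (by have := abs_sub_abs_le_abs_sub s t; linarith) (le_of_lt hr)
    rwa [abs_norm] at this
  · exact (ae_restrict_iff' measurableSet_Ioi).2 (ae_of_all _ fun r hr s hs => hd s r hr)

theorem integral_deriv_eq {f' : ℝ → ℝ → ℂ} (hf : CDecay f) (hf' : CDecay f')
    (hd : ∀ t r, 0 < r → HasDerivAt (f t) (f' t r) r) (t : ℝ) :
    ∫ r in Set.Ioi 0, f' t r = -f t 0 := by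
  have hc : ContinuousOn (f t) (Set.Ici 0) :=
    hf.1.comp (f := fun r : ℝ => (t, r)) (by fun_prop) (fun r hr => ⟨trivial, hr⟩)
  have := integral_Ioi_of_hasDerivAt_of_tendsto
    (hc 0 Set.self_mem_Ici) (fun r hr => hd t r hr)
    (hf'.integrableOn t) (tendsto_zero_iff_norm_tendsto_zero.2 (hf.norm.tendsto_zero t))
  simpa using this

end CDecay

/-! ## The one-dimensional Schrödinger kernel -/

/-- the complex heat kernel `z^{-1/2} exp(-x²/(4 z))` -/
def hk (z : ℂ) (x : ℝ) : ℂ := z ^ ((-(1 / 2 : ℝ) : ℝ) : ℂ) * cexp (-(x : ℂ) ^ 2 / (4 * z))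

/-- first spatial derivative of `hk` -/
def hk1 (z : ℂ) (x : ℝ) : ℂ := -(x : ℂ) / (2 * z) * hk z x

/-- second spatial derivative of `hk` -/
def hk2 (z : ℂ) (x : ℝ) : ℂ := ((x : ℂ) ^ 2 / (4 * z ^ 2) - 1 / (2 * z)) * hk z x

theorem hasDerivAt_hk {z : ℂ} (hz : z ≠ 0) (x : ℝ) : HasDerivAt (hk z) (hk1 z x) x := by
  have h : HasDerivAt (fun w : ℂ => z ^ ((-(1 / 2 : ℝ) : ℝ) : ℂ) * cexp (-w ^ 2 / (4 * z)))
      (hk1 z x) (x : ℂ) := by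
    refine HasDerivAt.congr_deriv
      ((((hasDerivAt_id (x : ℂ)).pow 2).neg.div_const (4 * z)).cexp.const_mul _) ?_
    simp only [hk1, hk, id, Pi.neg_apply, Pi.pow_apply]
    field_simp
    ring
  exact h.comp_ofReal

theorem hasDerivAt_hk1 {z : ℂ} (hz : z ≠ 0) (x : ℝ) : HasDerivAt (hk1 z) (hk2 z x) x := by
  have h := ((hasDerivAt_id x).ofReal_comp.neg.div_const (2 * z)).mul (hasDerivAt_hk hz x)
  refine HasDerivAt.congr_deriv h ?_
  simp only [hk1, hk2, id, Pi.neg_apply]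
  field_simp
  push_cast
  ring

theorem hasDerivAt_hk_time {z : ℂ} (hz : 0 < z.re) (x : ℝ) :
    HasDerivAt (fun w => hk w x) (hk2 z x) z := by
  have hz0 : z ≠ 0 := fun h => by simp [h] at hz
  have h1 := (hasStrictDerivAt_cpow_const (c := ((-(1 / 2 : ℝ) : ℝ) : ℂ))
    (show z ∈ slitPlane from Or.inl hz)).hasDerivAt
  have h2 : HasDerivAt (fun w : ℂ => cexp (-(x : ℂ) ^ 2 / (4 * w)))
      (cexp (-(x : ℂ) ^ 2 / (4 * z)) * ((x : ℂ) ^ 2 / (4 * z ^ 2))) z := by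
    refine HasDerivAt.congr_deriv (((hasDerivAt_const z (-(x : ℂ) ^ 2)).div
      ((hasDerivAt_id z).const_mul 4) (by simpa using hz0)).cexp) ?_
    simp only [id, Pi.div_apply]
    field_simp
    ring
  refine HasDerivAt.congr_deriv (h1.mul h2) ?_
  rw [cpow_sub _ _ hz0, cpow_one]
  simp only [hk2, hk]
  push_cast
  field_simp
  ring

theorem re_sq_div_nonneg {z : ℂ} (hz : 0 ≤ z.re) (x : ℝ) : 0 ≤ ((x : ℂ) ^ 2 / (4 * z)).re := by
  have h : (x : ℂ) ^ 2 / (4 * z) = ((x ^ 2 / 4 : ℝ) : ℂ) * z⁻¹ := by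
    push_cast
    rw [div_eq_mul_inv, mul_inv]; ring
  rw [h, re_ofReal_mul, inv_re]
  exact mul_nonneg (by positivity) (div_nonneg hz (normSq_nonneg z))

theorem norm_cexp_le_one {z : ℂ} (hz : 0 ≤ z.re) (x : ℝ) : ‖cexp (-(x : ℂ) ^ 2 / (4 * z))‖ ≤ 1 := by
  rw [norm_exp, neg_div, neg_re, Real.exp_le_one_iff]
  linarith [re_sq_div_nonneg hz x]

theorem norm_hk_le {z : ℂ} (hz : 0 ≤ z.re) (x : ℝ) : ‖hk z x‖ ≤ ‖z‖ ^ (-(1 / 2 : ℝ)) := by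
  rw [hk, norm_mul, norm_cpow_real]
  exact mul_le_of_le_one_right (by positivity) (norm_cexp_le_one hz x)

/-- On the left half plane the exponential is a contraction. -/
theorem norm_cexp_sub_le {a b : ℂ} (ha : a.re ≤ 0) (hb : b.re ≤ 0) :
    ‖cexp a - cexp b‖ ≤ ‖a - b‖ := by
  have h := Convex.norm_image_sub_le_of_norm_hasDerivWithin_le (𝕜 := ℂ) (f := cexp) (f' := cexp)
    (s := {w | w.re ≤ 0}) (C := 1) (fun x _ => (hasDerivAt_exp x).hasDerivWithinAt)
    (fun x hx => by rw [norm_exp, Real.exp_le_one_iff]; exact hx)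
    (convex_halfSpace_re_le 0) hb ha
  simpa using h

theorem norm_hk_sub_le {z : ℂ} (hz : 0 ≤ z.re) (hz0 : z ≠ 0) {r y : ℝ} (hr : 0 ≤ r) (hy : 0 ≤ y) :
    ‖hk z (r - y) - hk z (r + y)‖ ≤ ‖z‖ ^ (-(1 / 2 : ℝ)) * (r * y / ‖z‖) := by
  rw [hk, hk, ← mul_sub, norm_mul, norm_cpow_real]
  gcongr
  have hn : ∀ x : ℝ, (-(x : ℂ) ^ 2 / (4 * z)).re ≤ 0 := fun x => by
    rw [neg_div, neg_re]; linarith [re_sq_div_nonneg hz x]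
  refine (norm_cexp_sub_le (hn _) (hn _)).trans (le_of_eq ?_)
  have : -((r - y : ℝ) : ℂ) ^ 2 / (4 * z) - -((r + y : ℝ) : ℂ) ^ 2 / (4 * z)
      = ((r * y : ℝ) : ℂ) / z := by
    push_cast; field_simp; ring
  rw [this, norm_div, norm_real, Real.norm_of_nonneg (by positivity)]

namespace PolyKernel

variable {k l : ℝ → ℝ → ℂ}

theorem mul (hk : PolyKernel k) (hl : PolyKernel l) : PolyKernel (fun t r => k t r * l t r) := by
  refine ⟨hk.1.mul hl.1, fun T => ?_⟩
  obtain ⟨n, C, hC, h1⟩ := hk.2 T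
  obtain ⟨m, D, hD, h2⟩ := hl.2 T
  refine ⟨n + m, C * D, by positivity, fun t r ht hr => ?_⟩
  rw [norm_mul, pow_add]
  calc ‖k t r‖ * ‖l t r‖ ≤ (C * (1 + r) ^ n) * (D * (1 + r) ^ m) :=
        mul_le_mul (h1 t r ht hr) (h2 t r ht hr) (norm_nonneg _) (by positivity)
    _ = C * D * ((1 + r) ^ n * (1 + r) ^ m) := by ring

theorem add (hk : PolyKernel k) (hl : PolyKernel l) : PolyKernel (fun t r => k t r + l t r) := by
  refine ⟨hk.1.add hl.1, fun T => ?_⟩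
  obtain ⟨n, C, hC, h1⟩ := hk.2 T
  obtain ⟨m, D, hD, h2⟩ := hl.2 T
  refine ⟨n + m, C + D, by positivity, fun t r ht hr => ?_⟩
  refine (norm_add_le _ _).trans ?_
  rw [add_mul]
  refine add_le_add ((h1 t r ht hr).trans ?_) ((h2 t r ht hr).trans ?_)
  · gcongr
    · linarith
    · omega
  · gcongr
    · linarith
    · omega

theorem const (c : ℂ) : PolyKernel (fun _ _ => c) :=
  ⟨continuousOn_const, fun _ => ⟨0, ‖c‖, norm_nonneg _, by simp⟩⟩

theorem of_continuous {w : ℝ → ℂ} (hw : Continuous w) (n : ℕ) (C : ℝ) (hC : 0 ≤ C)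
    (h : ∀ y, 0 ≤ y → ‖w y‖ ≤ C * (1 + y) ^ n) : PolyKernel (fun _ y => w y) :=
  ⟨(hw.comp continuous_snd).continuousOn, fun _ => ⟨n, C, hC, fun _ y _ hy => h y hy⟩⟩

theorem affine (r c : ℝ) : PolyKernel (fun _ y => ((r + c * y : ℝ) : ℂ)) := by
  refine of_continuous (by fun_prop) 1 (|r| + |c|) (by positivity) (fun y hy => ?_)
  rw [norm_real, Real.norm_eq_abs]
  refine (abs_add_le _ _).trans ?_
  rw [abs_mul, abs_of_nonneg hy]
  nlinarith [abs_nonneg r, abs_nonneg c, mul_nonneg (abs_nonneg r) hy]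

end PolyKernel

section kernels

variable {ζ : ℝ → ℂ} {ε : ℝ}

theorem le_norm_of_le_re {z : ℂ} (h : ε ≤ z.re) : ε ≤ ‖z‖ := h.trans ((le_abs_self _).trans (abs_re_le_norm z))

theorem polyKernel_inv (hε : 0 < ε) (hζ : Continuous ζ) (h : ∀ s, ε ≤ (ζ s).re) :
    PolyKernel (fun s _ => (ζ s)⁻¹) := by
  have h0 : ∀ s, ζ s ≠ 0 := fun s hs => by have := h s; rw [hs, zero_re] at this; linarith
  refine ⟨((hζ.inv₀ h0).comp continuous_fst).continuousOn, fun _ => ⟨0, ε⁻¹, by positivity, fun s y _ _ => ?_⟩⟩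
  rw [pow_zero, mul_one, norm_inv]
  exact inv_anti₀ hε (le_norm_of_le_re (h s))

theorem polyKernel_hk (hε : 0 < ε) (hζ : Continuous ζ) (h : ∀ s, ε ≤ (ζ s).re) (r c : ℝ) :
    PolyKernel (fun s y => hk (ζ s) (r + c * y)) := by
  have h0 : ∀ s, ζ s ≠ 0 := fun s hs => by have := h s; rw [hs, zero_re] at this; linarith
  refine ⟨Continuous.continuousOn ?_, fun _ => ⟨0, ε ^ (-(1 / 2 : ℝ)), by positivity,
    fun s y _ _ => ?_⟩⟩
  · unfold hk
    refine Continuous.mul ?_ ?_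
    · refine (continuous_iff_continuousAt.2 fun s => ?_ : Continuous fun s => ζ s ^ ((-(1 / 2 : ℝ) : ℝ) : ℂ)).comp
        continuous_fst
      exact hζ.continuousAt.cpow continuousAt_const (Or.inl (hε.trans_le (h s)))
    · refine continuous_exp.comp (Continuous.div (by fun_prop) (by fun_prop) (fun p => ?_))
      exact mul_ne_zero (by norm_num) (h0 _)
  · rw [pow_zero, mul_one]
    refine (norm_hk_le (hε.le.trans (h s)) _).trans ?_
    exact Real.rpow_le_rpow_of_nonpos hε (le_norm_of_le_re (h s)) (by norm_num)

theorem polyKernel_hk1 (hε : 0 < ε) (hζ : Continuous ζ) (h : ∀ s, ε ≤ (ζ s).re) (r c : ℝ) :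
    PolyKernel (fun s y => hk1 (ζ s) (r + c * y)) := by
  have := (((PolyKernel.const (-1 / 2)).mul (PolyKernel.affine r c)).mul
    (polyKernel_inv hε hζ h)).mul (polyKernel_hk hε hζ h r c)
  convert this using 3
  simp only [hk1]
  rw [div_eq_mul_inv, mul_inv]
  ring

theorem polyKernel_hk2 (hε : 0 < ε) (hζ : Continuous ζ) (h : ∀ s, ε ≤ (ζ s).re) (r c : ℝ) :
    PolyKernel (fun s y => hk2 (ζ s) (r + c * y)) := by
  have hx := (PolyKernel.affine r c).mul (polyKernel_inv hε hζ h)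
  have := (((PolyKernel.const (1 / 4)).mul (hx.mul hx)).add
    ((PolyKernel.const (-1 / 2)).mul (polyKernel_inv hε hζ h))).mul (polyKernel_hk hε hζ h r c)
  convert this using 3
  simp only [hk2]
  rw [div_eq_mul_inv, mul_inv, div_eq_mul_inv, mul_inv, ← inv_pow]
  ring

end kernels

/-- the odd reflection kernel -/
def ok (z : ℂ) (r y : ℝ) : ℂ := hk z (r - y) - hk z (r + y)

theorem continuous_hk {z : ℂ} (hz : z ≠ 0) : Continuous (hk z) :=
  continuous_iff_continuousAt.2 fun x => (hasDerivAt_hk hz x).continuousAt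

theorem continuous_ok {z : ℂ} (hz : z ≠ 0) (r : ℝ) : Continuous (ok z r) :=
  ((continuous_hk hz).comp (by fun_prop)).sub ((continuous_hk hz).comp (by fun_prop))

theorem hasDerivAt_ok {z : ℂ} (hz : z ≠ 0) (r y : ℝ) :
    HasDerivAt (ok z r) (-hk1 z (r - y) - hk1 z (r + y)) y := by
  have h1 := (hasDerivAt_hk hz (r - y)).comp_const_sub r y
  have h2 := (hasDerivAt_hk hz (r + y)).comp_const_add r y
  exact h1.sub h2

theorem norm_ok_le {z : ℂ} (hz : 0 ≤ z.re) (hz0 : z ≠ 0) {r y : ℝ} (hr : 0 ≤ r) (hy : 0 ≤ y) :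
    ‖ok z r y‖ ≤ ‖z‖ ^ (-(1 / 2 : ℝ)) * (r * y / ‖z‖) := norm_hk_sub_le hz hz0 hr hy

/-- primitive of `y * ok z r y` -/
def okp (z : ℂ) (r y : ℝ) : ℂ := ∫ η in (0 : ℝ)..y, (η : ℂ) * ok z r η

theorem hasDerivAt_okp {z : ℂ} (hz : z ≠ 0) (r y : ℝ) :
    HasDerivAt (okp z r) ((y : ℂ) * ok z r y) y := by
  have hc : Continuous fun η : ℝ => (η : ℂ) * ok z r η := by
    have := continuous_ok hz r; fun_prop
  exact intervalIntegral.integral_hasDerivAt_right (hc.intervalIntegrable _ _)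
    (hc.stronglyMeasurableAtFilter _ _) hc.continuousAt

theorem norm_okp_le_cubic {z : ℂ} (hz : 0 ≤ z.re) (hz0 : z ≠ 0) {r y : ℝ} (hr : 0 ≤ r)
    (hy : 0 ≤ y) : ‖okp z r y‖ ≤ ‖z‖ ^ (-(1 / 2 : ℝ)) * (4 * r * (y ^ 3 / ‖z‖)) := by
  have hzn : 0 < ‖z‖ := norm_pos_iff.2 hz0
  refine (intervalIntegral.norm_integral_le_of_norm_le_const
    (C := ‖z‖ ^ (-(1 / 2 : ℝ)) * (r * y ^ 2 / ‖z‖)) (fun η hη => ?_)).trans ?_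
  · rw [Set.uIoc_of_le hy] at hη
    rw [norm_mul, norm_real, Real.norm_of_nonneg hη.1.le]
    calc η * ‖ok z r η‖ ≤ η * (‖z‖ ^ (-(1 / 2 : ℝ)) * (r * η / ‖z‖)) :=
          mul_le_mul_of_nonneg_left (norm_ok_le hz hz0 hr hη.1.le) hη.1.le
      _ = ‖z‖ ^ (-(1 / 2 : ℝ)) * (r * η ^ 2 / ‖z‖) := by ring
      _ ≤ _ := by have := hη.1.le; gcongr; exact hη.2
  · rw [sub_zero, abs_of_nonneg hy]
    have : 0 ≤ ‖z‖ ^ (-(1 / 2 : ℝ)) * (r * (y ^ 3 / ‖z‖)) := by positivity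
    calc _ = ‖z‖ ^ (-(1 / 2 : ℝ)) * (r * (y ^ 3 / ‖z‖)) := by ring
      _ ≤ _ := by linarith

theorem norm_okp_le_linear {z : ℂ} (hz : 0 ≤ z.re) (hz0 : z ≠ 0) {r y : ℝ} (hr : 0 ≤ r)
    (hy : 0 ≤ y) : ‖okp z r y‖ ≤ ‖z‖ ^ (-(1 / 2 : ℝ)) * (4 * r * y) := by
  have hzn : 0 < ‖z‖ := norm_pos_iff.2 hz0
  have hch := continuous_hk hz0
  have hpt : ∀ η : ℝ, (η : ℂ) * ok z r η = (r : ℂ) * (hk z (r - η) + hk z (r + η))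
      - 2 * z * (-hk1 z (r - η) - hk1 z (r + η)) := fun η => by
    simp only [ok, hk1]
    push_cast
    field_simp
    ring
  have hc1 : Continuous fun x => hk1 z x := by
    unfold hk1; fun_prop
  have i1 : IntervalIntegrable (fun η : ℝ => (r : ℂ) * (hk z (r - η) + hk z (r + η))) volume 0 y :=
    Continuous.intervalIntegrable (by fun_prop) _ _
  have i2 : IntervalIntegrable (fun η : ℝ => -hk1 z (r - η) - hk1 z (r + η)) volume 0 y :=
    Continuous.intervalIntegrable (by fun_prop) _ _
  have h0 : ok z r 0 = 0 := by simp [ok]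
  have e : okp z r y = (∫ η in (0 : ℝ)..y, (r : ℂ) * (hk z (r - η) + hk z (r + η)))
      - 2 * z * ok z r y := by
    unfold okp
    simp_rw [hpt]
    rw [intervalIntegral.integral_sub i1 (i2.const_mul _),
      intervalIntegral.integral_const_mul (2 * z), intervalIntegral.integral_eq_sub_of_hasDerivAt (fun η _ => hasDerivAt_ok hz0 r η) i2, h0,
      sub_zero]
  have b1 : ‖∫ η in (0 : ℝ)..y, (r : ℂ) * (hk z (r - η) + hk z (r + η))‖
      ≤ r * (2 * ‖z‖ ^ (-(1 / 2 : ℝ))) * |y - 0| := by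
    refine intervalIntegral.norm_integral_le_of_norm_le_const (fun η _ => ?_)
    rw [norm_mul, norm_real, Real.norm_of_nonneg hr]
    refine mul_le_mul_of_nonneg_left ((norm_add_le _ _).trans ?_) hr
    linarith [norm_hk_le hz (r - η), norm_hk_le hz (r + η)]
  have b2 : ‖2 * z * ok z r y‖ ≤ 2 * ‖z‖ * (‖z‖ ^ (-(1 / 2 : ℝ)) * (r * y / ‖z‖)) := by
    rw [norm_mul, norm_mul, Complex.norm_ofNat]
    gcongr
    exact norm_ok_le hz hz0 hr hy
  rw [sub_zero, abs_of_nonneg hy] at b1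
  rw [e]
  refine (norm_sub_le _ _).trans ((add_le_add b1 b2).trans (le_of_eq ?_))
  field_simp
  ring

theorem polyWeight_min {d : ℝ} (hd : 0 < d) : PolyWeight (fun y => min y (y ^ 3 / d)) := by
  refine ⟨by fun_prop, 1, 1, zero_le_one, fun y hy => ?_⟩
  rw [abs_of_nonneg (le_min hy (by positivity)), one_mul, pow_one]
  exact (min_le_left _ _).trans (by linarith)

/-- Dispersive bound without integration by parts. -/
theorem norm_integral_ok_le {z : ℂ} (hz : 0 ≤ z.re) (hz0 : z ≠ 0) {r : ℝ} (hr : 0 ≤ r)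
    {N : ℝ → ℝ → ℂ} (hN : CDecay N) (t : ℝ) :
    ‖∫ y in Set.Ioi 0, ok z r y * ((y : ℂ) * N t y)‖
      ≤ r * (‖z‖ ^ (-(3 / 2 : ℝ)) * ∫ y in Set.Ioi 0, y ^ 2 * ‖N t y‖) := by
  have hzn : 0 < ‖z‖ := norm_pos_iff.2 hz0
  have hp : ‖z‖ ^ (-(3 / 2 : ℝ)) = ‖z‖ ^ (-(1 / 2 : ℝ)) / ‖z‖ := by
    rw [← Real.rpow_sub_one hzn.ne']; norm_num
  rw [← integral_const_mul, ← integral_const_mul]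
  refine norm_integral_le_of_norm_le
    ((((hN.norm.weight (polyWeight_id.pow 1)).const_mul (‖z‖ ^ (-(3 / 2 : ℝ)))).const_mul r).integrableOn
      t) ((ae_restrict_iff' measurableSet_Ioi).2 (ae_of_all _ fun y hy => ?_))
  have hy' : (0 : ℝ) < y := hy
  rw [norm_mul, norm_mul, norm_real, Real.norm_of_nonneg hy'.le]
  calc ‖ok z r y‖ * (y * ‖N t y‖) ≤ (‖z‖ ^ (-(1 / 2 : ℝ)) * (r * y / ‖z‖)) * (y * ‖N t y‖) := by
        gcongr; exact norm_ok_le hz hz0 hr hy'.le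
    _ = _ := by rw [hp]; ring

/-- Dispersive bound after one integration by parts. -/
theorem norm_integral_ok_le_deriv {z : ℂ} (hz : 0 ≤ z.re) (hz0 : z ≠ 0) {r : ℝ} (hr : 0 ≤ r)
    {N N1 : ℝ → ℝ → ℂ} (hN : CDecay N) (hN1 : CDecay N1)
    (hd : ∀ t y, 0 < y → HasDerivAt (N t) (N1 t y) y) (t : ℝ) {d : ℝ} (hd0 : 0 < d)
    (hdz : d ≤ ‖z‖) :
    ‖∫ y in Set.Ioi 0, ok z r y * ((y : ℂ) * N t y)‖
      ≤ r * (4 * d ^ (-(1 / 2 : ℝ)) * ∫ y in Set.Ioi 0, min y (y ^ 3 / d) * ‖N1 t y‖) := by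
  have hzn : 0 < ‖z‖ := norm_pos_iff.2 hz0
  have hcont : Continuous (okp z r) :=
    continuous_iff_continuousAt.2 fun x => (hasDerivAt_okp hz0 r x).continuousAt
  have hb : ∀ y, 0 ≤ y → ‖okp z r y‖ ≤ d ^ (-(1 / 2 : ℝ)) * (4 * r * min y (y ^ 3 / d)) := by
    intro y hy
    have e1 : ‖z‖ ^ (-(1 / 2 : ℝ)) ≤ d ^ (-(1 / 2 : ℝ)) :=
      Real.rpow_le_rpow_of_nonpos hd0 hdz (by norm_num)
    rcases min_cases y (y ^ 3 / d) with ⟨h, _⟩ | ⟨h, _⟩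
    · rw [h]
      refine (norm_okp_le_linear hz hz0 hr hy).trans ?_
      gcongr
    · rw [h]
      refine (norm_okp_le_cubic hz hz0 hr hy).trans ?_
      gcongr
  have hk : PolyKernel (fun _ y => okp z r y) := by
    refine PolyKernel.of_continuous hcont 1 (d ^ (-(1 / 2 : ℝ)) * (4 * r)) (by positivity)
      (fun y hy => (hb y hy).trans ?_)
    rw [pow_one, mul_assoc (d ^ (-(1 / 2 : ℝ))) (4 * r)]
    have h3 : 4 * r * min y (y ^ 3 / d) ≤ 4 * r * (1 + y) :=
      mul_le_mul_of_nonneg_left ((min_le_left _ _).trans (by linarith)) (by positivity)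
    exact mul_le_mul_of_nonneg_left h3 (by positivity)
  have hc : Continuous fun y : ℝ => (y : ℂ) * ok z r y := by
    have := continuous_ok hz0 r; fun_prop
  have hk' : PolyKernel (fun _ y => (y : ℂ) * ok z r y) := by
    refine PolyKernel.of_continuous hc 2 (‖z‖ ^ (-(1 / 2 : ℝ)) * (r / ‖z‖)) (by positivity)
      (fun y hy => ?_)
    rw [norm_mul, norm_real, Real.norm_of_nonneg hy]
    calc y * ‖ok z r y‖ ≤ y * (‖z‖ ^ (-(1 / 2 : ℝ)) * (r * y / ‖z‖)) := by
          gcongr; exact norm_ok_le hz hz0 hr hy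
      _ = ‖z‖ ^ (-(1 / 2 : ℝ)) * (r / ‖z‖) * y ^ 2 := by ring
      _ ≤ _ := by gcongr; linarith
  have c1 := hN.kernel_mul hk'
  have c2 := hN1.kernel_mul hk
  have h := CDecay.integral_deriv_eq (hN.kernel_mul hk) (c1.add c2)
    (fun t y hy => (hasDerivAt_okp hz0 r y).mul (hd t y hy)) t
  rw [integral_add (c1.integrableOn t) (c2.integrableOn t)] at h
  have h0 : okp z r 0 = 0 := by simp [okp]
  rw [h0, zero_mul, neg_zero, add_eq_zero_iff_eq_neg] at h
  have e : ∫ y in Set.Ioi 0, ok z r y * ((y : ℂ) * N t y)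
      = -∫ y in Set.Ioi 0, okp z r y * N1 t y := by
    rw [← h]; congr 1; ext y; ring
  rw [e, norm_neg, ← integral_const_mul, ← integral_const_mul]
  refine norm_integral_le_of_norm_le
    ((((hN1.norm.weight (polyWeight_min hd0)).const_mul (4 * d ^ (-(1 / 2 : ℝ)))).const_mul
      r).integrableOn t) ((ae_restrict_iff' measurableSet_Ioi).2 (ae_of_all _ fun y hy => ?_))
  rw [norm_mul]
  calc ‖okp z r y‖ * ‖N1 t y‖ ≤ (d ^ (-(1 / 2 : ℝ)) * (4 * r * min y (y ^ 3 / d))) * ‖N1 t y‖ := by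
        gcongr; exact hb y (le_of_lt hy)
    _ = _ := by ring

theorem CDecay.continuous_integral {f : ℝ → ℝ → ℂ} (hf : CDecay f) :
    Continuous fun t => ∫ r in Set.Ioi 0, f t r := by
  refine continuous_iff_continuousAt.2 fun t => ?_
  obtain ⟨C, hC, h⟩ := hf.norm.exists_bound (|t| + 1)
  refine continuousAt_of_dominated (bound := fun r => C * (1 + r ^ 2)⁻¹)
    (Filter.Eventually.of_forall fun s => hf.aestronglyMeasurable s) ?_
    ((integrable_inv_one_add_sq.const_mul C).integrableOn) ?_
  · filter_upwards [Metric.ball_mem_nhds t one_pos] with s hs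
    refine (ae_restrict_iff' measurableSet_Ioi).2 (ae_of_all _ fun r hr => ?_)
    rw [Metric.mem_ball, Real.dist_eq] at hs
    have := h s r (by have := abs_sub_abs_le_abs_sub s t; linarith) (le_of_lt hr)
    rwa [abs_norm] at this
  · refine (ae_restrict_iff' measurableSet_Ioi).2 (ae_of_all _ fun r hr => ?_)
    have hr' : r ∈ Set.Ici (0 : ℝ) := Set.Ioi_subset_Ici_self hr
    exact (hf.1.comp_continuous (f := fun s : ℝ => (s, r)) (by fun_prop)
      (fun s => ⟨trivial, hr'⟩)).continuousAt

namespace RadialFlow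

variable (S : RadialFlow)

/-- the complex radial profile -/
def U (t r : ℝ) : ℂ := (S.f t r : ℂ) + (S.g t r : ℂ) * I
/-- its radial derivative -/
def U1 (t r : ℝ) : ℂ := (S.f1 t r : ℂ) + (S.g1 t r : ℂ) * I
/-- `r U` -/
def v (t r : ℝ) : ℂ := (S.a t r : ℂ) + (S.b t r : ℂ) * I
/-- first radial derivative of `r U` -/
def v1 (t r : ℝ) : ℂ := (S.a1 t r : ℂ) + (S.b1 t r : ℂ) * I
/-- second radial derivative of `r U` -/
def v2 (t r : ℝ) : ℂ := (S.a2 t r : ℂ) + (S.b2 t r : ℂ) * I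
/-- the nonlinearity -/
def N (t r : ℝ) : ℂ := ((S.q t r - S.q t r ^ 2 : ℝ) : ℂ) * S.U t r
/-- radial derivative of the nonlinearity -/
def N1 (t r : ℝ) : ℂ := (((1 - 2 * S.q t r) * S.q1 t r : ℝ) : ℂ) * S.U t r
  + ((S.q t r - S.q t r ^ 2 : ℝ) : ℂ) * S.U1 t r

theorem cU : CDecay S.U := S.rf.complex S.rg
theorem cU1 : CDecay S.U1 := S.rf1.complex S.rg1
theorem cv : CDecay S.v := S.ra.complex S.rb
theorem cv1 : CDecay S.v1 := S.ra1.complex S.rb1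
theorem cv2 : CDecay S.v2 := S.ra2.complex S.rb2
theorem cN : CDecay S.N :=
  ((S.rF.mul S.rf).complex (S.rF.mul S.rg)).congr fun t r _ => by
    simp only [N, U]; push_cast; ring
theorem cN1 : CDecay S.N1 :=
  (((S.rF1.mul S.rf).complex (S.rF1.mul S.rg)).add
    ((S.rF.mul S.rf1).complex (S.rF.mul S.rg1))).congr fun t r _ => by
      simp only [N1, U, U1]; push_cast; ring

theorem v_eq (t r : ℝ) : S.v t r = r * S.U t r := by
  simp only [v, U, a, b]; push_cast; ring

theorem dr_U (t r : ℝ) : HasDerivAt (S.U t) (S.U1 t r) r :=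
  (S.hf t r).ofReal_comp.add ((S.hg t r).ofReal_comp.mul_const I)
theorem dr_v (t r : ℝ) : HasDerivAt (S.v t) (S.v1 t r) r :=
  (S.dr_a t r).ofReal_comp.add ((S.dr_b t r).ofReal_comp.mul_const I)
theorem dr_v1 (t r : ℝ) : HasDerivAt (S.v1 t) (S.v2 t r) r :=
  (S.dr_a1 t r).ofReal_comp.add ((S.dr_b1 t r).ofReal_comp.mul_const I)
theorem dr_N (t r : ℝ) : HasDerivAt (S.N t) (S.N1 t r) r :=
  (S.dr_F t r).ofReal_comp.mul (S.dr_U t r)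

theorem dt_v (t r : ℝ) (hr : 0 < r) :
    HasDerivAt (fun s => S.v s r) (I * (S.v2 t r - r * S.N t r)) t := by
  refine HasDerivAt.congr_deriv ((S.dt_a t r hr).ofReal_comp.add
    ((S.dt_b t r hr).ofReal_comp.mul_const I)) ?_
  simp only [v2, N, U, a, b]
  push_cast
  linear_combination (-(((S.b2 t r : ℝ) : ℂ)) + ((S.q t r : ℂ) - (S.q t r : ℂ) ^ 2) * (r * S.g t r)) * I_sq

theorem v_odd (t r : ℝ) : S.v t (-r) = -S.v t r := by
  simp only [v_eq, U, S.f_even, S.g_even]; push_cast; ring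

theorem v_zero (t : ℝ) : S.v t 0 = 0 := by simp [v_eq]

theorem continuous_v (t : ℝ) : Continuous (S.v t) :=
  continuous_iff_continuousAt.2 fun x => (S.dr_v t x).continuousAt

/-- Evolution of the smoothed profile. -/
theorem hasDerivAt_smoothed {ε t r : ℝ} (hε : 0 < ε) (s : ℝ) :
    HasDerivAt (fun s => ∫ y in Set.Ioi 0, ok (ε + I * (t - s : ℝ)) r y * S.v s y)
      (-I * ∫ y in Set.Ioi 0, ok (ε + I * (t - s : ℝ)) r y * (y * S.N s y)) s := by
  set ζ : ℝ → ℂ := fun s => ε + I * (t - s : ℝ) with hζd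
  have hζc : Continuous ζ := by fun_prop
  have hζre : ∀ s, ε ≤ (ζ s).re := fun s => by simp [hζd]
  have hζ0 : ∀ s, ζ s ≠ 0 := fun s hs => by have := hζre s; rw [hs, zero_re] at this; linarith
  have hζd : ∀ s, HasDerivAt ζ (-I) s := fun s => by
    refine HasDerivAt.congr_deriv
      ((((hasDerivAt_id s).const_sub t).ofReal_comp.const_mul I).const_add (ε : ℂ)) ?_
    simp
  have k0 : PolyKernel (fun s y => ok (ζ s) r y) := by
    have := (polyKernel_hk hε hζc hζre r (-1)).add
      ((PolyKernel.const (-1)).mul (polyKernel_hk hε hζc hζre r 1))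
    convert this using 3
    rw [ok, neg_one_mul, one_mul, ← sub_eq_add_neg, neg_one_mul, ← sub_eq_add_neg]
  have k1 : PolyKernel (fun s y => -hk1 (ζ s) (r - y) - hk1 (ζ s) (r + y)) := by
    have := ((PolyKernel.const (-1)).mul (polyKernel_hk1 hε hζc hζre r (-1))).add
      ((PolyKernel.const (-1)).mul (polyKernel_hk1 hε hζc hζre r 1))
    convert this using 3
    ring_nf
  have k2 : PolyKernel (fun s y => hk2 (ζ s) (r - y) - hk2 (ζ s) (r + y)) := by
    have := (polyKernel_hk2 hε hζc hζre r (-1)).add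
      ((PolyKernel.const (-1)).mul (polyKernel_hk2 hε hζc hζre r 1))
    convert this using 3
    rw [neg_one_mul, one_mul, ← sub_eq_add_neg, neg_one_mul, ← sub_eq_add_neg]
  have kid : PolyKernel (fun _ y => ((y : ℝ) : ℂ)) := by
    simpa using PolyKernel.affine 0 1
  have dk0 : ∀ s y, HasDerivAt (fun y => ok (ζ s) r y)
      (-hk1 (ζ s) (r - y) - hk1 (ζ s) (r + y)) y := fun s y => hasDerivAt_ok (hζ0 s) r y
  have dk1 : ∀ s y, HasDerivAt (fun y => -hk1 (ζ s) (r - y) - hk1 (ζ s) (r + y))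
      (hk2 (ζ s) (r - y) - hk2 (ζ s) (r + y)) y := fun s y => by
    have h1 := (hasDerivAt_hk1 (hζ0 s) (r - y)).comp_const_sub r y
    have h2 := (hasDerivAt_hk1 (hζ0 s) (r + y)).comp_const_add r y
    refine HasDerivAt.congr_deriv (h1.neg.sub h2) ?_
    rw [neg_neg]
  have dt0 : ∀ s y, HasDerivAt (fun s => ok (ζ s) r y)
      (-I * (hk2 (ζ s) (r - y) - hk2 (ζ s) (r + y))) s := fun s y => by
    have hre : 0 < (ζ s).re := hε.trans_le (hζre s)
    have h1 := (hasDerivAt_hk_time hre (r - y)).scomp s (hζd s)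
    have h2 := (hasDerivAt_hk_time hre (r + y)).scomp s (hζd s)
    refine HasDerivAt.congr_deriv (h1.sub h2) ?_
    simp only [smul_eq_mul]; ring
  have cP := S.cv.kernel_mul k2
  have cQ := S.cv2.kernel_mul k0
  have cR := (S.cN.kernel_mul kid).kernel_mul k0
  have cb := (S.cv.kernel_mul k1).add ((S.cv1.kernel_mul k0).const_mul (-1))
  have hb := CDecay.integral_deriv_eq cb (cP.add (cQ.const_mul (-1))) (fun s y _ => by
    refine HasDerivAt.congr_deriv (((dk1 s y).mul (S.dr_v s y)).add
      (((dk0 s y).mul (S.dr_v1 s y)).const_mul (-1))) ?_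
    ring) s
  have hb0 : ok (ζ s) r 0 = 0 := by simp [ok]
  rw [hb0, v_zero] at hb
  simp only [mul_zero, zero_mul, add_zero, neg_zero] at hb
  have cD := ((cP.add (cQ.const_mul (-1))).const_mul (-I)).add (cR.const_mul (-I))
  have main := CDecay.hasDerivAt_integral (S.cv.kernel_mul k0) cD (fun s y hy => by
    refine HasDerivAt.congr_deriv ((dt0 s y).mul (S.dt_v s y hy)) ?_
    ring) s
  refine HasDerivAt.congr_deriv main ?_
  rw [integral_add (((cP.add (cQ.const_mul (-1))).const_mul (-I)).integrableOn s)
    ((cR.const_mul (-I)).integrableOn s), integral_const_mul, integral_const_mul, hb, mul_zero,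
    zero_add]

theorem continuous_smoothed_deriv {ε t r : ℝ} (hε : 0 < ε) :
    Continuous fun s => ∫ y in Set.Ioi 0, ok (ε + I * (t - s : ℝ)) r y * (y * S.N s y) := by
  set ζ : ℝ → ℂ := fun s => ε + I * (t - s : ℝ) with hζd
  have hζc : Continuous ζ := by fun_prop
  have hζre : ∀ s, ε ≤ (ζ s).re := fun s => by simp [hζd]
  have k0 : PolyKernel (fun s y => ok (ζ s) r y) := by
    have := (polyKernel_hk hε hζc hζre r (-1)).add
      ((PolyKernel.const (-1)).mul (polyKernel_hk hε hζc hζre r 1))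
    convert this using 3
    rw [ok, neg_one_mul, one_mul, ← sub_eq_add_neg, neg_one_mul, ← sub_eq_add_neg]
  have kid : PolyKernel (fun _ y => ((y : ℝ) : ℂ)) := by
    simpa using PolyKernel.affine 0 1
  exact ((S.cN.kernel_mul kid).kernel_mul k0).continuous_integral

theorem exists_bound_v (t : ℝ) : ∃ C, ∀ y, ‖S.v t y‖ ≤ C := by
  obtain ⟨C, hC, h⟩ := S.cv.2 |t| 0
  refine ⟨C, fun y => ?_⟩
  rcases le_total 0 y with hy | hy
  · simpa using h t y le_rfl hy
  · have := h t (-y) le_rfl (by linarith)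
    simpa [v_odd] using this

theorem smoothed_eq {δ t r : ℝ} (hδ : 0 < δ) :
    ∫ y in Set.Ioi 0, ok ((δ ^ 2 : ℝ) : ℂ) r y * S.v t y
      = ∫ x : ℝ, (Real.exp (-(1 / 4) * x ^ 2) : ℂ) * S.v t (r - δ * x) := by
  have hz : ((δ ^ 2 : ℝ) : ℂ) ≠ 0 := by exact_mod_cast (by positivity : δ ^ 2 ≠ 0)
  have hhk : ∀ x, hk ((δ ^ 2 : ℝ) : ℂ) (δ * x) = δ⁻¹ * (Real.exp (-(1 / 4) * x ^ 2) : ℂ) := by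
    intro x
    have hδc : (δ : ℂ) ≠ 0 := by exact_mod_cast hδ.ne'
    rw [hk, ← ofReal_cpow (by positivity), ← Real.rpow_natCast, ← Real.rpow_mul hδ.le]
    have : ((2 : ℕ) : ℝ) * -(1 / 2) = -1 := by norm_num
    rw [this, Real.rpow_neg_one, ofReal_inv, ofReal_exp]
    congr 2
    push_cast
    rw [Real.rpow_two]
    push_cast
    field_simp
  obtain ⟨C, hC⟩ := S.exists_bound_v t
  have hg : Integrable (fun x : ℝ => (Real.exp (-(1 / 4) * x ^ 2) : ℂ) * S.v t (r - δ * x)) := by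
    refine Integrable.mul_bdd (c := C) ?_ ?_ (ae_of_all _ fun x => hC _)
    · exact (integrable_exp_neg_mul_sq (by norm_num)).ofReal
    · have := S.continuous_v t
      exact Continuous.aestronglyMeasurable (by fun_prop)
  have e1 : ∀ x : ℝ, (Real.exp (-(1 / 4) * x ^ 2) : ℂ) * S.v t (r - δ * x)
      = δ * (fun y => hk ((δ ^ 2 : ℝ) : ℂ) y * S.v t (r - y)) (δ * x) := fun x => by
    have hδc : (δ : ℂ) ≠ 0 := by exact_mod_cast hδ.ne'
    simp only [hhk]
    push_cast
    field_simp
  have hk_int : Integrable (fun y : ℝ => hk ((δ ^ 2 : ℝ) : ℂ) y * S.v t (r - y)) := by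
    rw [← integrable_comp_mul_left_iff _ hδ.ne']
    have hδc : (δ : ℂ) ≠ 0 := by exact_mod_cast hδ.ne'
    simp_rw [e1] at hg
    simpa [hδ.ne'] using hg.const_mul ((δ : ℂ)⁻¹)
  have hk_int' : Integrable (fun y : ℝ => hk ((δ ^ 2 : ℝ) : ℂ) (r - y) * S.v t y) := by
    simpa using hk_int.comp_sub_left r
  have hk_neg : Integrable (fun y : ℝ => hk ((δ ^ 2 : ℝ) : ℂ) (r + y) * S.v t y) := by
    have := hk_int'.comp_neg.neg
    refine this.congr (ae_of_all _ fun y => ?_)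
    simp [v_odd]
  simp_rw [e1]
  rw [integral_const_mul, Measure.integral_comp_mul_left (fun y => hk ((δ ^ 2 : ℝ) : ℂ) y * S.v t (r - y)) δ,
    abs_of_pos (inv_pos.2 hδ), real_smul, ofReal_inv, mul_inv_cancel_left₀ (by exact_mod_cast hδ.ne'),
    ← integral_sub_left_eq_self _ volume r]
  simp only [sub_sub_cancel, ok, sub_mul]
  rw [integral_sub hk_int'.integrableOn hk_neg.integrableOn,
    ← integral_add_compl (measurableSet_Ioi (a := (0 : ℝ))) hk_int', Set.compl_Ioi, sub_eq_add_neg]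
  congr 1
  rw [← integral_neg, ← neg_zero, ← integral_comp_neg_Ioi]
  simp [v_odd]

theorem tendsto_smoothed (t r : ℝ) :
    Filter.Tendsto (fun δ : ℝ => ∫ y in Set.Ioi 0, ok ((δ ^ 2 : ℝ) : ℂ) r y * S.v t y)
      (nhdsWithin 0 (Set.Ioi 0)) (nhds ((√(4 * Real.pi) : ℝ) * S.v t r)) := by
  obtain ⟨C, hC⟩ := S.exists_bound_v t
  have hc := S.continuous_v t
  have h1 : Filter.Tendsto (fun δ : ℝ => ∫ x : ℝ,
      (Real.exp (-(1 / 4) * x ^ 2) : ℂ) * S.v t (r - δ * x))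
      (nhdsWithin 0 (Set.Ioi 0)) (nhds (∫ x : ℝ, (Real.exp (-(1 / 4) * x ^ 2) : ℂ) * S.v t r)) := by
    refine tendsto_integral_filter_of_dominated_convergence
      (fun x => Real.exp (-(1 / 4) * x ^ 2) * C) (Filter.Eventually.of_forall fun δ => ?_)
      (Filter.Eventually.of_forall fun δ => ae_of_all _ fun x => ?_) ?_ (ae_of_all _ fun x => ?_)
    · exact Continuous.aestronglyMeasurable (by fun_prop)
    · rw [norm_mul, norm_real, Real.norm_of_nonneg (Real.exp_nonneg _)]
      exact mul_le_mul_of_nonneg_left (hC _) (Real.exp_nonneg _)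
    · exact (integrable_exp_neg_mul_sq (by norm_num)).mul_const C
    · have h2 : Continuous fun δ : ℝ => (Real.exp (-(1 / 4) * x ^ 2) : ℂ) * S.v t (r - δ * x) := by
        fun_prop
      have := (h2.tendsto 0).mono_left (nhdsWithin_le_nhds (s := Set.Ioi 0))
      simpa using this
  rw [integral_mul_const, integral_complex_ofReal, integral_gaussian] at h1
  have e : Real.pi / (1 / 4) = 4 * Real.pi := by ring
  rw [e] at h1
  refine h1.congr' ?_
  filter_upwards [self_mem_nhdsWithin] with δ hδ
  exact (S.smoothed_eq hδ).symm

end RadialFlow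

namespace RadialFlow

variable (S : RadialFlow)

/-- Pointwise Duhamel bound: at each earlier time one may use the kernel bound either with or
without integration by parts. -/
theorem duhamel_bound {t r : ℝ} (ht : 0 < t) (hr : 0 < r) (β : ℝ → ℝ≥0∞)
    (hβ : ∀ s ∈ Set.Ioo 0 t,
      ENNReal.ofReal ((t - s) ^ (-(3 / 2 : ℝ)) * ∫ y in Set.Ioi 0, y ^ 2 * ‖S.N s y‖) ≤ β s ∨
      ENNReal.ofReal (4 * (t - s) ^ (-(1 / 2 : ℝ)) *
        ∫ y in Set.Ioi 0, min y (y ^ 3 / (t - s)) * ‖S.N1 s y‖) ≤ β s) :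
    ENNReal.ofReal ‖S.U t r‖ ≤
      ENNReal.ofReal (t ^ (-(3 / 2 : ℝ)) * ∫ y in Set.Ioi 0, y ^ 2 * ‖S.U 0 y‖)
        + ∫⁻ s in Set.Ioo 0 t, β s := by
  set A0 : ℝ := t ^ (-(3 / 2 : ℝ)) * ∫ y in Set.Ioi 0, y ^ 2 * ‖S.U 0 y‖ with hA0
  have key : ∀ δ : ℝ, 0 < δ →
      ENNReal.ofReal ‖∫ y in Set.Ioi 0, ok ((δ ^ 2 : ℝ) : ℂ) r y * S.v t y‖
        ≤ ENNReal.ofReal r * (ENNReal.ofReal A0 + ∫⁻ s in Set.Ioo 0 t, β s) := by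
    intro δ hδ
    have hε : 0 < δ ^ 2 := by positivity
    set ε := δ ^ 2
    set J : ℝ → ℂ := fun s => ∫ y in Set.Ioi 0, ok (ε + I * (t - s : ℝ)) r y * S.v s y with hJ
    set D : ℝ → ℂ := fun s => ∫ y in Set.Ioi 0, ok (ε + I * (t - s : ℝ)) r y * (y * S.N s y)
      with hD
    have hJd : ∀ s, HasDerivAt J (-I * D s) s := fun s => S.hasDerivAt_smoothed hε s
    have hDc : Continuous D := S.continuous_smoothed_deriv hε
    have hre : ∀ s : ℝ, (ε + I * (t - s : ℝ) : ℂ).re = ε := fun s => by simp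
    have him : ∀ s : ℝ, (ε + I * (t - s : ℝ) : ℂ).im = t - s := fun s => by simp
    have hz : ∀ s : ℝ, 0 ≤ (ε + I * (t - s : ℝ) : ℂ).re := fun s => by rw [hre]; exact hε.le
    have hz0 : ∀ s : ℝ, (ε + I * (t - s : ℝ) : ℂ) ≠ 0 := fun s h => by
      have := hre s; rw [h, zero_re] at this; exact hε.ne this
    have hn : ∀ s : ℝ, t - s ≤ ‖(ε + I * (t - s : ℝ) : ℂ)‖ := fun s => by
      have := (le_abs_self _).trans (abs_im_le_norm (ε + I * (t - s : ℝ) : ℂ))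
      rwa [him] at this
    have h1 : J t - J 0 = ∫ s in (0 : ℝ)..t, -I * D s :=
      (intervalIntegral.integral_eq_sub_of_hasDerivAt (fun s _ => hJd s)
        ((continuous_const.mul hDc).intervalIntegrable _ _)).symm
    have h2 : ‖J t - J 0‖ₑ ≤ ENNReal.ofReal r * ∫⁻ s in Set.Ioo 0 t, β s := by
      rw [h1, intervalIntegral.integral_of_le ht.le, integral_Ioc_eq_integral_Ioo]
      refine (enorm_integral_le_lintegral_enorm _).trans ?_
      rw [← lintegral_const_mul' _ _ ENNReal.ofReal_ne_top]
      refine setLIntegral_mono' measurableSet_Ioo (fun s hs => ?_)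
      have hts : 0 < t - s := sub_pos.2 hs.2
      rw [enorm_mul, enorm_neg, ← ofReal_norm, ← ofReal_norm, norm_I, ENNReal.ofReal_one, one_mul]
      rcases hβ s hs with h | h
      · refine le_trans ?_ (mul_le_mul_right h _)
        rw [← ENNReal.ofReal_mul hr.le]
        refine ENNReal.ofReal_le_ofReal ((norm_integral_ok_le (hz s) (hz0 s) hr.le S.cN s).trans ?_)
        have h0 : 0 ≤ ∫ y in Set.Ioi 0, y ^ 2 * ‖S.N s y‖ :=
          integral_nonneg fun y => by positivity
        have := Real.rpow_le_rpow_of_nonpos hts (hn s) (show -(3 / 2 : ℝ) ≤ 0 by norm_num)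
        gcongr
      · refine le_trans ?_ (mul_le_mul_right h _)
        rw [← ENNReal.ofReal_mul hr.le]
        exact ENNReal.ofReal_le_ofReal (norm_integral_ok_le_deriv (hz s) (hz0 s) hr.le S.cN S.cN1
          (fun t y _ => S.dr_N t y) s hts (hn s))
    have h3 : ‖J 0‖ ≤ r * A0 := by
      have := norm_integral_ok_le (hz 0) (hz0 0) hr.le S.cU 0
      simp_rw [← v_eq] at this
      refine this.trans ?_
      have h0 : 0 ≤ ∫ y in Set.Ioi 0, y ^ 2 * ‖S.U 0 y‖ :=
        integral_nonneg fun y => by positivity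
      have h4 := hn 0
      rw [sub_zero] at h4
      have := Real.rpow_le_rpow_of_nonpos ht h4 (show -(3 / 2 : ℝ) ≤ 0 by norm_num)
      rw [hA0, sub_zero]
      gcongr
    have h4 : ∫ y in Set.Ioi 0, ok (ε : ℂ) r y * S.v t y = J t := by
      simp [hJ]
    rw [h4, ofReal_norm, mul_add, ← ENNReal.ofReal_mul hr.le]
    calc ‖J t‖ₑ = ‖J 0 + (J t - J 0)‖ₑ := by rw [add_sub_cancel]
      _ ≤ ‖J 0‖ₑ + ‖J t - J 0‖ₑ := enorm_add_le _ _
      _ ≤ _ := by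
        gcongr
        rw [← ofReal_norm]
        exact ENNReal.ofReal_le_ofReal h3
  have hlim := (ENNReal.continuous_ofReal.tendsto _).comp (S.tendsto_smoothed t r).norm
  have hle := le_of_tendsto hlim (by
    filter_upwards [self_mem_nhdsWithin] with δ hδ
    exact key δ hδ)
  rw [norm_mul, norm_real, Real.norm_of_nonneg (Real.sqrt_nonneg _), v_eq, norm_mul, norm_real,
    Real.norm_of_nonneg hr.le] at hle
  have h1 : ENNReal.ofReal r * ENNReal.ofReal ‖S.U t r‖
      ≤ ENNReal.ofReal r * (ENNReal.ofReal A0 + ∫⁻ s in Set.Ioo 0 t, β s) := by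
    refine le_trans ?_ hle
    rw [← ENNReal.ofReal_mul hr.le]
    refine ENNReal.ofReal_le_ofReal (le_mul_of_one_le_left (by positivity) ?_)
    rw [Real.one_le_sqrt]
    linarith [Real.pi_gt_three]
  exact (ENNReal.mul_le_mul_iff_right (by simpa using hr) ENNReal.ofReal_ne_top).1 h1

theorem norm_U_sq (t r : ℝ) : ‖S.U t r‖ ^ 2 = S.q t r := by
  rw [← normSq_eq_norm_sq, U, normSq_add_mul_I, q]

theorem norm_U1_sq (t r : ℝ) : ‖S.U1 t r‖ ^ 2 = S.f1 t r ^ 2 + S.g1 t r ^ 2 := by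
  rw [← normSq_eq_norm_sq, U1, normSq_add_mul_I]

theorem norm_N_le (t r : ℝ) : ‖S.N t r‖ ≤ (S.q t r + S.q t r ^ 2) * ‖S.U t r‖ := by
  have hq := S.q_nonneg t r
  rw [N, norm_mul, norm_real]
  gcongr
  rw [Real.norm_eq_abs, abs_le]
  constructor <;> nlinarith

theorem abs_q1_le (t r : ℝ) : |S.q1 t r| ≤ 2 * (‖S.U t r‖ * ‖S.U1 t r‖) := by
  refine abs_le_of_sq_le_sq ?_ (by positivity)
  have : (2 * (‖S.U t r‖ * ‖S.U1 t r‖)) ^ 2 = 4 * (‖S.U t r‖ ^ 2 * ‖S.U1 t r‖ ^ 2) := by ring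
  rw [this, norm_U_sq, norm_U1_sq, q, q1]
  nlinarith [sq_nonneg (S.f t r * S.g1 t r - S.g t r * S.f1 t r)]

theorem norm_N1_le (t r : ℝ) :
    ‖S.N1 t r‖ ≤ (3 * S.q t r + 5 * S.q t r ^ 2) * ‖S.U1 t r‖ := by
  have hq := S.q_nonneg t r
  have h1 := S.abs_q1_le t r
  have h2 := S.norm_U_sq t r
  refine (norm_add_le _ _).trans ?_
  rw [norm_mul, norm_mul, norm_real, norm_real, norm_mul, Real.norm_eq_abs, Real.norm_eq_abs,
    Real.norm_eq_abs]
  have h3 : |1 - 2 * S.q t r| ≤ 1 + 2 * S.q t r := by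
    rw [abs_le]; constructor <;> linarith
  have h4 : |S.q t r - S.q t r ^ 2| ≤ S.q t r + S.q t r ^ 2 := by
    rw [abs_le]; constructor <;> nlinarith
  calc |1 - 2 * S.q t r| * |S.q1 t r| * ‖S.U t r‖ + |S.q t r - S.q t r ^ 2| * ‖S.U1 t r‖
      ≤ (1 + 2 * S.q t r) * (2 * (‖S.U t r‖ * ‖S.U1 t r‖)) * ‖S.U t r‖
        + (S.q t r + S.q t r ^ 2) * ‖S.U1 t r‖ := by gcongr
    _ = ((1 + 2 * S.q t r) * 2 * ‖S.U t r‖ ^ 2 + (S.q t r + S.q t r ^ 2)) * ‖S.U1 t r‖ := by ring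
    _ = _ := by rw [h2]; ring

/-- `r² |∂_r U|²` -/
def grd (t r : ℝ) : ℝ := r ^ 2 * ‖S.U1 t r‖ ^ 2

theorem rgrd : RapidDecay S.grd := (S.cU1.norm.pow 1).weight (polyWeight_id.pow 1)

theorem grd_nonneg (t r : ℝ) : 0 ≤ S.grd t r := by unfold grd; positivity

theorem integral_grd (t : ℝ) : ∫ r in Set.Ioi 0, S.grd t r = S.B t := by
  have hr1 : RapidDecay fun t r => r * S.q t r := S.rq.weight polyWeight_id
  have hr2 : RapidDecay fun t r => S.q t r + r * S.q1 t r := S.rq.add (S.rq1.weight polyWeight_id)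
  have h := RapidDecay.integral_deriv_eq hr1 hr2 (fun t r _ => by
    refine HasDerivAt.congr_deriv ((hasDerivAt_id r).mul (S.dr_q t r)) ?_
    simp) t
  have e : ∀ r, S.kin t r = S.grd t r + (S.q t r + r * S.q1 t r) := fun r => by
    rw [grd, norm_U1_sq]; simp only [kin, a1, b1, q, q1]; ring
  rw [B]
  simp_rw [e]
  rw [integral_add (S.rgrd.integrableOn t) (hr2.integrableOn t), h]
  simp

end RadialFlow

theorem polyWeight_sqrt : PolyWeight (fun y => √y) :=
  ⟨Real.continuous_sqrt.continuousOn, 1, 1, zero_le_one, fun r hr => by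
    rw [abs_of_nonneg (Real.sqrt_nonneg r), one_mul, pow_one]
    refine Real.sqrt_le_iff.2 ⟨by linarith, by nlinarith⟩⟩

namespace RadialFlow

variable (S : RadialFlow)

theorem rN1 : RapidDecay (fun t y => ‖S.N1 t y‖) := S.cN1.norm

/-- weighted norm of the derivative of the nonlinearity -/
def n2 (t : ℝ) : ℝ := ∫ y in Set.Ioi 0, y ^ 2 * √y * ‖S.N1 t y‖

theorem rn2 : RapidDecay (fun t y => y ^ 2 * √y * ‖S.N1 t y‖) :=
  S.rN1.weight ((polyWeight_id.pow 1).mul polyWeight_sqrt)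

theorem n2_pointwise {t y p : ℝ} (hy : 0 ≤ y) (hp : 0 ≤ p) (h : y * S.q t y ≤ p ^ 2) :
    y ^ 2 * √y * ‖S.N1 t y‖ ≤
      p * (3 / 2 * S.rho t y + 5 / 2 * S.d6 t y + 4 * S.grd t y) := by
  have h1 := S.norm_N1_le t y
  have h2 := S.norm_U_sq t y
  set m := ‖S.U t y‖
  set n := ‖S.U1 t y‖ with hn
  have hm0 : 0 ≤ m := norm_nonneg _
  have hn0 : 0 ≤ n := norm_nonneg _
  have hs : √y ^ 2 = y := Real.sq_sqrt hy
  have h3 : √y * m ≤ p := abs_le_of_sq_le_sq' (by rw [mul_pow, hs, h2]; exact h) hp |>.2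
  have e1 : S.rho t y = (y * m) ^ 2 := by
    rw [mul_pow, h2]; simp only [rho, a, b, q]; ring
  have e2 : S.d6 t y = (y * m ^ 3) ^ 2 := by
    simp only [d6]; rw [← h2]; ring
  have e3 : S.grd t y = (y * n) ^ 2 := by rw [grd]; ring
  rw [e1, e2, e3]
  rw [← h2] at h1
  calc y ^ 2 * √y * ‖S.N1 t y‖ ≤ y ^ 2 * √y * ((3 * m ^ 2 + 5 * (m ^ 2) ^ 2) * n) := by gcongr
    _ = (√y * m) * (3 * ((y * m) * (y * n)) + 5 * ((y * m ^ 3) * (y * n))) := by ring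
    _ ≤ p * (3 * ((y * m) * (y * n)) + 5 * ((y * m ^ 3) * (y * n))) := by gcongr
    _ ≤ _ := mul_le_mul_of_nonneg_left
      (by nlinarith [sq_nonneg (y * m - y * n), sq_nonneg (y * m ^ 3 - y * n)]) hp

theorem n2_le (h : S.Threshold) {t p : ℝ} (hp : 0 ≤ p)
    (hq : ∀ y, 0 ≤ y → y * S.q t y ≤ p ^ 2) :
    S.n2 t ≤ p * (3 / 2 * S.mass 0 + 13 / 2 * sob) := by
  have hi : RapidDecay fun t y => 3 / 2 * S.rho t y + 5 / 2 * S.d6 t y + 4 * S.grd t y :=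
    ((S.rrho.const_mul _).add (S.rd6.const_mul _)).add (S.rgrd.const_mul _)
  calc S.n2 t ≤ ∫ y in Set.Ioi 0, p * (3 / 2 * S.rho t y + 5 / 2 * S.d6 t y + 4 * S.grd t y) :=
        setIntegral_mono_on (S.rn2.integrableOn t) ((hi.const_mul p).integrableOn t)
          measurableSet_Ioi fun y hy => S.n2_pointwise (le_of_lt hy) hp (hq y (le_of_lt hy))
    _ = p * (3 / 2 * S.mass t + 5 / 2 * S.L6 t + 4 * S.B t) := by
      rw [integral_const_mul, integral_add, integral_add, integral_const_mul, integral_const_mul,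
        integral_const_mul, integral_grd, mass, L6]
      · exact (S.rrho.const_mul _).integrableOn t
      · exact (S.rd6.const_mul _).integrableOn t
      · exact ((S.rrho.const_mul _).add (S.rd6.const_mul _)).integrableOn t
      · exact (S.rgrd.const_mul _).integrableOn t
    _ ≤ _ := by
      have h1 := h.L6_le_sob t
      have h2 := h.B_lt t
      rw [S.mass_eq t]
      exact mul_le_mul_of_nonneg_left (by linarith) hp

theorem mul_q_le_of_local (h : S.Threshold) {R l t y : ℝ} (hR : 0 < R) (hl : 0 < l) (hy : 0 ≤ y) :
    y * S.q t y ≤ (S.mass 0 + sob) / l + (1 + l / R) ^ 2 * S.K R t := by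
  have hM := h.mass_pos
  have hs := sob_pos
  have hK := S.K_nonneg R t
  have hq := S.q_nonneg t y
  rcases le_total y l with hyl | hyl
  · have h1 := S.loc_q_le hR t y hy
    have h2 : 1 ≤ (1 + l / R) * hinv R y := by
      unfold hinv
      rw [← div_eq_mul_inv, one_le_div (by positivity)]
      gcongr
    have h3 : 1 ≤ ((1 + l / R) * hinv R y) ^ 2 := one_le_pow₀ h2
    calc y * S.q t y ≤ ((1 + l / R) * hinv R y) ^ 2 * (y * S.q t y) :=
          le_mul_of_one_le_left (by positivity) h3
      _ = (1 + l / R) ^ 2 * (y * (hinv R y ^ 2 * S.q t y)) := by ring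
      _ ≤ (1 + l / R) ^ 2 * S.K R t := by gcongr
      _ ≤ _ := le_add_of_nonneg_left (by positivity)
  · have h1 := S.rho_le t y hy
    have h2 := h.B_lt t
    rw [S.mass_eq t] at h1
    have e1 : S.rho t y = y ^ 2 * S.q t y := by simp only [rho, a, b, q]; ring
    rw [e1] at h1
    have h3 : y * S.q t y ≤ (S.mass 0 + sob) / l := by
      rw [le_div_iff₀ hl]
      calc y * S.q t y * l ≤ y * S.q t y * y := by gcongr
        _ = y ^ 2 * S.q t y := by ring
        _ ≤ _ := by linarith
    exact h3.trans (le_add_of_nonneg_right (by positivity))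

theorem exists_n2_bound (h : S.Threshold) {R η : ℝ} (hR : 0 < R) (hη : 0 < η) :
    ∃ C, 0 ≤ C ∧ ∀ t, S.n2 t ≤ η + C * S.K R t := by
  have hM := h.mass_pos
  have hs := sob_pos
  set c := S.mass 0 + sob with hc
  set D := 3 / 2 * S.mass 0 + 13 / 2 * sob with hD
  have hc0 : 0 < c := by positivity
  have hD0 : 0 < D := by positivity
  set l := c * D ^ 2 / η ^ 2 with hl
  have hl0 : 0 < l := by positivity
  refine ⟨D ^ 2 / (2 * η) * (1 + l / R) ^ 2, by positivity, fun t => ?_⟩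
  have hK := S.K_nonneg R t
  set P := c / l + (1 + l / R) ^ 2 * S.K R t with hP
  have hP0 : 0 ≤ P := by positivity
  have h1 := S.n2_le h (t := t) (Real.sqrt_nonneg P) fun y hy => by
    rw [Real.sq_sqrt hP0]; exact S.mul_q_le_of_local h hR hl0 hy
  rw [← hD] at h1
  have h2 : √P * D ≤ η / 2 + D ^ 2 / (2 * η) * P := by
    have h4 : √P ^ 2 = P := Real.sq_sqrt hP0
    have : η / 2 + D ^ 2 / (2 * η) * √P ^ 2 - √P * D = (η - D * √P) ^ 2 / (2 * η) := by
      field_simp; ring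
    rw [h4] at this
    have h5 : 0 ≤ (η - D * √P) ^ 2 / (2 * η) := by positivity
    linarith
  have h3 : D ^ 2 / (2 * η) * (c / l) = η / 2 := by
    rw [hl]; field_simp
  calc S.n2 t ≤ η / 2 + D ^ 2 / (2 * η) * P := h1.trans h2
    _ = η / 2 + D ^ 2 / (2 * η) * (c / l) + D ^ 2 / (2 * η) * (1 + l / R) ^ 2 * S.K R t := by
      rw [hP]; ring
    _ = _ := by rw [h3]; ring

theorem exists_small_window (h : S.Threshold) {τ η : ℝ} (hτ : 0 < τ) (hη : 0 < η) (T1 : ℝ) :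
    ∃ T, T1 ≤ T ∧ ∫⁻ s in Set.Ioo T (T + 2 * τ), ENNReal.ofReal (S.n2 s) ≤ ENNReal.ofReal η := by
  obtain ⟨R, C, T0, Vm, V, V', hR, hC, hV, hV', hVm, hK⟩ := h.exists_morawetz
  obtain ⟨D, hD, hn⟩ := S.exists_n2_bound h hR (η := η / (4 * τ)) (by positivity)
  have hmono : Monotone V := monotone_of_deriv_nonneg (fun t => (hV t).differentiableAt)
    (fun t => by rw [(hV t).deriv]; exact hV' t)
  have hlim := tendsto_atTop_ciSup hmono ⟨Vm, by rintro _ ⟨t, rfl⟩; exact hVm t⟩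
  have hlim2 : Filter.Tendsto (fun T => D * C * (V (T + 2 * τ) - V T)) Filter.atTop (nhds 0) := by
    have := ((hlim.comp (Filter.tendsto_atTop_add_const_right _ (2 * τ) Filter.tendsto_id)).sub
      hlim).const_mul (D * C)
    simpa using this
  obtain ⟨T, hT1, hT0, hT⟩ := ((Filter.eventually_ge_atTop T1).and
    ((Filter.eventually_ge_atTop T0).and
      (hlim2.eventually (gt_mem_nhds (half_pos hη))))).exists
  refine ⟨T, hT1, ?_⟩
  have hle : T ≤ T + 2 * τ := by linarith
  have hi : IntervalIntegrable V' volume T (T + 2 * τ) :=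
    intervalIntegral.intervalIntegrable_deriv_of_nonneg
      (fun t _ => (hV t).continuousAt.continuousWithinAt) (fun t _ => hV t) (fun t _ => hV' t)
  have hint := intervalIntegral.integral_eq_sub_of_hasDerivAt (fun t _ => hV t) hi
  have hi2 : IntegrableOn (fun s => η / (4 * τ) + D * C * V' s) (Set.Ioc T (T + 2 * τ)) :=
    (integrableOn_const measure_Ioc_lt_top.ne).add
      (((intervalIntegrable_iff_integrableOn_Ioc_of_le hle).1 hi).const_mul _)
  calc ∫⁻ s in Set.Ioo T (T + 2 * τ), ENNReal.ofReal (S.n2 s)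
      ≤ ∫⁻ s in Set.Ioo T (T + 2 * τ), ENNReal.ofReal (η / (4 * τ) + D * C * V' s) := by
        refine setLIntegral_mono' measurableSet_Ioo fun s hs => ENNReal.ofReal_le_ofReal ?_
        have h1 := hK s (hT0.trans hs.1.le)
        calc _ ≤ _ := hn s
          _ ≤ η / (4 * τ) + D * (C * V' s) := by gcongr
          _ = _ := by ring
    _ = ∫⁻ s in Set.Ioc T (T + 2 * τ), ENNReal.ofReal (η / (4 * τ) + D * C * V' s) :=
        setLIntegral_congr Ioo_ae_eq_Ioc
    _ = ENNReal.ofReal (∫ s in Set.Ioc T (T + 2 * τ), (η / (4 * τ) + D * C * V' s)) := by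
        refine (ofReal_integral_eq_lintegral_ofReal hi2 (ae_of_all _ fun s => ?_)).symm
        have := hV' s
        change 0 ≤ η / (4 * τ) + D * C * V' s
        positivity
    _ ≤ ENNReal.ofReal η := by
        refine ENNReal.ofReal_le_ofReal ?_
        rw [← intervalIntegral.integral_of_le hle, intervalIntegral.integral_add
          (by simp) (hi.const_mul _), intervalIntegral.integral_const_mul, hint,
          intervalIntegral.integral_const]
        have : (T + 2 * τ - T) • (η / (4 * τ)) = η / 2 := by
          rw [smul_eq_mul]; field_simp; ring
        linarith

end RadialFlow

theorem lintegral_rpow_Ioo {p c : ℝ} (hp : p < 1) (hc : 0 ≤ c) :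
    ∫⁻ s in Set.Ioo 0 c, ENNReal.ofReal (s ^ (-p)) = ENNReal.ofReal (c ^ (1 - p) / (1 - p)) := by
  have hi : IntervalIntegrable (fun s : ℝ => s ^ (-p)) volume 0 c :=
    intervalIntegral.intervalIntegrable_rpow' (by linarith)
  rw [setLIntegral_congr Ioo_ae_eq_Ioc, ← ofReal_integral_eq_lintegral_ofReal
    ((intervalIntegrable_iff_integrableOn_Ioc_of_le hc).1 hi),
    ← intervalIntegral.integral_of_le hc, integral_rpow (Or.inl (by linarith)),
    Real.zero_rpow (by linarith), sub_zero, neg_add_eq_sub]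
  exact (ae_restrict_iff' measurableSet_Ioc).2 (ae_of_all _ fun s hs => Real.rpow_nonneg hs.1.le _)

theorem lintegral_rpow_Ioi {p c : ℝ} (hp : 1 < p) (hc : 0 < c) :
    ∫⁻ s in Set.Ioi c, ENNReal.ofReal (s ^ (-p)) = ENNReal.ofReal (c ^ (1 - p) / (p - 1)) := by
  rw [← ofReal_integral_eq_lintegral_ofReal (integrableOn_Ioi_rpow_of_lt (by linarith) hc),
    integral_Ioi_rpow_of_lt (by linarith) hc, neg_add_eq_sub]
  · congr 1
    rw [← neg_sub p 1, div_neg, neg_div, neg_neg]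
  · exact (ae_restrict_iff' measurableSet_Ioi).2
      (ae_of_all _ fun s hs => Real.rpow_nonneg (hc.trans hs).le _)

/-- time-weighted near-field kernel, extended by zero to non-positive lags -/
def nearKernel (d y : ℝ) : ℝ := if 0 < d then d ^ (-(1 / 4 : ℝ)) * min y (y ^ 3 / d) else 0

theorem measurable_nearKernel : Measurable fun p : ℝ × ℝ => nearKernel p.1 p.2 := by
  unfold nearKernel
  refine Measurable.ite (measurableSet_lt measurable_const measurable_fst) ?_ measurable_const
  exact (measurable_fst.pow_const _).mul
    (measurable_snd.min ((measurable_snd.pow_const 3).div measurable_fst))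

theorem lintegral_nearKernel_le {y : ℝ} (hy : 0 < y) :
    ∫⁻ d, ENNReal.ofReal (nearKernel d y) ≤ ENNReal.ofReal (16 / 3 * (y ^ 2 * √y)) := by
  have hy2 : 0 < y ^ 2 := by positivity
  have e1 : (y ^ 2 : ℝ) ^ (1 - (1 / 4 : ℝ)) = y * √y := by
    rw [Real.sqrt_eq_rpow, ← Real.rpow_natCast, ← Real.rpow_mul hy.le]
    nth_rewrite 2 [← Real.rpow_one y]
    rw [← Real.rpow_add hy]; norm_num
  have e2 : y ^ 3 * (y ^ 2 : ℝ) ^ (1 - (5 / 4 : ℝ)) = y ^ 2 * √y := by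
    rw [Real.sqrt_eq_rpow, ← Real.rpow_natCast, ← Real.rpow_natCast, ← Real.rpow_mul hy.le,
      ← Real.rpow_add hy, ← Real.rpow_add hy]; norm_num
  calc ∫⁻ d, ENNReal.ofReal (nearKernel d y)
      ≤ ∫⁻ d, ((Set.Ioo 0 (y ^ 2)).indicator (fun d => ENNReal.ofReal y *
          ENNReal.ofReal (d ^ (-(1 / 4 : ℝ)))) d +
        (Set.Ici (y ^ 2)).indicator (fun d => ENNReal.ofReal (y ^ 3) *
          ENNReal.ofReal (d ^ (-(5 / 4 : ℝ)))) d) := by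
        refine lintegral_mono fun d => ?_
        unfold nearKernel
        split_ifs with hd
        · rcases lt_or_ge d (y ^ 2) with hdy | hdy
          · refine le_trans ?_ le_self_add
            rw [Set.indicator_of_mem (show d ∈ Set.Ioo 0 (y ^ 2) from ⟨hd, hdy⟩),
              ← ENNReal.ofReal_mul hy.le]
            refine ENNReal.ofReal_le_ofReal ?_
            rw [mul_comm]
            gcongr
            exact min_le_left _ _
          · refine le_trans ?_ le_add_self
            rw [Set.indicator_of_mem (show d ∈ Set.Ici (y ^ 2) from hdy),
              ← ENNReal.ofReal_mul (by positivity)]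
            refine ENNReal.ofReal_le_ofReal ?_
            have : d ^ (-(5 / 4 : ℝ)) = d ^ (-(1 / 4 : ℝ)) / d := by
              rw [← Real.rpow_sub_one hd.ne']; norm_num
            rw [this]
            calc d ^ (-(1 / 4 : ℝ)) * min y (y ^ 3 / d) ≤ d ^ (-(1 / 4 : ℝ)) * (y ^ 3 / d) := by
                  gcongr; exact min_le_right _ _
              _ = _ := by ring
        · simp
    _ = ENNReal.ofReal y * (∫⁻ d in Set.Ioo 0 (y ^ 2), ENNReal.ofReal (d ^ (-(1 / 4 : ℝ)))) +
        ENNReal.ofReal (y ^ 3) * ∫⁻ d in Set.Ioi (y ^ 2), ENNReal.ofReal (d ^ (-(5 / 4 : ℝ))) := by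
        rw [lintegral_add_left (by measurability), lintegral_indicator measurableSet_Ioo,
          lintegral_indicator measurableSet_Ici, lintegral_const_mul _ (by fun_prop),
          lintegral_const_mul _ (by fun_prop), setLIntegral_congr (Ioi_ae_eq_Ici).symm]
    _ = ENNReal.ofReal (y * (y * √y / (1 - 1 / 4)) + y ^ 3 *
          ((y ^ 2 : ℝ) ^ (1 - (5 / 4 : ℝ)) / (5 / 4 - 1))) := by
        rw [lintegral_rpow_Ioo (by norm_num) hy2.le, lintegral_rpow_Ioi (by norm_num) hy2, e1,
          ENNReal.ofReal_add (by positivity), ENNReal.ofReal_mul hy.le,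
          ENNReal.ofReal_mul (by positivity)]
        have : (0:ℝ) ≤ (y ^ 2 : ℝ) ^ (1 - (5 / 4 : ℝ)) := by positivity
        exact mul_nonneg (by positivity) (div_nonneg this (by norm_num))
    _ ≤ _ := by
        refine ENNReal.ofReal_le_ofReal (le_of_eq ?_)
        rw [mul_div_assoc', mul_div_assoc', e2]
        ring

namespace RadialFlow

variable (S : RadialFlow)

/-- near-field contribution to the linear evolution -/
def near (τ t : ℝ) : ℝ≥0∞ := ∫⁻ s in Set.Ioo (t - τ) t, ENNReal.ofReal ((t - s) ^ (-(1 / 4 : ℝ)) *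
  ∫ y in Set.Ioi 0, min y (y ^ 3 / (t - s)) * ‖S.N1 s y‖)

theorem continuous_N1_abs : Continuous fun p : ℝ × ℝ => ‖S.N1 p.1 |p.2|‖ := by
  have h := S.cN1.1.norm
  exact h.comp_continuous (f := fun p : ℝ × ℝ => (p.1, |p.2|)) (by fun_prop)
    (fun p => ⟨trivial, abs_nonneg p.2⟩)

theorem near_integrand_eq {t s : ℝ} (hs : s < t) :
    ENNReal.ofReal ((t - s) ^ (-(1 / 4 : ℝ)) *
      ∫ y in Set.Ioi 0, min y (y ^ 3 / (t - s)) * ‖S.N1 s y‖) =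
    ∫⁻ y in Set.Ioi 0, ENNReal.ofReal (nearKernel (t - s) y) * ENNReal.ofReal ‖S.N1 s |y|‖ := by
  have hd : 0 < t - s := by linarith
  have hi := ((S.rN1.weight (polyWeight_min hd)).integrableOn s).const_mul
    ((t - s) ^ (-(1 / 4 : ℝ)))
  rw [← integral_const_mul, ofReal_integral_eq_lintegral_ofReal hi]
  · refine setLIntegral_congr_fun measurableSet_Ioi fun y hy => ?_
    have hy' : 0 < y := hy
    simp only [nearKernel, if_pos hd, abs_of_pos hy']
    rw [← ENNReal.ofReal_mul, mul_assoc]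
    positivity
  · refine (ae_restrict_iff' measurableSet_Ioi).2 (ae_of_all _ fun y hy => ?_)
    have hy' : 0 < y := hy
    change 0 ≤ (t - s) ^ (-(1 / 4 : ℝ)) * (min y (y ^ 3 / (t - s)) * ‖S.N1 s y‖)
    positivity

theorem lintegral_near_le (T L : ℝ) :
    ∫⁻ t, ∫⁻ s in Set.Ioo T L, ∫⁻ y in Set.Ioi 0,
      ENNReal.ofReal (nearKernel (t - s) y) * ENNReal.ofReal ‖S.N1 s |y|‖ ≤
    ENNReal.ofReal (16 / 3) * ∫⁻ s in Set.Ioo T L, ENNReal.ofReal (S.n2 s) := by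
  have hm1 : Measurable fun p : (ℝ × ℝ) × ℝ => ENNReal.ofReal (nearKernel (p.1.1 - p.1.2) p.2) *
      ENNReal.ofReal ‖S.N1 p.1.2 |p.2|‖ := by
    have h1 : Measurable fun p : (ℝ × ℝ) × ℝ => nearKernel (p.1.1 - p.1.2) p.2 :=
      Measurable.comp (g := fun p : ℝ × ℝ => nearKernel p.1 p.2)
        (f := fun p : (ℝ × ℝ) × ℝ => (p.1.1 - p.1.2, p.2)) measurable_nearKernel (by fun_prop)
    have h2 : Measurable fun p : (ℝ × ℝ) × ℝ => ‖S.N1 p.1.2 |p.2|‖ :=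
      Measurable.comp (g := fun p : ℝ × ℝ => ‖S.N1 p.1 |p.2|‖)
        (f := fun p : (ℝ × ℝ) × ℝ => (p.1.2, p.2)) S.continuous_N1_abs.measurable (by fun_prop)
    exact h1.ennreal_ofReal.mul h2.ennreal_ofReal
  have hm2 := hm1.lintegral_prod_right' (ν := volume.restrict (Set.Ioi (0:ℝ)))
  rw [lintegral_lintegral_swap hm2.aemeasurable, ← lintegral_const_mul' _ _ ENNReal.ofReal_ne_top]
  refine lintegral_mono fun s => ?_
  have hm3 : Measurable fun p : ℝ × ℝ => ENNReal.ofReal (nearKernel (p.1 - s) p.2) *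
      ENNReal.ofReal ‖S.N1 s |p.2|‖ :=
    Measurable.comp (g := fun p : (ℝ × ℝ) × ℝ => ENNReal.ofReal (nearKernel (p.1.1 - p.1.2) p.2) *
      ENNReal.ofReal ‖S.N1 p.1.2 |p.2|‖) (f := fun p : ℝ × ℝ => ((p.1, s), p.2)) hm1 (by fun_prop)
  rw [lintegral_lintegral_swap hm3.aemeasurable, n2, ofReal_integral_eq_lintegral_ofReal
    (S.rn2.integrableOn s) (ae_of_all _ fun y => ?_), ← lintegral_const_mul' _ _
    ENNReal.ofReal_ne_top]
  · refine setLIntegral_mono' measurableSet_Ioi fun y hy => ?_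
    have hy' : 0 < y := hy
    rw [lintegral_mul_const' _ _ ENNReal.ofReal_ne_top,
      lintegral_sub_right_eq_self (fun d => ENNReal.ofReal (nearKernel d y)) s]
    calc _ ≤ ENNReal.ofReal (16 / 3 * (y ^ 2 * √y)) * ENNReal.ofReal ‖S.N1 s |y|‖ := by
          gcongr
          exact lintegral_nearKernel_le hy'
      _ = _ := by
        rw [abs_of_pos hy', ← ENNReal.ofReal_mul (by positivity),
          ← ENNReal.ofReal_mul (by positivity)]
        congr 1; ring
  · change 0 ≤ y ^ 2 * √y * ‖S.N1 s y‖
    positivity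

theorem exists_good_time (h : S.Threshold) {τ ε : ℝ} (hτ : 0 < τ) (hε : 0 < ε) :
    ∃ t, τ ≤ t ∧ S.near τ t ≤ ENNReal.ofReal ε := by
  obtain ⟨T, hT0, hT⟩ := S.exists_small_window h hτ (η := 3 / 32 * (τ * ε)) (by positivity) 0
  by_contra! hcon
  have h1 := S.lintegral_near_le T (T + 2 * τ)
  have h2 : ENNReal.ofReal (16 / 3) * ∫⁻ s in Set.Ioo T (T + 2 * τ), ENNReal.ofReal (S.n2 s) ≤
      ENNReal.ofReal (τ * ε / 2) := by
    calc _ ≤ ENNReal.ofReal (16 / 3) * ENNReal.ofReal (3 / 32 * (τ * ε)) := by gcongr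
      _ = _ := by rw [← ENNReal.ofReal_mul (by norm_num)]; congr 1; ring
  have h3 : ∫⁻ t in Set.Ioo (T + τ) (T + 2 * τ), S.near τ t ≤ ENNReal.ofReal (τ * ε / 2) := by
    refine le_trans ?_ (h1.trans h2)
    refine le_trans ?_ (setLIntegral_le_lintegral (Set.Ioo (T + τ) (T + 2 * τ)) _)
    refine setLIntegral_mono' measurableSet_Ioo fun t ht => ?_
    rw [near]
    refine le_trans (setLIntegral_mono' measurableSet_Ioo fun s hs =>
      (S.near_integrand_eq hs.2).le) ?_
    exact lintegral_mono_set (Set.Ioo_subset_Ioo (by linarith [ht.1]) ht.2.le)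
  have h4 : ENNReal.ofReal (τ * ε) ≤ ∫⁻ t in Set.Ioo (T + τ) (T + 2 * τ), S.near τ t := by
    have hv : volume (Set.Ioo (T + τ) (T + 2 * τ)) = ENNReal.ofReal τ := by
      rw [Real.volume_Ioo]; congr 1; ring
    calc ENNReal.ofReal (τ * ε) = ∫⁻ t in Set.Ioo (T + τ) (T + 2 * τ), ENNReal.ofReal ε := by
          rw [setLIntegral_const, hv, ENNReal.ofReal_mul hτ.le, mul_comm]
      _ ≤ _ := setLIntegral_mono' measurableSet_Ioo fun t ht =>
          (hcon t (by linarith [ht.1])).le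
  have h5 := (ENNReal.ofReal_le_ofReal_iff (by positivity)).1 (h4.trans h3)
  have : 0 < τ * ε := by positivity
  linarith

end RadialFlow

theorem lintegral_comp_sub_left (t : ℝ) (A : Set ℝ) (f : ℝ → ℝ≥0∞) :
    ∫⁻ s in (fun s => t - s) ⁻¹' A, f (t - s) = ∫⁻ w in A, f w :=
  (Measure.measurePreserving_sub_left volume t).setLIntegral_comp_preimage_emb
    (MeasurableEquiv.subLeft t).measurableEmbedding f A

namespace RadialFlow

variable (S : RadialFlow)

theorem rN : RapidDecay (fun t y => ‖S.N t y‖) := S.cN.norm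

theorem integral_N_le (h : S.Threshold) (t : ℝ) :
    ∫ y in Set.Ioi 0, y ^ 2 * ‖S.N t y‖ ≤ S.mass 0 / 2 + 5 / 2 * sob := by
  have hi : RapidDecay fun t y => 1 / 2 * S.rho t y + S.d4 t y + 1 / 2 * S.d6 t y :=
    ((S.rrho.const_mul _).add S.rd4).add (S.rd6.const_mul _)
  calc _ ≤ ∫ y in Set.Ioi 0, (1 / 2 * S.rho t y + S.d4 t y + 1 / 2 * S.d6 t y) := by
        refine setIntegral_mono_on ((S.rN.weight (polyWeight_id.pow 1)).integrableOn t)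
          (hi.integrableOn t) measurableSet_Ioi fun y hy => ?_
        have h1 := S.norm_N_le t y
        have h2 := S.norm_U_sq t y
        set m := ‖S.U t y‖
        have e1 : S.rho t y = y ^ 2 * m ^ 2 := by
          rw [h2]; simp only [rho, a, b, q]; ring
        have e2 : S.d4 t y = y ^ 2 * m ^ 4 := by simp only [d4]; rw [← h2]; ring
        have e3 : S.d6 t y = y ^ 2 * m ^ 6 := by simp only [d6]; rw [← h2]; ring
        rw [e1, e2, e3]
        rw [← h2] at h1
        calc y ^ 2 * ‖S.N t y‖ ≤ y ^ 2 * ((m ^ 2 + (m ^ 2) ^ 2) * m) := by gcongr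
          _ ≤ y ^ 2 * (1 / 2 * m ^ 2 + m ^ 4 + 1 / 2 * m ^ 6) :=
            mul_le_mul_of_nonneg_left
              (by nlinarith [sq_nonneg (m - m ^ 2), sq_nonneg (m ^ 2 - m ^ 3)]) (by positivity)
          _ = _ := by ring
    _ = 1 / 2 * S.mass t + S.L4 t + 1 / 2 * S.L6 t := by
      rw [integral_add, integral_add, integral_const_mul, integral_const_mul, mass, L4, L6]
      · exact (S.rrho.const_mul _).integrableOn t
      · exact S.rd4.integrableOn t
      · exact ((S.rrho.const_mul _).add S.rd4).integrableOn t
      · exact (S.rd6.const_mul _).integrableOn t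
    _ ≤ _ := by
      have h1 := h.L6_le_sob t
      have h2 := h.L4_le t
      rw [S.mass_eq t]
      linarith

theorem far_rpow_le {σ τ θ p x : ℝ} (hσ : 0 < σ) (hτ : 1 ≤ τ) (hθ : 0 ≤ θ) (hp : θ + 1 / 6 ≤ p)
    (h1 : σ ≤ x) (h2 : τ ≤ x) : x ^ (-p) ≤ σ ^ (-θ) * τ ^ (-(1 / 6 : ℝ)) := by
  have hx : 0 < x := by linarith
  have hx1 : 1 ≤ x := by linarith
  calc x ^ (-p) ≤ x ^ (-θ + -(1 / 6 : ℝ)) := Real.rpow_le_rpow_of_exponent_le hx1 (by linarith)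
    _ = x ^ (-θ) * x ^ (-(1 / 6 : ℝ)) := Real.rpow_add hx _ _
    _ ≤ _ := by
      gcongr ?_ * ?_
      · exact Real.rpow_le_rpow_of_nonpos hσ h1 (by linarith)
      · exact Real.rpow_le_rpow_of_nonpos (by linarith) h2 (by norm_num)

theorem near_rpow_le {σ τ θ d : ℝ} (hσ : 0 < σ) (hτ : 1 ≤ τ) (hθ : 1 / 4 ≤ θ) (hθ' : θ ≤ 1 / 3)
    (hd : 0 < d) (hdτ : d ≤ τ) :
    (d + σ) ^ (-(1 / 2 : ℝ)) ≤ σ ^ (-θ) * τ ^ (1 / 12 : ℝ) * d ^ (-(1 / 4 : ℝ)) := by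
  have hx : 0 < d + σ := by linarith
  calc (d + σ) ^ (-(1 / 2 : ℝ)) = (d + σ) ^ (-θ) * (d + σ) ^ (-(1 / 2 - θ)) := by
        rw [← Real.rpow_add hx]; congr 1; ring
    _ ≤ σ ^ (-θ) * d ^ (-(1 / 2 - θ)) := by
      gcongr ?_ * ?_
      · exact Real.rpow_le_rpow_of_nonpos hσ (by linarith) (by linarith)
      · exact Real.rpow_le_rpow_of_nonpos hd (by linarith) (by linarith)
    _ = σ ^ (-θ) * (d ^ (θ - 1 / 4) * d ^ (-(1 / 4 : ℝ))) := by
      rw [← Real.rpow_add hd]; congr 2; ring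
    _ ≤ σ ^ (-θ) * (τ ^ (1 / 12 : ℝ) * d ^ (-(1 / 4 : ℝ))) := by
      gcongr
      exact (Real.rpow_le_rpow hd.le hdτ (by linarith)).trans
        (Real.rpow_le_rpow_of_exponent_le hτ (by linarith))
    _ = _ := by ring

theorem lintegral_far {t c : ℝ} (hc : c < t) :
    ∫⁻ s in Set.Iio c, ENNReal.ofReal ((t - s) ^ (-(3 / 2 : ℝ))) =
      ENNReal.ofReal (2 * (t - c) ^ (-(1 / 2 : ℝ))) := by
  have : Set.Iio c = (fun s => t - s) ⁻¹' Set.Ioi (t - c) := by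
    ext s; simp
  rw [this, lintegral_comp_sub_left t _
    (fun w => ENNReal.ofReal (w ^ (-(3 / 2 : ℝ)))),
    lintegral_rpow_Ioi (by norm_num) (by linarith)]
  congr 1
  norm_num
  ring

theorem near_kernel_le {σ τ θ t s : ℝ} (hσ : 0 < σ) (hτ : 1 ≤ τ) (hθ : 1 / 4 ≤ θ)
    (hθ' : θ ≤ 1 / 3) (hs : s < t) (hsτ : t - τ ≤ s) :
    4 * (t + σ - s) ^ (-(1 / 2 : ℝ)) *
        ∫ y in Set.Ioi 0, min y (y ^ 3 / (t + σ - s)) * ‖S.N1 s y‖ ≤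
      4 * σ ^ (-θ) * τ ^ (1 / 12 : ℝ) * ((t - s) ^ (-(1 / 4 : ℝ)) *
        ∫ y in Set.Ioi 0, min y (y ^ 3 / (t - s)) * ‖S.N1 s y‖) := by
  have hd : 0 < t - s := by linarith
  have hd' : 0 < t + σ - s := by linarith
  have h1 := near_rpow_le hσ hτ hθ hθ' hd (by linarith)
  have h2 : ∫ y in Set.Ioi 0, min y (y ^ 3 / (t + σ - s)) * ‖S.N1 s y‖ ≤
      ∫ y in Set.Ioi 0, min y (y ^ 3 / (t - s)) * ‖S.N1 s y‖ := by
    refine setIntegral_mono_on ((S.rN1.weight (polyWeight_min hd')).integrableOn s)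
      ((S.rN1.weight (polyWeight_min hd)).integrableOn s) measurableSet_Ioi fun y hy => ?_
    have hy' : 0 < y := hy
    gcongr
    linarith
  have h3 : 0 ≤ ∫ y in Set.Ioi 0, min y (y ^ 3 / (t + σ - s)) * ‖S.N1 s y‖ :=
    setIntegral_nonneg measurableSet_Ioi fun y hy => by
      have hy' : 0 < y := hy
      positivity
  have e : t + σ - s = t - s + σ := by ring
  rw [← e] at h1
  calc _ ≤ 4 * (σ ^ (-θ) * τ ^ (1 / 12 : ℝ) * (t - s) ^ (-(1 / 4 : ℝ))) *
        ∫ y in Set.Ioi 0, min y (y ^ 3 / (t - s)) * ‖S.N1 s y‖ := by gcongr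
    _ = _ := by ring

/-- After a good time, the linear evolution is small in both decay scales. -/
theorem exists_linear_bound (h : S.Threshold) {δ : ℝ} (hδ : 0 < δ) :
    ∃ t₀, 1 ≤ t₀ ∧ ∀ σ r θ : ℝ, 0 < σ → 0 < r → 1 / 4 ≤ θ → θ ≤ 1 / 3 → ∀ β : ℝ → ℝ≥0∞,
      (∀ s ∈ Set.Ioo t₀ (t₀ + σ),
        ENNReal.ofReal ((t₀ + σ - s) ^ (-(3 / 2 : ℝ)) * ∫ y in Set.Ioi 0, y ^ 2 * ‖S.N s y‖)
          ≤ β s ∨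
        ENNReal.ofReal (4 * (t₀ + σ - s) ^ (-(1 / 2 : ℝ)) *
          ∫ y in Set.Ioi 0, min y (y ^ 3 / (t₀ + σ - s)) * ‖S.N1 s y‖) ≤ β s) →
      ENNReal.ofReal ‖S.U (t₀ + σ) r‖ ≤
        ENNReal.ofReal (δ * σ ^ (-θ)) + ∫⁻ s in Set.Ioo t₀ (t₀ + σ), β s := by
  have hM := h.mass_pos
  have hs := sob_pos
  set A := ∫ y in Set.Ioi 0, y ^ 2 * ‖S.U 0 y‖ with hA
  have hA0 : 0 ≤ A := setIntegral_nonneg measurableSet_Ioi fun y _ => by positivity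
  set C := S.mass 0 / 2 + 5 / 2 * sob with hC
  have hC0 : 0 < C := by positivity
  obtain ⟨τ, hτ1, hτ⟩ : ∃ τ : ℝ, 1 ≤ τ ∧ (A + 2 * C) * τ ^ (-(1 / 6 : ℝ)) < δ / 2 := by
    have := (tendsto_rpow_neg_atTop (y := 1 / 6) (by norm_num)).const_mul (A + 2 * C)
    rw [mul_zero] at this
    exact ((Filter.eventually_ge_atTop 1).and
      (this.eventually (gt_mem_nhds (half_pos hδ)))).exists
  have hτ0 : 0 < τ := by linarith
  obtain ⟨t₀, ht₀, hnear⟩ := S.exists_good_time h hτ0 (ε := δ / (8 * τ ^ (1 / 12 : ℝ)))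
    (by positivity)
  refine ⟨t₀, hτ1.trans ht₀, fun σ r θ hσ hr hθ hθ' β hβ => ?_⟩
  set F : ℝ → ℝ≥0∞ := fun s => ENNReal.ofReal ((t₀ + σ - s) ^ (-(3 / 2 : ℝ))) *
    ENNReal.ofReal C with hF
  set G : ℝ → ℝ≥0∞ := fun s => ENNReal.ofReal (4 * σ ^ (-θ) * τ ^ (1 / 12 : ℝ)) *
    ENNReal.ofReal ((t₀ - s) ^ (-(1 / 4 : ℝ)) *
      ∫ y in Set.Ioi 0, min y (y ^ 3 / (t₀ - s)) * ‖S.N1 s y‖) with hG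
  set β' : ℝ → ℝ≥0∞ := fun s => if s < t₀ - τ then F s else if s < t₀ then G s else
    if s = t₀ then ⊤ else β s with hβ'
  have hd := S.duhamel_bound (t := t₀ + σ) (by linarith) hr β' fun s hs => by
    have hts : 0 < t₀ + σ - s := by linarith [hs.2]
    simp only [hβ']
    split_ifs with h1 h2 h3
    · left
      simp only [hF]
      rw [← ENNReal.ofReal_mul (by positivity)]
      refine ENNReal.ofReal_le_ofReal ?_
      gcongr
      exact S.integral_N_le h s
    · right
      simp only [hG]
      rw [← ENNReal.ofReal_mul (by positivity)]
      exact ENNReal.ofReal_le_ofReal (S.near_kernel_le hσ hτ1 hθ hθ' h2 (not_lt.1 h1))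
    · exact Or.inl le_top
    · exact hβ s ⟨lt_of_le_of_ne (not_lt.1 h2) (Ne.symm h3), hs.2⟩
  refine hd.trans ?_
  have hFi : ∫⁻ s in Set.Iio (t₀ - τ), F s ≤
      ENNReal.ofReal (σ ^ (-θ) * (2 * C * τ ^ (-(1 / 6 : ℝ)))) := by
    rw [hF, lintegral_mul_const' _ _ ENNReal.ofReal_ne_top,
      lintegral_far (by linarith), ← ENNReal.ofReal_mul (by
        have : 0 < t₀ + σ - (t₀ - τ) := by linarith
        positivity)]
    refine ENNReal.ofReal_le_ofReal ?_
    have := far_rpow_le (p := 1 / 2) (θ := θ) (x := t₀ + σ - (t₀ - τ)) hσ hτ1 (by linarith)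
      (by linarith) (by linarith) (by linarith)
    calc _ ≤ 2 * (σ ^ (-θ) * τ ^ (-(1 / 6 : ℝ))) * C := by gcongr
      _ = _ := by ring
  have hGi : ∫⁻ s in Set.Ico (t₀ - τ) t₀, G s ≤ ENNReal.ofReal (σ ^ (-θ) * (δ / 2)) := by
    rw [setLIntegral_congr Ioo_ae_eq_Ico.symm, hG,
      lintegral_const_mul' _ _ ENNReal.ofReal_ne_top]
    calc _ ≤ ENNReal.ofReal (4 * σ ^ (-θ) * τ ^ (1 / 12 : ℝ)) *
          ENNReal.ofReal (δ / (8 * τ ^ (1 / 12 : ℝ))) := by gcongr; exact hnear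
      _ = _ := by
        rw [← ENNReal.ofReal_mul (by positivity)]
        congr 1
        field_simp
        norm_num
  have hsplit : ∫⁻ s in Set.Ioo 0 (t₀ + σ), β' s ≤ (∫⁻ s in Set.Iio (t₀ - τ), F s) +
      ((∫⁻ s in Set.Ico (t₀ - τ) t₀, G s) + ∫⁻ s in Set.Ioo t₀ (t₀ + σ), β s) := by
    have hsub : Set.Ioo 0 (t₀ + σ) ⊆
        Set.Iio (t₀ - τ) ∪ (Set.Ico (t₀ - τ) t₀ ∪ Set.Ico t₀ (t₀ + σ)) := fun s hs => by
      simp only [Set.mem_union, Set.mem_Iio, Set.mem_Ico]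
      have := hs.2
      rcases lt_or_ge s (t₀ - τ) with h1 | h1
      · exact Or.inl h1
      · rcases lt_or_ge s t₀ with h2 | h2
        · exact Or.inr (Or.inl ⟨h1, h2⟩)
        · exact Or.inr (Or.inr ⟨h2, this⟩)
    refine (lintegral_mono_set hsub).trans ((lintegral_union_le _ _ _).trans ?_)
    gcongr ?_ + ?_
    · refine (setLIntegral_congr_fun measurableSet_Iio fun s hs => ?_).le
      exact if_pos hs
    · refine (lintegral_union_le _ _ _).trans ?_
      gcongr ?_ + ?_
      · refine (setLIntegral_congr_fun measurableSet_Ico fun s hs => ?_).le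
        exact (if_neg (not_lt.2 hs.1)).trans (if_pos hs.2)
      · rw [setLIntegral_congr Ioo_ae_eq_Ico.symm]
        refine (setLIntegral_congr_fun measurableSet_Ioo fun s hs => ?_).le
        exact (if_neg (by linarith [hs.1])).trans
          ((if_neg (not_lt.2 hs.1.le)).trans (if_neg hs.1.ne'))
  have hinit : (t₀ + σ) ^ (-(3 / 2 : ℝ)) * A ≤ σ ^ (-θ) * (A * τ ^ (-(1 / 6 : ℝ))) := by
    have := far_rpow_le (p := 3 / 2) (θ := θ) (x := t₀ + σ) hσ hτ1 (by linarith)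
      (by linarith) (by linarith) (by linarith)
    calc _ ≤ σ ^ (-θ) * τ ^ (-(1 / 6 : ℝ)) * A := by gcongr
      _ = _ := by ring
  calc ENNReal.ofReal ((t₀ + σ) ^ (-(3 / 2 : ℝ)) * A) + ∫⁻ s in Set.Ioo 0 (t₀ + σ), β' s
      ≤ ENNReal.ofReal (σ ^ (-θ) * (A * τ ^ (-(1 / 6 : ℝ)))) +
        (ENNReal.ofReal (σ ^ (-θ) * (2 * C * τ ^ (-(1 / 6 : ℝ)))) +
          (ENNReal.ofReal (σ ^ (-θ) * (δ / 2)) + ∫⁻ s in Set.Ioo t₀ (t₀ + σ), β s)) := by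
        refine add_le_add (ENNReal.ofReal_le_ofReal hinit) (hsplit.trans ?_)
        gcongr
    _ = ENNReal.ofReal (σ ^ (-θ) * ((A + 2 * C) * τ ^ (-(1 / 6 : ℝ)) + δ / 2)) +
          ∫⁻ s in Set.Ioo t₀ (t₀ + σ), β s := by
        rw [← add_assoc, ← add_assoc, ← ENNReal.ofReal_add (by positivity) (by positivity),
          ← ENNReal.ofReal_add (by positivity) (by positivity)]
        congr 2
        ring
    _ ≤ _ := by
        rw [mul_comm δ]
        gcongr
        linarith

end RadialFlow

theorem integrable_lorentz {Y : ℝ} (hY : 0 < Y) :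
    IntegrableOn (fun y : ℝ => 2 * (1 + (y / Y) ^ 2)⁻¹) (Set.Ioi 0) :=
  ((integrable_inv_one_add_sq.comp_div hY.ne').const_mul 2).integrableOn

theorem integral_lorentz {Y : ℝ} (hY : 0 < Y) :
    ∫ y in Set.Ioi 0, 2 * (1 + (y / Y) ^ 2)⁻¹ = Real.pi * Y := by
  have h := integral_comp_mul_right_Ioi (fun y : ℝ => (1 + y ^ 2)⁻¹) 0 (inv_pos.2 hY)
  simp only [← div_eq_mul_inv, zero_div] at h
  rw [integral_const_mul, h, integral_Ioi_inv_one_add_sq]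
  simp
  ring

theorem min_sq_le {y l : ℝ} (hy : 0 < y) (hl : 0 < l) :
    (min 1 (y ^ 2 / l ^ 4)) ^ 2 / y ^ 2 ≤ 2 * (1 + (y / l ^ 2) ^ 2)⁻¹ / l ^ 4 := by
  have e : (y / l ^ 2) ^ 2 = y ^ 2 / l ^ 4 := by rw [div_pow]; ring
  rw [e]
  set z := y ^ 2 / l ^ 4 with hz
  have hz0 : 0 < z := by positivity
  have e2 : y ^ 2 = z * l ^ 4 := by rw [hz]; field_simp
  rw [e2, ← div_div, ← div_eq_mul_inv]
  refine div_le_div_of_nonneg_right ?_ (by positivity)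
  rw [div_le_div_iff₀ hz0 (by positivity)]
  rcases le_total z 1 with h | h
  · rw [min_eq_right h]; nlinarith [mul_pos hz0 hz0]
  · rw [min_eq_left h]; nlinarith

theorem mul_le_weighted {a b l : ℝ} (hl : 0 < l) : a * b ≤ 1 / 2 * (l * a ^ 2 + b ^ 2 / l) := by
  have : 1 / 2 * (l * a ^ 2 + b ^ 2 / l) - a * b = (l * a - b) ^ 2 / (2 * l) := by
    field_simp; ring
  have h2 : 0 ≤ (l * a - b) ^ 2 / (2 * l) := by positivity
  linarith

namespace RadialFlow

variable (S : RadialFlow)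

theorem quintic_pointwise {t y l X B : ℝ} (hy : 0 < y) (hl : 0 < l) (hX : ‖S.U t y‖ ≤ X)
    (hB : y * S.q t y ≤ B) :
    min y (y ^ 3 / l ^ 4) * (S.q t y ^ 2 * ‖S.U1 t y‖) ≤
      X ^ 2 * B * (1 / 2 * ((2 * (1 + (y / l ^ 2) ^ 2)⁻¹) / l ^ 3 + S.grd t y / l)) := by
  have h2 := S.norm_U_sq t y
  have hq := S.q_nonneg t y
  set m := ‖S.U t y‖
  set n := ‖S.U1 t y‖ with hn
  have hm0 : 0 ≤ m := norm_nonneg _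
  have hn0 : 0 ≤ n := norm_nonneg _
  have hB0 : 0 ≤ B := le_trans (by positivity) hB
  have e1 : min y (y ^ 3 / l ^ 4) = y * min 1 (y ^ 2 / l ^ 4) := by
    rw [mul_min_of_nonneg _ _ hy.le, mul_one]
    congr 1; ring
  have hqX : S.q t y ≤ X ^ 2 := by rw [← h2]; gcongr
  set k := min 1 (y ^ 2 / l ^ 4) with hk
  have hk0 : 0 ≤ k := by positivity
  have h3 : k * n ≤ 1 / 2 * (l * (k / y) ^ 2 + (y * n) ^ 2 / l) := by
    have := mul_le_weighted (a := k / y) (b := y * n) hl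
    have e : k / y * (y * n) = k * n := by field_simp
    rwa [e] at this
  have h4 : l * (k / y) ^ 2 ≤ 2 * (1 + (y / l ^ 2) ^ 2)⁻¹ / l ^ 3 := by
    rw [div_pow]
    calc l * (k ^ 2 / y ^ 2) ≤ l * (2 * (1 + (y / l ^ 2) ^ 2)⁻¹ / l ^ 4) := by
          exact mul_le_mul_of_nonneg_left (min_sq_le hy hl) hl.le
      _ = _ := by field_simp
  have e3 : S.grd t y = (y * n) ^ 2 := by rw [grd]; ring
  rw [e1, e3]
  calc y * k * (S.q t y ^ 2 * n) = S.q t y * (y * S.q t y) * (k * n) := by ring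
    _ ≤ X ^ 2 * B * (k * n) := by gcongr
    _ ≤ _ := mul_le_mul_of_nonneg_left
      (h3.trans (mul_le_mul_of_nonneg_left (add_le_add_left h4 _) (by norm_num))) (by positivity)

theorem cubic_pointwise {t y w κ X c : ℝ} (hy : 0 < y) (hκ : 0 < κ) (hX : ‖S.U t y‖ ≤ X)
    (hc0 : 0 ≤ c) (hc : y * ‖S.U t y‖ ≤ c) :
    min y (y ^ 3 / w) * (S.q t y * ‖S.U1 t y‖) ≤
      X ^ 2 * (1 / 2 * (2 * (1 + (y / κ ^ 2) ^ 2)⁻¹ + S.grd t y)) +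
      X * c * (1 / 2 * (2 * (1 + (y / κ ^ 2) ^ 2)⁻¹ / κ ^ 3 + S.grd t y / κ)) := by
  have h2 := S.norm_U_sq t y
  have hg := S.grd_nonneg t y
  have e3 : S.grd t y = (y * ‖S.U1 t y‖) ^ 2 := by rw [grd]; ring
  rw [← h2]
  set m := ‖S.U t y‖
  set n := ‖S.U1 t y‖ with hn
  have hm0 : 0 ≤ m := norm_nonneg _
  have hn0 : 0 ≤ n := norm_nonneg _
  have hX0 : 0 ≤ X := hm0.trans hX
  have h0 : min y (y ^ 3 / w) * (m ^ 2 * n) ≤ y * (m ^ 2 * n) := by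
    gcongr; exact min_le_left _ _
  refine h0.trans ?_
  rcases le_total y (κ ^ 2) with hyk | hyk
  · refine le_trans ?_ (le_add_of_nonneg_right (by positivity))
    have h1 : y * n ≤ 1 / 2 * (1 + (y * n) ^ 2) := by nlinarith [sq_nonneg (y * n - 1)]
    have h3 : 1 ≤ 2 * (1 + (y / κ ^ 2) ^ 2)⁻¹ := by
      rw [← div_eq_mul_inv, one_le_div (by positivity)]
      have : (y / κ ^ 2) ^ 2 ≤ 1 :=
        pow_le_one₀ (by positivity) ((div_le_one (by positivity)).2 hyk)
      linarith
    calc y * (m ^ 2 * n) = m ^ 2 * (y * n) := by ring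
      _ ≤ X ^ 2 * (1 / 2 * (1 + (y * n) ^ 2)) := by gcongr
      _ ≤ _ := by rw [e3]; gcongr
  · refine le_trans ?_ (le_add_of_nonneg_left (by positivity))
    have h1 : n ≤ 1 / 2 * (κ * (1 / y) ^ 2 + (y * n) ^ 2 / κ) := by
      have := mul_le_weighted (a := 1 / y) (b := y * n) hκ
      have e : 1 / y * (y * n) = n := by field_simp
      rwa [e] at this
    have h3 : κ * (1 / y) ^ 2 ≤ 2 * (1 + (y / κ ^ 2) ^ 2)⁻¹ / κ ^ 3 := by
      have h5 : 1 + (y / κ ^ 2) ^ 2 ≤ 2 * (y / κ ^ 2) ^ 2 := by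
        have : 1 ≤ (y / κ ^ 2) ^ 2 := one_le_pow₀ ((one_le_div (by positivity)).2 hyk)
        linarith
      have h6 : κ * (1 / y) ^ 2 = 2 * (2 * (y / κ ^ 2) ^ 2)⁻¹ / κ ^ 3 := by field_simp
      rw [h6]
      gcongr
    calc y * (m ^ 2 * n) = m * (y * m) * n := by ring
      _ ≤ X * c * (1 / 2 * (κ * (1 / y) ^ 2 + (y * n) ^ 2 / κ)) := by gcongr
      _ ≤ _ := by rw [e3]; gcongr

theorem integral_quintic_le (h : S.Threshold) {t l X : ℝ} (hl : 0 < l)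
    (hX : ∀ y, 0 < y → ‖S.U t y‖ ≤ X) :
    ∫ y in Set.Ioi 0, min y (y ^ 3 / l ^ 4) * (S.q t y ^ 2 * ‖S.U1 t y‖) ≤
      X ^ 2 * sob * (Real.pi + sob) / 2 / l := by
  have hs := sob_pos
  have hB := h.B_lt t
  have i1 := integrable_lorentz (Y := l ^ 2) (by positivity)
  have i2 := S.rgrd.integrableOn t
  calc _ ≤ ∫ y in Set.Ioi 0, X ^ 2 * sob *
        (1 / 2 * ((2 * (1 + (y / l ^ 2) ^ 2)⁻¹) / l ^ 3 + S.grd t y / l)) := by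
        refine setIntegral_mono_on ((((S.rq.pow 1).mul S.cU1.norm).weight
          (polyWeight_min (by positivity))).integrableOn t)
          ((((i1.div_const _).add (i2.div_const _)).const_mul _).const_mul _)
          measurableSet_Ioi fun y hy => ?_
        have hy' : 0 < y := hy
        exact S.quintic_pointwise hy' hl (hX y hy') ((S.mul_q_le_B t y hy'.le).trans hB.le)
    _ = X ^ 2 * sob * (1 / 2 * (Real.pi * l ^ 2 / l ^ 3 + S.B t / l)) := by
        rw [integral_const_mul, integral_const_mul,
          integral_add (i1.div_const _) (i2.div_const _), integral_div, integral_div,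
          integral_lorentz (by positivity), integral_grd]
    _ ≤ X ^ 2 * sob * (1 / 2 * (Real.pi * l ^ 2 / l ^ 3 + sob / l)) := by gcongr
    _ = _ := by field_simp

theorem integral_cubic_le (h : S.Threshold) {t w κ X : ℝ} (hw : 0 < w) (hκ : 0 < κ)
    (hX : ∀ y, 0 < y → ‖S.U t y‖ ≤ X) :
    ∫ y in Set.Ioi 0, min y (y ^ 3 / w) * (S.q t y * ‖S.U1 t y‖) ≤
      X ^ 2 * (Real.pi * κ ^ 2 + sob) / 2 +
        X * (S.mass 0 + sob + 1) * (Real.pi + sob) / 2 / κ := by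
  have hs := sob_pos
  have hM := h.mass_pos
  have hB := h.B_lt t
  set c := S.mass 0 + sob + 1 with hc
  have hX0 : 0 ≤ X := (norm_nonneg _).trans (hX 1 one_pos)
  have i1 := integrable_lorentz (Y := κ ^ 2) (by positivity)
  have i2 := S.rgrd.integrableOn t
  have i3 : IntegrableOn (fun y => X ^ 2 * (1 / 2 * (2 * (1 + (y / κ ^ 2) ^ 2)⁻¹ + S.grd t y)))
      (Set.Ioi 0) := ((i1.add i2).const_mul (1 / 2)).const_mul (X ^ 2)
  have i4 : IntegrableOn (fun y => X * c *
      (1 / 2 * (2 * (1 + (y / κ ^ 2) ^ 2)⁻¹ / κ ^ 3 + S.grd t y / κ))) (Set.Ioi 0) :=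
    (((i1.div_const (κ ^ 3)).add (i2.div_const κ)).const_mul (1 / 2)).const_mul (X * c)
  calc _ ≤ ∫ y in Set.Ioi 0, (X ^ 2 * (1 / 2 * (2 * (1 + (y / κ ^ 2) ^ 2)⁻¹ + S.grd t y)) +
        X * c * (1 / 2 * (2 * (1 + (y / κ ^ 2) ^ 2)⁻¹ / κ ^ 3 + S.grd t y / κ))) := by
        refine setIntegral_mono_on (((S.rq.mul S.cU1.norm).weight
          (polyWeight_min hw)).integrableOn t) (i3.add i4) measurableSet_Ioi fun y hy => ?_
        have hy' : 0 < y := hy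
        refine S.cubic_pointwise hy' hκ (hX y hy') (by positivity) ?_
        refine abs_le_of_sq_le_sq' ?_ (by positivity) |>.2
        have h1 := S.rho_le t y hy'.le
        rw [S.mass_eq t] at h1
        have e1 : S.rho t y = (y * ‖S.U t y‖) ^ 2 := by
          rw [mul_pow, norm_U_sq]; simp only [rho, a, b, q]; ring
        rw [← e1]
        nlinarith
    _ = X ^ 2 * (1 / 2 * (Real.pi * κ ^ 2 + S.B t)) +
        X * c * (1 / 2 * (Real.pi * κ ^ 2 / κ ^ 3 + S.B t / κ)) := by
        have e1 : ∫ y in Set.Ioi 0, (2 * (1 + (y / κ ^ 2) ^ 2)⁻¹ + S.grd t y) =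
            Real.pi * κ ^ 2 + S.B t := by
          rw [integral_add i1 i2, integral_lorentz (by positivity), integral_grd]
        have e2 : ∫ y in Set.Ioi 0, (2 * (1 + (y / κ ^ 2) ^ 2)⁻¹ / κ ^ 3 + S.grd t y / κ) =
            Real.pi * κ ^ 2 / κ ^ 3 + S.B t / κ := by
          rw [integral_add (i1.div_const _) (i2.div_const _), integral_div, integral_div,
            integral_lorentz (by positivity), integral_grd]
        rw [integral_add i3 i4, integral_const_mul (X ^ 2), integral_const_mul (X * c),
          integral_const_mul (1 / 2), integral_const_mul (1 / 2), e1, e2]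
    _ ≤ X ^ 2 * (1 / 2 * (Real.pi * κ ^ 2 + sob)) +
        X * c * (1 / 2 * (Real.pi * κ ^ 2 / κ ^ 3 + sob / κ)) := by gcongr
    _ = _ := by field_simp

theorem integral_N_le_of_bound (h : S.Threshold) {t X : ℝ} (hX : ∀ y, 0 < y → ‖S.U t y‖ ≤ X) :
    ∫ y in Set.Ioi 0, y ^ 2 * ‖S.N t y‖ ≤ X * (S.mass 0 + 2 * sob) := by
  have hX0 : 0 ≤ X := (norm_nonneg _).trans (hX 1 one_pos)
  calc _ ≤ ∫ y in Set.Ioi 0, X * (S.rho t y + S.d4 t y) := by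
        refine setIntegral_mono_on ((S.rN.weight (polyWeight_id.pow 1)).integrableOn t)
          (((S.rrho.add S.rd4).const_mul X).integrableOn t) measurableSet_Ioi fun y hy => ?_
        have h1 := S.norm_N_le t y
        have h2 := hX y hy
        have hq := S.q_nonneg t y
        have e1 : S.rho t y = y ^ 2 * S.q t y := by simp only [rho, a, b, q]; ring
        rw [e1, d4]
        calc y ^ 2 * ‖S.N t y‖ ≤ y ^ 2 * ((S.q t y + S.q t y ^ 2) * X) := by
              gcongr; exact h1.trans (by gcongr)
          _ = _ := by ring
    _ = X * (S.mass t + S.L4 t) := by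
        rw [integral_const_mul, integral_add (S.rrho.integrableOn t) (S.rd4.integrableOn t),
          mass, L4]
    _ ≤ _ := by
        rw [S.mass_eq t]
        have := h.L4_le t
        gcongr

/-- Short-lag bound of the Duhamel integrand, given a pointwise bound on the solution. -/
theorem near_integrand_le (h : S.Threshold) {t w κ X : ℝ} (hw : 0 < w) (hκ : 0 < κ)
    (hX : ∀ y, 0 < y → ‖S.U t y‖ ≤ X) :
    4 * w ^ (-(1 / 2 : ℝ)) * ∫ y in Set.Ioi 0, min y (y ^ 3 / w) * ‖S.N1 t y‖ ≤
      w ^ (-(1 / 2 : ℝ)) * (X ^ 2 * (6 * (Real.pi * κ ^ 2 + sob)) +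
        X * (6 * (S.mass 0 + sob + 1) * (Real.pi + sob) / κ)) +
      w ^ (-(3 / 4 : ℝ)) * (X ^ 2 * (10 * sob * (Real.pi + sob))) := by
  set l := w ^ (1 / 4 : ℝ) with hl
  have hl0 : 0 < l := by positivity
  have e1 : l ^ 4 = w := by
    rw [hl, ← Real.rpow_natCast, ← Real.rpow_mul hw.le]; norm_num
  have e2 : w ^ (-(3 / 4 : ℝ)) = w ^ (-(1 / 2 : ℝ)) / l := by
    rw [hl, ← Real.rpow_sub hw]; norm_num
  have h1 := S.integral_quintic_le h hl0 hX
  rw [e1] at h1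
  have h2 := S.integral_cubic_le h hw hκ hX
  have i1 := ((S.rq.mul S.cU1.norm).weight (polyWeight_min hw)).integrableOn t
  have i2 := (((S.rq.pow 1).mul S.cU1.norm).weight (polyWeight_min hw)).integrableOn t
  have h3 : ∫ y in Set.Ioi 0, min y (y ^ 3 / w) * ‖S.N1 t y‖ ≤
      3 * (∫ y in Set.Ioi 0, min y (y ^ 3 / w) * (S.q t y * ‖S.U1 t y‖)) +
      5 * ∫ y in Set.Ioi 0, min y (y ^ 3 / w) * (S.q t y ^ 2 * ‖S.U1 t y‖) := by
    rw [← integral_const_mul, ← integral_const_mul,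
      ← integral_add (i1.const_mul 3) (i2.const_mul 5)]
    refine setIntegral_mono_on ((S.rN1.weight (polyWeight_min hw)).integrableOn t)
      ((i1.const_mul 3).add (i2.const_mul 5)) measurableSet_Ioi fun y hy => ?_
    have hy' : 0 < y := hy
    calc min y (y ^ 3 / w) * ‖S.N1 t y‖ ≤
        min y (y ^ 3 / w) * ((3 * S.q t y + 5 * S.q t y ^ 2) * ‖S.U1 t y‖) := by
          gcongr; exact S.norm_N1_le t y
      _ = _ := by ring
  rw [e2]
  calc _ ≤ 4 * w ^ (-(1 / 2 : ℝ)) * (3 * (X ^ 2 * (Real.pi * κ ^ 2 + sob) / 2 +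
        X * (S.mass 0 + sob + 1) * (Real.pi + sob) / 2 / κ) +
          5 * (X ^ 2 * sob * (Real.pi + sob) / 2 / l)) := by
        gcongr
        exact h3.trans (by gcongr)
    _ = _ := by field_simp; ring

end RadialFlow

theorem lintegral_conv_rpow_le {k : ℝ → ℝ≥0∞} {σ a p K K' : ℝ} (hσ : 0 < σ) (hp0 : 0 ≤ p)
    (hp : p < 1) (hK : 0 ≤ K) (hK' : 0 ≤ K')
    (h1 : ∀ w, σ / 2 ≤ w → w < σ → k w ≤ ENNReal.ofReal (K * (σ / 2) ^ (-a)))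
    (h2 : ∫⁻ w in Set.Ioc 0 (σ / 2), k w ≤ ENNReal.ofReal (K' * (σ / 2) ^ (1 - a))) :
    ∫⁻ s in Set.Ioo 0 σ, k (σ - s) * ENNReal.ofReal (s ^ (-p)) ≤
      ENNReal.ofReal ((K / (1 - p) + K') * (σ / 2) ^ (1 - a - p)) := by
  have hp1 : 0 < 1 - p := by linarith
  have hσ2 : 0 < σ / 2 := by positivity
  have hsub : Set.Ioo 0 σ ⊆ Set.Ioo 0 (σ / 2) ∪ Set.Ico (σ / 2) σ := fun s hs => by
    rcases lt_or_ge s (σ / 2) with h | h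
    · exact Or.inl ⟨hs.1, h⟩
    · exact Or.inr ⟨h, hs.2⟩
  have e1 : (σ / 2) ^ (-a) * (σ / 2) ^ (1 - p) = (σ / 2) ^ (1 - a - p) := by
    rw [← Real.rpow_add hσ2]; ring_nf
  have e2 : (σ / 2) ^ (1 - a) * (σ / 2) ^ (-p) = (σ / 2) ^ (1 - a - p) := by
    rw [← Real.rpow_add hσ2]; ring_nf
  have a1 : ∫⁻ s in Set.Ioo 0 (σ / 2), k (σ - s) * ENNReal.ofReal (s ^ (-p)) ≤
      ENNReal.ofReal (K / (1 - p) * (σ / 2) ^ (1 - a - p)) := by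
    calc _ ≤ ∫⁻ s in Set.Ioo 0 (σ / 2),
          ENNReal.ofReal (K * (σ / 2) ^ (-a)) * ENNReal.ofReal (s ^ (-p)) := by
          refine setLIntegral_mono' measurableSet_Ioo fun s hs => ?_
          gcongr
          exact h1 _ (by linarith [hs.2]) (by linarith [hs.1])
      _ = _ := by
          rw [lintegral_const_mul' _ _ ENNReal.ofReal_ne_top, lintegral_rpow_Ioo hp hσ2.le,
            ← ENNReal.ofReal_mul (by positivity), ← e1]
          congr 1; ring
  have a2 : ∫⁻ s in Set.Ico (σ / 2) σ, k (σ - s) * ENNReal.ofReal (s ^ (-p)) ≤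
      ENNReal.ofReal (K' * (σ / 2) ^ (1 - a - p)) := by
    have hpre : Set.Ico (σ / 2) σ = (fun s => σ - s) ⁻¹' Set.Ioc 0 (σ / 2) := by
      ext s
      simp only [Set.mem_Ico, Set.mem_preimage, Set.mem_Ioc, sub_pos]
      constructor <;> rintro ⟨u, v⟩ <;> constructor <;> linarith
    calc _ ≤ ∫⁻ s in Set.Ico (σ / 2) σ, k (σ - s) * ENNReal.ofReal ((σ / 2) ^ (-p)) := by
          refine setLIntegral_mono' measurableSet_Ico fun s hs => ?_
          exact mul_le_mul' le_rfl (ENNReal.ofReal_le_ofReal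
            (Real.rpow_le_rpow_of_nonpos hσ2 hs.1 (neg_nonpos.2 hp0)))
      _ = (∫⁻ w in Set.Ioc 0 (σ / 2), k w) * ENNReal.ofReal ((σ / 2) ^ (-p)) := by
          rw [lintegral_mul_const' _ _ ENNReal.ofReal_ne_top, hpre, lintegral_comp_sub_left]
      _ ≤ ENNReal.ofReal (K' * (σ / 2) ^ (1 - a)) * ENNReal.ofReal ((σ / 2) ^ (-p)) := by gcongr
      _ = _ := by rw [← ENNReal.ofReal_mul (by positivity), mul_assoc, e2]
  calc _ ≤ _ := lintegral_mono_set hsub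
    _ ≤ _ := lintegral_union_le _ _ _
    _ ≤ _ := add_le_add a1 a2
    _ = _ := by rw [← ENNReal.ofReal_add (by positivity) (by positivity), add_mul]

theorem half_rpow_le {σ θ : ℝ} (hσ : 0 < σ) (h1 : θ ≤ 1) :
    (σ / 2) ^ (-θ) ≤ 2 * σ ^ (-θ) := by
  rw [Real.div_rpow hσ.le (by norm_num), div_eq_mul_inv, ← Real.rpow_neg (by norm_num), neg_neg,
    mul_comm]
  gcongr
  calc (2 : ℝ) ^ θ ≤ 2 ^ (1 : ℝ) := Real.rpow_le_rpow_of_exponent_le (by norm_num) h1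
    _ = 2 := Real.rpow_one 2

theorem lintegral_near_conv {σ θ l : ℝ} (hσ : 0 < σ) (hl : 0 < l) (h0 : 0 ≤ θ) (h1 : θ ≤ 1 / 3) :
    ∫⁻ s in Set.Ioo 0 σ, (Set.Iio (l ^ 4)).indicator
      (fun w => ENNReal.ofReal (w ^ (-(1 / 2 : ℝ)))) (σ - s) * ENNReal.ofReal (s ^ (-θ)) ≤
      ENNReal.ofReal (7 * l ^ 2 * σ ^ (-θ)) := by
  have hσ2 : 0 < σ / 2 := by positivity
  have el : (l ^ 4) ^ (1 / 2 : ℝ) = l ^ 2 := by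
    rw [show l ^ 4 = (l ^ 2) ^ 2 by ring, ← Real.sqrt_eq_rpow, Real.sqrt_sq (by positivity)]
  refine (lintegral_conv_rpow_le (a := 1) (K := l ^ 2) (K' := 2 * l ^ 2) hσ h0 (by linarith)
    (by positivity) (by positivity) ?_ ?_).trans (ENNReal.ofReal_le_ofReal ?_)
  · intro w hw _
    have hw0 : 0 < w := hσ2.trans_le hw
    by_cases hwl : w ∈ Set.Iio (l ^ 4)
    · rw [Set.indicator_of_mem hwl]
      refine ENNReal.ofReal_le_ofReal ?_
      calc w ^ (-(1 / 2 : ℝ)) = w ^ (1 / 2 : ℝ) * w ^ (-1 : ℝ) := by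
            rw [← Real.rpow_add hw0]; norm_num
        _ ≤ l ^ 2 * (σ / 2) ^ (-1 : ℝ) := by
            rw [← el]
            exact mul_le_mul (Real.rpow_le_rpow hw0.le (le_of_lt hwl) (by norm_num))
              (Real.rpow_le_rpow_of_nonpos hσ2 hw (by norm_num)) (by positivity) (by positivity)
    · rw [Set.indicator_of_notMem hwl]; exact zero_le
  · calc _ ≤ ∫⁻ w in Set.Ioi 0, (Set.Iio (l ^ 4)).indicator
          (fun w => ENNReal.ofReal (w ^ (-(1 / 2 : ℝ)))) w :=
          lintegral_mono_set fun w hw => hw.1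
      _ = ∫⁻ w in Set.Ioo 0 (l ^ 4), ENNReal.ofReal (w ^ (-(1 / 2 : ℝ))) := by
          rw [lintegral_indicator measurableSet_Iio, Measure.restrict_restrict measurableSet_Iio,
            Set.inter_comm, Set.Ioi_inter_Iio]
      _ = ENNReal.ofReal ((l ^ 4) ^ (1 - 1 / 2 : ℝ) / (1 - 1 / 2)) :=
          lintegral_rpow_Ioo (by norm_num) (by positivity)
      _ ≤ _ := by
          refine ENNReal.ofReal_le_ofReal (le_of_eq ?_)
          rw [show (1 - 1 / 2 : ℝ) = 1 / 2 by norm_num, el]; norm_num; ring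
  · have e : (1 - 1 - θ : ℝ) = -θ := by ring
    have h2 := half_rpow_le (θ := θ) hσ (by linarith)
    have h3 : l ^ 2 / (1 - θ) ≤ l ^ 2 * (3 / 2) := by
      rw [div_le_iff₀ (by linarith)]
      nlinarith [sq_nonneg l]
    rw [e]
    calc _ ≤ (l ^ 2 * (3 / 2) + 2 * l ^ 2) * (2 * σ ^ (-θ)) := by gcongr
      _ = _ := by ring

theorem lintegral_far_conv {σ θ l : ℝ} (hσ : 0 < σ) (hl : 0 < l) (h0 : 0 ≤ θ) (h1 : θ ≤ 1 / 3) :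
    ∫⁻ s in Set.Ioo 0 σ, (Set.Ici (l ^ 4)).indicator
      (fun w => ENNReal.ofReal (w ^ (-(3 / 2 : ℝ)))) (σ - s) * ENNReal.ofReal (s ^ (-θ)) ≤
      ENNReal.ofReal (7 / l ^ 2 * σ ^ (-θ)) := by
  have hσ2 : 0 < σ / 2 := by positivity
  have hl4 : 0 < l ^ 4 := by positivity
  have el : (l ^ 4) ^ (-(1 / 2 : ℝ)) = 1 / l ^ 2 := by
    rw [Real.rpow_neg (by positivity), show l ^ 4 = (l ^ 2) ^ 2 by ring, ← Real.sqrt_eq_rpow,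
      Real.sqrt_sq (by positivity), one_div]
  refine (lintegral_conv_rpow_le (a := 1) (K := 1 / l ^ 2) (K' := 2 * (1 / l ^ 2)) hσ h0
    (by linarith) (by positivity) (by positivity) ?_ ?_).trans (ENNReal.ofReal_le_ofReal ?_)
  · intro w hw _
    have hw0 : 0 < w := hσ2.trans_le hw
    by_cases hwl : w ∈ Set.Ici (l ^ 4)
    · rw [Set.indicator_of_mem hwl]
      refine ENNReal.ofReal_le_ofReal ?_
      calc w ^ (-(3 / 2 : ℝ)) = w ^ (-(1 / 2 : ℝ)) * w ^ (-1 : ℝ) := by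
            rw [← Real.rpow_add hw0]; norm_num
        _ ≤ 1 / l ^ 2 * (σ / 2) ^ (-1 : ℝ) := by
            rw [← el]
            exact mul_le_mul (Real.rpow_le_rpow_of_nonpos hl4 hwl (by norm_num))
              (Real.rpow_le_rpow_of_nonpos hσ2 hw (by norm_num)) (by positivity) (by positivity)
    · rw [Set.indicator_of_notMem hwl]; exact zero_le
  · calc _ ≤ ∫⁻ w in Set.Ioi 0, (Set.Ici (l ^ 4)).indicator
          (fun w => ENNReal.ofReal (w ^ (-(3 / 2 : ℝ)))) w :=
          lintegral_mono_set fun w hw => hw.1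
      _ = ∫⁻ w in Set.Ioi (l ^ 4), ENNReal.ofReal (w ^ (-(3 / 2 : ℝ))) := by
          rw [lintegral_indicator measurableSet_Ici, Measure.restrict_restrict measurableSet_Ici,
            Set.inter_eq_left.2 (show Set.Ici (l ^ 4) ⊆ Set.Ioi 0 from fun w hw => hl4.trans_le hw),
            setLIntegral_congr Ioi_ae_eq_Ici]
      _ = ENNReal.ofReal ((l ^ 4) ^ (1 - 3 / 2 : ℝ) / (3 / 2 - 1)) :=
          lintegral_rpow_Ioi (by norm_num) (by positivity)
      _ ≤ _ := by
          refine ENNReal.ofReal_le_ofReal (le_of_eq ?_)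
          rw [show (1 - 3 / 2 : ℝ) = -(1 / 2) by norm_num, el]; norm_num; ring
  · have e : (1 - 1 - θ : ℝ) = -θ := by ring
    have h2 := half_rpow_le (θ := θ) hσ (by linarith)
    have h3 : 1 / l ^ 2 / (1 - θ) ≤ 1 / l ^ 2 * (3 / 2) := by
      rw [div_le_iff₀ (by linarith)]
      have : 0 < 1 / l ^ 2 := by positivity
      nlinarith
    rw [e]
    calc _ ≤ (1 / l ^ 2 * (3 / 2) + 2 * (1 / l ^ 2)) * (2 * σ ^ (-θ)) := by gcongr
      _ = _ := by ring

theorem lintegral_quarter_conv {σ θ : ℝ} (hσ : 0 < σ) (h0 : 0 ≤ θ) (h1 : θ ≤ 1 / 3) :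
    ∫⁻ s in Set.Ioo 0 σ, ENNReal.ofReal ((σ - s) ^ (-(3 / 4 : ℝ))) *
      ENNReal.ofReal (s ^ (-(1 / 4 + θ))) ≤ ENNReal.ofReal (13 * σ ^ (-θ)) := by
  have hσ2 : 0 < σ / 2 := by positivity
  refine (lintegral_conv_rpow_le (k := fun w => ENNReal.ofReal (w ^ (-(3 / 4 : ℝ)))) (a := 3 / 4)
    (K := 1) (K' := 4) hσ (by linarith) (by linarith)
    (by positivity) (by positivity) ?_ ?_).trans (ENNReal.ofReal_le_ofReal ?_)
  · intro w hw _
    rw [one_mul]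
    exact ENNReal.ofReal_le_ofReal (Real.rpow_le_rpow_of_nonpos hσ2 hw (by norm_num))
  · rw [← setLIntegral_congr Ioo_ae_eq_Ioc, lintegral_rpow_Ioo (by norm_num) hσ2.le]
    refine ENNReal.ofReal_le_ofReal (le_of_eq ?_)
    norm_num; ring
  · have e : (1 - 3 / 4 - (1 / 4 + θ) : ℝ) = -θ := by ring
    have h2 := half_rpow_le (θ := θ) hσ (by linarith)
    have h3 : 1 / (1 - (1 / 4 + θ)) ≤ 5 / 2 := by
      rw [div_le_iff₀ (by linarith)]
      linarith
    rw [e]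
    calc _ ≤ (5 / 2 + 4) * (2 * σ ^ (-θ)) := by gcongr
      _ = _ := by ring

theorem lintegral_comp_sub_Ioo (t σ : ℝ) (f : ℝ → ℝ≥0∞) :
    ∫⁻ s in Set.Ioo t (t + σ), f (s - t) = ∫⁻ s in Set.Ioo 0 σ, f s := by
  have h := (measurePreserving_sub_right volume t).setLIntegral_comp_preimage_emb
    (MeasurableEquiv.subRight t).measurableEmbedding f (Set.Ioo 0 σ)
  rw [← h]
  congr 2
  ext s
  simp only [Set.mem_Ioo, Set.mem_preimage, sub_pos, sub_lt_iff_lt_add']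

namespace RadialFlow

variable (S : RadialFlow)

/-- Nonlinear closing estimate: a small pointwise decay hypothesis is improved by the
Duhamel integral. -/
theorem exists_nonlinear_bound (h : S.Threshold) :
    ∃ d, 0 < d ∧ ∀ t₀ σ θ : ℝ, 0 < σ → (θ = 1 / 4 ∨ θ = 1 / 3) →
      (∀ s ∈ Set.Ioo 0 σ, ∀ y, 0 < y →
        ‖S.U (t₀ + s) y‖ ≤ d * min (s ^ (-(1 / 4 : ℝ))) (s ^ (-(1 / 3 : ℝ)))) →
      ∃ β : ℝ → ℝ≥0∞, (∀ s ∈ Set.Ioo t₀ (t₀ + σ),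
        ENNReal.ofReal ((t₀ + σ - s) ^ (-(3 / 2 : ℝ)) * ∫ y in Set.Ioi 0, y ^ 2 * ‖S.N s y‖)
          ≤ β s ∨
        ENNReal.ofReal (4 * (t₀ + σ - s) ^ (-(1 / 2 : ℝ)) *
          ∫ y in Set.Ioi 0, min y (y ^ 3 / (t₀ + σ - s)) * ‖S.N1 s y‖) ≤ β s) ∧
        ∫⁻ s in Set.Ioo t₀ (t₀ + σ), β s ≤ ENNReal.ofReal (d / 4 * σ ^ (-θ)) := by
  have hM := h.mass_pos
  have hs := sob_pos
  set E := S.mass 0 + 2 * sob with hE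
  set D := 10 * sob * (Real.pi + sob) with hD
  set Bc := 6 * (S.mass 0 + sob + 1) * (Real.pi + sob) with hBc
  have hE0 : 0 < E := by positivity
  have hD0 : 0 < D := by positivity
  have hBc0 : 0 < Bc := by positivity
  obtain ⟨l, hl⟩ : ∃ l, l = 84 * E + 1 := ⟨_, rfl⟩
  have hl0 : 0 < l := by rw [hl]; positivity
  obtain ⟨κ, hκ⟩ : ∃ κ, κ = 84 * l ^ 2 * Bc := ⟨_, rfl⟩
  have hκ0 : 0 < κ := by rw [hκ]; positivity
  set A := 6 * (Real.pi * κ ^ 2 + sob) with hA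
  have hA0 : 0 < A := by positivity
  obtain ⟨d, hd⟩ : ∃ d, d = 1 / (156 * (l * A + D)) := ⟨_, rfl⟩
  have hd0 : 0 < d := by rw [hd]; positivity
  refine ⟨d, hd0, fun t₀ σ θ hσ hθ hX => ?_⟩
  have hθ0 : 0 ≤ θ := by rcases hθ with rfl | rfl <;> norm_num
  have hθ1 : θ ≤ 1 / 3 := by rcases hθ with rfl | rfl <;> norm_num
  set k1 : ℝ → ℝ≥0∞ := (Set.Iio (l ^ 4)).indicator
    (fun w => ENNReal.ofReal (w ^ (-(1 / 2 : ℝ)))) with hk1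
  set k2 : ℝ → ℝ≥0∞ := (Set.Ici (l ^ 4)).indicator
    (fun w => ENNReal.ofReal (w ^ (-(3 / 2 : ℝ)))) with hk2
  set b : ℝ → ℝ≥0∞ := fun s =>
    ENNReal.ofReal (d * (Bc / κ)) * (k1 (σ - s) * ENNReal.ofReal (s ^ (-θ))) +
    (ENNReal.ofReal (d ^ 2 * (l * A + D)) * (ENNReal.ofReal ((σ - s) ^ (-(3 / 4 : ℝ))) *
      ENNReal.ofReal (s ^ (-(1 / 4 + θ)))) +
    ENNReal.ofReal (d * E) * (k2 (σ - s) * ENNReal.ofReal (s ^ (-θ)))) with hb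
  have mk1 : Measurable k1 := Measurable.indicator (by fun_prop) measurableSet_Iio
  have mk2 : Measurable k2 := Measurable.indicator (by fun_prop) measurableSet_Ici
  refine ⟨fun s => b (s - t₀), fun s hs => ?_, ?_⟩
  · obtain ⟨s, rfl⟩ : ∃ s', s = t₀ + s' := ⟨s - t₀, by ring⟩
    have hs' : s ∈ Set.Ioo 0 σ := ⟨by linarith [hs.1], by linarith [hs.2]⟩
    have hs0 := hs'.1
    have hw : 0 < σ - s := by linarith [hs'.2]
    have e1 : t₀ + σ - (t₀ + s) = σ - s := by ring
    have hX' := hX s hs'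
    set X := d * min (s ^ (-(1 / 4 : ℝ))) (s ^ (-(1 / 3 : ℝ))) with hXd
    have hX0 : 0 ≤ X := by positivity
    have x1 : X ≤ d * s ^ (-θ) := by
      rcases hθ with rfl | rfl
      · exact mul_le_mul_of_nonneg_left (min_le_left _ _) hd0.le
      · exact mul_le_mul_of_nonneg_left (min_le_right _ _) hd0.le
    have x2 : X ^ 2 ≤ d ^ 2 * s ^ (-(1 / 4 + θ)) := by
      have x3 : X ≤ d * s ^ (-(1 / 4 : ℝ)) :=
        mul_le_mul_of_nonneg_left (min_le_left _ _) hd0.le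
      calc X ^ 2 = X * X := sq X
        _ ≤ (d * s ^ (-(1 / 4 : ℝ))) * (d * s ^ (-θ)) := by gcongr
        _ = _ := by rw [neg_add, Real.rpow_add hs0]; ring
    simp only [e1, add_sub_cancel_left]
    rcases lt_or_ge (σ - s) (l ^ 4) with hlt | hge
    · right
      have e2 : k1 (σ - s) = ENNReal.ofReal ((σ - s) ^ (-(1 / 2 : ℝ))) :=
        Set.indicator_of_mem (s := Set.Iio (l ^ 4)) hlt _
      have hwl : (σ - s) ^ (-(1 / 2 : ℝ)) ≤ l * (σ - s) ^ (-(3 / 4 : ℝ)) := by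
        have h3 : (l ^ 4) ^ (1 / 4 : ℝ) = l := by
          rw [← Real.rpow_natCast, ← Real.rpow_mul hl0.le]; norm_num
        calc (σ - s) ^ (-(1 / 2 : ℝ)) = (σ - s) ^ (1 / 4 : ℝ) * (σ - s) ^ (-(3 / 4 : ℝ)) := by
              rw [← Real.rpow_add hw]; norm_num
          _ ≤ (l ^ 4) ^ (1 / 4 : ℝ) * (σ - s) ^ (-(3 / 4 : ℝ)) := by gcongr
          _ = _ := by rw [h3]
      have h4 := S.near_integrand_le h hw hκ0 hX'
      rw [← hA, ← hD, ← hBc] at h4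
      calc _ ≤ ENNReal.ofReal (d * (Bc / κ) * ((σ - s) ^ (-(1 / 2 : ℝ)) * s ^ (-θ)) +
            d ^ 2 * (l * A + D) * ((σ - s) ^ (-(3 / 4 : ℝ)) * s ^ (-(1 / 4 + θ)))) := by
            refine ENNReal.ofReal_le_ofReal (h4.trans ?_)
            calc _ = (σ - s) ^ (-(1 / 2 : ℝ)) * (X ^ 2 * A) +
                  (σ - s) ^ (-(1 / 2 : ℝ)) * (X * (Bc / κ)) +
                  (σ - s) ^ (-(3 / 4 : ℝ)) * (X ^ 2 * D) := by ring
              _ ≤ l * (σ - s) ^ (-(3 / 4 : ℝ)) * (d ^ 2 * s ^ (-(1 / 4 + θ)) * A) +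
                  (σ - s) ^ (-(1 / 2 : ℝ)) * (d * s ^ (-θ) * (Bc / κ)) +
                  (σ - s) ^ (-(3 / 4 : ℝ)) * (d ^ 2 * s ^ (-(1 / 4 + θ)) * D) := by gcongr
              _ = _ := by ring
        _ = ENNReal.ofReal (d * (Bc / κ)) * (k1 (σ - s) * ENNReal.ofReal (s ^ (-θ))) +
            ENNReal.ofReal (d ^ 2 * (l * A + D)) * (ENNReal.ofReal ((σ - s) ^ (-(3 / 4 : ℝ))) *
              ENNReal.ofReal (s ^ (-(1 / 4 + θ)))) := by
            rw [e2, ENNReal.ofReal_add (by positivity) (by positivity),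
              ENNReal.ofReal_mul (p := d * (Bc / κ)) (by positivity),
              ENNReal.ofReal_mul (p := d ^ 2 * (l * A + D)) (by positivity),
              ENNReal.ofReal_mul (p := (σ - s) ^ (-(1 / 2 : ℝ))) (by positivity),
              ENNReal.ofReal_mul (p := (σ - s) ^ (-(3 / 4 : ℝ))) (by positivity)]
        _ ≤ _ := by
            rw [hb]
            exact add_le_add le_rfl le_self_add
    · left
      have e2 : k2 (σ - s) = ENNReal.ofReal ((σ - s) ^ (-(3 / 2 : ℝ))) :=
        Set.indicator_of_mem (s := Set.Ici (l ^ 4)) hge _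
      have h4 := S.integral_N_le_of_bound h hX'
      calc _ ≤ ENNReal.ofReal (d * E * ((σ - s) ^ (-(3 / 2 : ℝ)) * s ^ (-θ))) := by
            refine ENNReal.ofReal_le_ofReal ?_
            calc _ ≤ (σ - s) ^ (-(3 / 2 : ℝ)) * (d * s ^ (-θ) * E) := by
                  gcongr
                  exact h4.trans (mul_le_mul_of_nonneg_right x1 hE0.le)
              _ = _ := by ring
        _ = ENNReal.ofReal (d * E) * (k2 (σ - s) * ENNReal.ofReal (s ^ (-θ))) := by
            rw [e2, ENNReal.ofReal_mul (p := d * E) (by positivity),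
              ENNReal.ofReal_mul (p := (σ - s) ^ (-(3 / 2 : ℝ))) (by positivity)]
        _ ≤ _ := le_add_left le_add_self
  · rw [lintegral_comp_sub_Ioo t₀ σ b]
    have c1 := lintegral_near_conv hσ hl0 hθ0 hθ1
    have c2 := lintegral_quarter_conv hσ hθ0 hθ1
    have c3 := lintegral_far_conv hσ hl0 hθ0 hθ1
    rw [hb, lintegral_add_left (by fun_prop), lintegral_add_left (by fun_prop),
      lintegral_const_mul' _ _ ENNReal.ofReal_ne_top,
      lintegral_const_mul' _ _ ENNReal.ofReal_ne_top,
      lintegral_const_mul' _ _ ENNReal.ofReal_ne_top]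
    calc _ ≤ ENNReal.ofReal (d * (Bc / κ)) * ENNReal.ofReal (7 * l ^ 2 * σ ^ (-θ)) +
          (ENNReal.ofReal (d ^ 2 * (l * A + D)) * ENNReal.ofReal (13 * σ ^ (-θ)) +
          ENNReal.ofReal (d * E) * ENNReal.ofReal (7 / l ^ 2 * σ ^ (-θ))) := by gcongr
      _ = ENNReal.ofReal (d * (Bc / κ) * (7 * l ^ 2 * σ ^ (-θ)) +
          (d ^ 2 * (l * A + D) * (13 * σ ^ (-θ)) + d * E * (7 / l ^ 2 * σ ^ (-θ)))) := by
          rw [← ENNReal.ofReal_mul (by positivity), ← ENNReal.ofReal_mul (by positivity),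
            ← ENNReal.ofReal_mul (by positivity), ← ENNReal.ofReal_add (by positivity)
            (by positivity), ← ENNReal.ofReal_add (by positivity) (by positivity)]
      _ ≤ _ := by
          refine ENNReal.ofReal_le_ofReal ?_
          have p1 : d * (Bc / κ) * (7 * l ^ 2 * σ ^ (-θ)) = d / 12 * σ ^ (-θ) := by
            rw [hκ]; field_simp; norm_num
          have p2 : d ^ 2 * (l * A + D) * (13 * σ ^ (-θ)) = d / 12 * σ ^ (-θ) := by
            have : d * (l * A + D) = 1 / 156 := by rw [hd]; field_simp
            calc _ = d * (d * (l * A + D)) * (13 * σ ^ (-θ)) := by ring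
              _ = _ := by rw [this]; ring
          have p3 : d * E * (7 / l ^ 2 * σ ^ (-θ)) ≤ d / 12 * σ ^ (-θ) := by
            have : E * (7 / l ^ 2) ≤ 1 / 12 := by
              rw [← mul_div_assoc, div_le_iff₀ (by positivity), hl]
              nlinarith
            calc _ = d * (E * (7 / l ^ 2)) * σ ^ (-θ) := by ring
              _ ≤ d * (1 / 12) * σ ^ (-θ) := by gcongr
              _ = _ := by ring
          rw [p1, p2]
          linarith

end RadialFlow

theorem CDecay.eventually_norm_le {f : ℝ → ℝ → ℂ} (hf : CDecay f) (t₀ : ℝ) {ε : ℝ} (hε : 0 < ε) :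
    ∀ᶠ t in nhds t₀, ∀ r, 0 ≤ r → ‖f t r‖ ≤ ‖f t₀ r‖ + ε := by
  obtain ⟨C, hC, h1⟩ := hf.2 (|t₀| + 1) 1
  have hF : Continuous fun p : ℝ × ℝ => f p.1 |p.2| :=
    hf.1.comp_continuous (f := fun p : ℝ × ℝ => (p.1, |p.2|)) (by fun_prop)
      fun p => ⟨trivial, abs_nonneg p.2⟩
  have hF0 : Continuous fun p : ℝ × ℝ => f t₀ |p.2| :=
    hF.comp (g := fun p : ℝ × ℝ => f p.1 |p.2|) (f := fun p : ℝ × ℝ => (t₀, p.2)) (by fun_prop)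
  have hK : ∀ᶠ t in nhds t₀, ∀ r ∈ Set.Icc 0 (C / ε), ‖f t |r|‖ < ‖f t₀ |r|‖ + ε := by
    refine isCompact_Icc.eventually_forall_of_forall_eventually fun r _ => ?_
    exact (hF.norm.continuousAt).eventually_lt ((hF0.norm.add continuous_const).continuousAt)
      (by simpa using hε)
  have hT : ∀ᶠ t in nhds t₀, |t| < |t₀| + 1 :=
    continuous_abs.continuousAt.eventually_lt continuousAt_const (by linarith)
  filter_upwards [hK, hT] with t ht htT r hr
  rcases le_or_gt r (C / ε) with h | h
  · have := ht r ⟨hr, h⟩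
    rw [abs_of_nonneg hr] at this
    exact this.le
  · have h2 := h1 t r htT.le hr
    rw [pow_one] at h2
    have h3 : C < r * ε := (div_lt_iff₀ hε).1 h
    have h4 : ‖f t r‖ ≤ ε := by
      by_contra! h5
      nlinarith [mul_lt_mul_of_pos_left h5 (show 0 < 1 + r by linarith)]
    linarith [norm_nonneg (f t₀ r)]

namespace RadialFlow

variable (S : RadialFlow)

/-- Uniform-in-space decay of order `-1/3` for subthreshold solutions. -/
theorem exists_decay (h : S.Threshold) :
    ∃ t₀ d : ℝ, 0 < d ∧ ∀ σ r : ℝ, 0 < σ → 0 < r → ‖S.U (t₀ + σ) r‖ ≤ d * σ ^ (-(1 / 3 : ℝ)) := by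
  obtain ⟨d, hd, hnl⟩ := S.exists_nonlinear_bound h
  obtain ⟨t₀, -, hlin⟩ := S.exists_linear_bound h (δ := d / 4) (by positivity)
  set φ : ℝ → ℝ := fun s => min (s ^ (-(1 / 4 : ℝ))) (s ^ (-(1 / 3 : ℝ))) with hφ
  set P : ℝ → Prop := fun s => ∀ y, 0 < y → ‖S.U (t₀ + s) y‖ ≤ d * φ s with hP
  have hφ0 : ∀ s, 0 < s → 0 < φ s := fun s hs => by rw [hφ]; positivity
  have hφc : ∀ s, 0 < s → ContinuousAt φ s := fun s hs =>
    (Real.continuousAt_rpow_const _ _ (Or.inl hs.ne')).min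
      (Real.continuousAt_rpow_const _ _ (Or.inl hs.ne'))
  have step : ∀ σ, 0 < σ → (∀ s ∈ Set.Ioo 0 σ, P s) →
      ∀ r, 0 < r → ‖S.U (t₀ + σ) r‖ ≤ d / 2 * φ σ := by
    intro σ hσ hs r hr
    have key : ∀ θ : ℝ, (θ = 1 / 4 ∨ θ = 1 / 3) → ‖S.U (t₀ + σ) r‖ ≤ d / 2 * σ ^ (-θ) := by
      intro θ hθ
      obtain ⟨β, hβ, hI⟩ := hnl t₀ σ θ hσ hθ hs
      have h1 := hlin σ r θ hσ hr (by rcases hθ with rfl | rfl <;> norm_num)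
        (by rcases hθ with rfl | rfl <;> norm_num) β hβ
      have h2 := h1.trans (add_le_add le_rfl hI)
      rw [← ENNReal.ofReal_add (by positivity) (by positivity),
        ENNReal.ofReal_le_ofReal_iff (by positivity)] at h2
      linarith
    rw [hφ, mul_min_of_nonneg _ _ (by positivity)]
    exact le_min (key _ (Or.inl rfl)) (key _ (Or.inr rfl))
  have small : ∃ ε, 0 < ε ∧ ∀ s, 0 < s → s < ε → P s := by
    obtain ⟨C, hC, hb⟩ := S.cU.2 (|t₀| + 1) 0
    refine ⟨min 1 ((d / (C + 1)) ^ 4), by positivity, fun s hs hsε y hy => ?_⟩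
    have hs1 : s < 1 := hsε.trans_le (min_le_left _ _)
    have hs2 : s ≤ (d / (C + 1)) ^ 4 := (hsε.trans_le (min_le_right _ _)).le
    have h1 := hb (t₀ + s) y ((abs_add_le _ _).trans (by rw [abs_of_pos hs]; linarith)) hy.le
    rw [pow_zero, one_mul] at h1
    have h2 : s ^ (-(1 / 4 : ℝ)) ≤ φ s :=
      le_min le_rfl (Real.rpow_le_rpow_of_exponent_ge hs hs1.le (by norm_num))
    have h3 : ((d / (C + 1)) ^ 4) ^ (-(1 / 4 : ℝ)) = (C + 1) / d := by
      rw [← Real.rpow_natCast, ← Real.rpow_mul (by positivity)]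
      norm_num
      rw [Real.rpow_neg_one, inv_div]
    have h4 : (C + 1) / d ≤ s ^ (-(1 / 4 : ℝ)) := by
      rw [← h3]
      exact Real.rpow_le_rpow_of_nonpos hs hs2 (by norm_num)
    calc _ ≤ C := h1
      _ ≤ d * ((C + 1) / d) := by field_simp; linarith
      _ ≤ d * φ s := by gcongr; exact h4.trans h2
  have all : ∀ σ, 0 < σ → P σ := by
    by_contra! hcon
    obtain ⟨σ₀, hσ₀, hn⟩ := hcon
    obtain ⟨ε, hε, hsm⟩ := small
    set F : Set ℝ := {s | 0 < s ∧ ¬ P s} with hF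
    have hFne : F.Nonempty := ⟨σ₀, hσ₀, hn⟩
    have hFlb : ∀ s ∈ F, ε ≤ s := fun s hs => by
      by_contra! hlt
      exact hs.2 (hsm s hs.1 hlt)
    have hFb : BddBelow F := ⟨ε, hFlb⟩
    set m := sInf F with hm
    have hm0 : 0 < m := hε.trans_le (le_csInf hFne hFlb)
    have hlt : ∀ s ∈ Set.Ioo 0 m, P s := fun s hs => by
      by_contra hns
      exact notMem_of_lt_csInf hs.2 hFb ⟨hs.1, hns⟩
    have hmb := step m hm0 hlt
    have hpos : 0 < d / 4 * φ m := mul_pos (by positivity) (hφ0 m hm0)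
    have hev := S.cU.eventually_norm_le (t₀ + m) hpos
    have hev' : ∀ᶠ s in nhds m, ∀ r, 0 ≤ r →
        ‖S.U (t₀ + s) r‖ ≤ ‖S.U (t₀ + m) r‖ + d / 4 * φ m :=
      (continuous_const.add continuous_id).continuousAt.eventually hev
    have hev2 : ∀ᶠ s in nhds m, 3 / 4 * φ m < φ s :=
      (continuousAt_const).eventually_lt (hφc m hm0) (by linarith [hφ0 m hm0])
    obtain ⟨η, hη, hball⟩ := Metric.eventually_nhds_iff.1 (hev'.and hev2)
    obtain ⟨a, haF, ham⟩ := exists_lt_of_csInf_lt hFne (show sInf F < m + η by linarith)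
    have ham' : m ≤ a := csInf_le hFb haF
    obtain ⟨h1, h2⟩ := hball (y := a) (by rw [Real.dist_eq, abs_lt]; constructor <;> linarith)
    refine haF.2 fun y hy => ?_
    have h3 := h1 y hy.le
    have h4 := hmb y hy
    nlinarith
  refine ⟨t₀, d, hd, fun σ r hσ hr => (all σ hσ r hr).trans ?_⟩
  exact mul_le_mul_of_nonneg_left (min_le_right _ _) hd.le

end RadialFlow

theorem RapidDecay.time_neg {f : ℝ → ℝ → ℝ} (hf : RapidDecay f) :
    RapidDecay (fun t r => f (-t) r) := by
  refine ⟨?_, fun T n => ?_⟩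
  · exact hf.1.comp (f := fun p : ℝ × ℝ => (-p.1, p.2)) (by fun_prop) fun p hp => ⟨trivial, hp.2⟩
  · obtain ⟨C, hC, h⟩ := hf.2 T n
    exact ⟨C, hC, fun t r ht hr => h (-t) r (by rwa [abs_neg]) hr⟩

namespace RadialFlow

variable (S : RadialFlow)

/-- Time reversal `u(t) ↦ conj u(-t)`. -/
def reverse : RadialFlow where
  f t r := S.f (-t) r
  f1 t r := S.f1 (-t) r
  f2 t r := S.f2 (-t) r
  f3 t r := S.f3 (-t) r
  g t r := -S.g (-t) r
  g1 t r := -S.g1 (-t) r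
  g2 t r := -S.g2 (-t) r
  g3 t r := -S.g3 (-t) r
  rf := S.rf.time_neg
  rf1 := S.rf1.time_neg
  rf2 := S.rf2.time_neg
  rf3 := S.rf3.time_neg
  rg := S.rg.time_neg.neg
  rg1 := S.rg1.time_neg.neg
  rg2 := S.rg2.time_neg.neg
  rg3 := S.rg3.time_neg.neg
  hf t r := S.hf (-t) r
  hf1 t r := S.hf1 (-t) r
  hf2 t r := S.hf2 (-t) r
  hg t r := (S.hg (-t) r).neg
  hg1 t r := (S.hg1 (-t) r).neg
  hg2 t r := (S.hg2 (-t) r).neg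
  f_even t r := S.f_even (-t) r
  g_even t r := by rw [S.g_even]
  f_dt t r hr := by
    refine ((S.f_dt (-t) r hr).comp t (hasDerivAt_neg t)).congr_deriv ?_
    ring
  g_dt t r hr := by
    refine (((S.g_dt (-t) r hr).comp t (hasDerivAt_neg t)).neg.congr_deriv ?_).congr_of_eventuallyEq
      (Filter.Eventually.of_forall fun s => ?_)
    · ring
    · simp
  f1_dt t r hr := by
    refine ((S.f1_dt (-t) r hr).comp t (hasDerivAt_neg t)).congr_deriv ?_
    ring
  g1_dt t r hr := by
    refine (((S.g1_dt (-t) r hr).comp t (hasDerivAt_neg t)).neg.congr_deriv ?_).congr_of_eventuallyEq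
      (Filter.Eventually.of_forall fun s => ?_)
    · ring
    · simp; ring

theorem reverse_q (t r : ℝ) : S.reverse.q t r = S.q (-t) r := by
  simp only [q, reverse, neg_sq]

theorem Threshold.reverse {S : RadialFlow} (h : S.Threshold) : S.reverse.Threshold := by
  have e1 : S.reverse.B 0 = S.B 0 := by
    simp only [B, kin, a1, b1, RadialFlow.reverse, neg_zero]
    congr 1; ext r; ring
  have e2 : S.reverse.L4 0 = S.L4 0 := by simp only [L4, d4, reverse_q, neg_zero]
  have e3 : S.reverse.L6 0 = S.L6 0 := by simp only [L6, d6, reverse_q, neg_zero]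
  unfold Threshold
  rw [e1, e2, e3]
  exact h

/-- radial density of the tenth power -/
def d10 (t r : ℝ) : ℝ := r ^ 2 * S.q t r ^ 5

theorem rd10 : RapidDecay S.d10 := (S.rq.pow 4).weight (polyWeight_id.pow 1)

/-- radial form of the spatial `L¹⁰` norm to the tenth power -/
def L10 (t : ℝ) : ℝ := ∫ r in Set.Ioi 0, S.d10 t r

theorem exists_lintegral_L10_Ioi (h : S.Threshold) :
    ∃ T, ∫⁻ t in Set.Ioi T, ENNReal.ofReal (S.L10 t) < ⊤ := by
  obtain ⟨t₀, d, hd, hdec⟩ := S.exists_decay h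
  have hs := sob_pos
  refine ⟨t₀ + 1, ?_⟩
  have key : ∀ t ∈ Set.Ioi (t₀ + 1), ENNReal.ofReal (S.L10 t) ≤
      ENNReal.ofReal (d ^ 4 * sob) * ENNReal.ofReal ((t - t₀) ^ (-(4 / 3 : ℝ))) := by
    intro t ht
    have hσ : 0 < t - t₀ := by linarith [Set.mem_Ioi.1 ht]
    rw [← ENNReal.ofReal_mul (by positivity)]
    refine ENNReal.ofReal_le_ofReal ?_
    have e4 : (d * (t - t₀) ^ (-(1 / 3 : ℝ))) ^ 4 = d ^ 4 * (t - t₀) ^ (-(4 / 3 : ℝ)) := by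
      rw [mul_pow, ← Real.rpow_natCast ((t - t₀) ^ _), ← Real.rpow_mul hσ.le]; norm_num
    calc S.L10 t ≤ ∫ r in Set.Ioi 0, d ^ 4 * (t - t₀) ^ (-(4 / 3 : ℝ)) * S.d6 t r := by
          refine setIntegral_mono_on (S.rd10.integrableOn t)
            ((S.rd6.integrableOn t).const_mul _) measurableSet_Ioi fun r hr => ?_
          have h1 := hdec (t - t₀) r hσ hr
          rw [add_sub_cancel] at h1
          have h2 := S.norm_U_sq t r
          have hq := S.q_nonneg t r
          rw [← e4, d10, d6]
          calc r ^ 2 * S.q t r ^ 5 = ‖S.U t r‖ ^ 4 * (r ^ 2 * S.q t r ^ 3) := by rw [← h2]; ring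
            _ ≤ _ := by gcongr
      _ = d ^ 4 * (t - t₀) ^ (-(4 / 3 : ℝ)) * S.L6 t := by rw [integral_const_mul, L6]
      _ ≤ d ^ 4 * (t - t₀) ^ (-(4 / 3 : ℝ)) * sob := by
          gcongr; exact h.L6_le_sob t
      _ = _ := by ring
  have e : Set.Ioi (t₀ + 1) = (fun t => t - t₀) ⁻¹' Set.Ioi 1 := by
    ext t; simp [add_comm]
  have hI : ∫⁻ t in Set.Ioi (t₀ + 1), ENNReal.ofReal ((t - t₀) ^ (-(4 / 3 : ℝ))) =
      ∫⁻ t in Set.Ioi (1 : ℝ), ENNReal.ofReal (t ^ (-(4 / 3 : ℝ))) := by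
    rw [e]
    exact (measurePreserving_sub_right volume t₀).setLIntegral_comp_preimage_emb
      (MeasurableEquiv.subRight t₀).measurableEmbedding
      (fun t => ENNReal.ofReal (t ^ (-(4 / 3 : ℝ)))) (Set.Ioi 1)
  calc _ ≤ ∫⁻ t in Set.Ioi (t₀ + 1),
        ENNReal.ofReal (d ^ 4 * sob) * ENNReal.ofReal ((t - t₀) ^ (-(4 / 3 : ℝ))) :=
        setLIntegral_mono' measurableSet_Ioi key
    _ = ENNReal.ofReal (d ^ 4 * sob) * ENNReal.ofReal (1 ^ (1 - 4 / 3 : ℝ) / (4 / 3 - 1)) := by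
        rw [lintegral_const_mul' _ _ ENNReal.ofReal_ne_top, hI,
          lintegral_rpow_Ioi (by norm_num) one_pos]
    _ < ⊤ := ENNReal.mul_lt_top ENNReal.ofReal_lt_top ENNReal.ofReal_lt_top

theorem lintegral_L10_Icc (T : ℝ) :
    ∫⁻ t in Set.Icc (-T) T, ENNReal.ofReal (S.L10 t) < ⊤ := by
  obtain ⟨C, hC, hb⟩ := S.rd10.exists_bound T
  have hI : IntegrableOn (fun r : ℝ => C * (1 + r ^ 2)⁻¹) (Set.Ioi 0) :=
    (integrable_inv_one_add_sq.const_mul C).integrableOn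
  refine setLIntegral_lt_top_of_le_nnreal (by simp)
    ⟨(∫ r in Set.Ioi 0, C * (1 + r ^ 2)⁻¹).toNNReal, fun t ht => ?_⟩
  refine ENNReal.ofReal_le_ofReal ?_
  refine setIntegral_mono_on (S.rd10.integrableOn t) hI measurableSet_Ioi fun r hr => ?_
  exact (le_abs_self _).trans (hb t r (abs_le.2 ht) (le_of_lt hr))

/-- Threshold solutions below the ground state have finite spacetime `L¹⁰` norm, in polar form. -/
theorem lintegral_L10_lt_top (h : S.Threshold) : ∫⁻ t, ENNReal.ofReal (S.L10 t) < ⊤ := by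
  obtain ⟨T₁, h1⟩ := S.exists_lintegral_L10_Ioi h
  obtain ⟨T₂, h2⟩ := S.reverse.exists_lintegral_L10_Ioi h.reverse
  have e2 : ∫⁻ t in Set.Iio (-T₂), ENNReal.ofReal (S.L10 t) =
      ∫⁻ t in Set.Ioi T₂, ENNReal.ofReal (S.reverse.L10 t) := by
    have hr : ∀ t, S.reverse.L10 t = S.L10 (-t) := fun t => by simp only [L10, d10, reverse_q]
    have hp : Set.Ioi T₂ = Neg.neg ⁻¹' Set.Iio (-T₂) := by ext t; simp
    simp only [hr]
    rw [hp]
    exact ((Measure.measurePreserving_neg volume).setLIntegral_comp_preimage_emb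
      (MeasurableEquiv.neg ℝ).measurableEmbedding (fun t => ENNReal.ofReal (S.L10 t)) _).symm
  rw [← e2] at h2
  have h3 := S.lintegral_L10_Icc (max T₁ T₂)
  have hU : (Set.univ : Set ℝ) ⊆
      Set.Ioi T₁ ∪ (Set.Iio (-T₂) ∪ Set.Icc (-max T₁ T₂) (max T₁ T₂)) := by
    intro t _
    by_contra hn
    simp only [Set.mem_union, Set.mem_Ioi, Set.mem_Iio, Set.mem_Icc, not_or, not_lt] at hn
    exact hn.2.2 ⟨by linarith [hn.2.1, le_max_right T₁ T₂], hn.1.trans (le_max_left _ _)⟩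
  rw [← setLIntegral_univ]
  calc _ ≤ _ := lintegral_mono_set hU
    _ ≤ _ := lintegral_union_le _ _ _
    _ ≤ _ := add_le_add le_rfl (lintegral_union_le _ _ _)
    _ < ⊤ := ENNReal.add_lt_top.2 ⟨h1, ENNReal.add_lt_top.2 ⟨h2, h3⟩⟩

end RadialFlow

theorem integral_radial (f : ℝ → ℝ) :
    ∫ x : E3, f ‖x‖ = 4 * Real.pi * ∫ r in Set.Ioi 0, r ^ 2 * f r := by
  have h := integral_fun_norm_addHaar (volume : Measure E3) f
  have hv : (volume : Measure E3).real (Metric.ball 0 1) = Real.pi * 4 / 3 := by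
    rw [Measure.real, EuclideanSpace.volume_ball_fin_three]
    simp
    positivity
  rw [h, hv, finrank_euclideanSpace_fin]
  simp only [smul_eq_mul, nsmul_eq_mul, Nat.cast_ofNat]
  ring

theorem hasDerivAt_bubble_potential (x : ℝ) :
    HasDerivAt (fun x : ℝ => 1 / 8 * Real.arctan x + (x ^ 3 - x) / (8 * (1 + x ^ 2) ^ 2))
      (x ^ 2 / (1 + x ^ 2) ^ 3) x := by
  have h0 : (8 * (1 + x ^ 2) ^ 2) ≠ 0 := by positivity
  have h1 : (1 + x ^ 2) ≠ 0 := by positivity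
  refine (((Real.hasDerivAt_arctan x).const_mul (1 / 8)).add
    ((((hasDerivAt_id x).pow 3).sub (hasDerivAt_id x)).div
      (((((hasDerivAt_id x).pow 2).const_add 1).pow 2).const_mul 8) h0)).congr_deriv ?_
  simp only [id, Pi.sub_apply, Pi.pow_apply]
  field_simp
  push_cast
  ring

theorem hasDerivAt_bubble_kinetic (x : ℝ) :
    HasDerivAt (fun x : ℝ => 3 / 8 * Real.arctan x - (5 * x ^ 3 + 3 * x) / (8 * (1 + x ^ 2) ^ 2))
      (x ^ 4 / (1 + x ^ 2) ^ 3) x := by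
  have h0 : (8 * (1 + x ^ 2) ^ 2) ≠ 0 := by positivity
  have h1 : (1 + x ^ 2) ≠ 0 := by positivity
  refine (((Real.hasDerivAt_arctan x).const_mul (3 / 8)).sub
    (((((hasDerivAt_id x).pow 3).const_mul 5).add ((hasDerivAt_id x).const_mul 3)).div
      (((((hasDerivAt_id x).pow 2).const_add 1).pow 2).const_mul 8) h0)).congr_deriv ?_
  simp only [id, Pi.add_apply, Pi.pow_apply]
  field_simp
  push_cast
  ring

theorem tendsto_cubic_div_quartic (a b : ℝ) :
    Filter.Tendsto (fun x : ℝ => (a * x ^ 3 + b * x) / (8 * (1 + x ^ 2) ^ 2)) Filter.atTop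
      (nhds 0) := by
  have h : Filter.Tendsto (fun x : ℝ => (|a| + |b|) * x⁻¹) Filter.atTop (nhds 0) := by
    simpa using tendsto_inv_atTop_zero.const_mul (|a| + |b|)
  refine squeeze_zero_norm' ?_ h
  filter_upwards [Filter.eventually_ge_atTop 1] with x hx
  have hx0 : 0 < x := by linarith
  rw [Real.norm_eq_abs, abs_div, abs_of_pos (show 0 < 8 * (1 + x ^ 2) ^ 2 by positivity),
    div_le_iff₀ (by positivity)]
  have h1 : |a * x ^ 3 + b * x| ≤ (|a| + |b|) * x ^ 3 := by
    refine (abs_add_le _ _).trans ?_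
    rw [abs_mul, abs_mul, abs_of_pos hx0, abs_of_pos (show 0 < x ^ 3 by positivity), add_mul]
    have : x ≤ x ^ 3 := le_self_pow₀ hx (by norm_num)
    gcongr
  refine h1.trans ?_
  have h2 : x ^ 3 ≤ x⁻¹ * (8 * (1 + x ^ 2) ^ 2) := by
    rw [inv_mul_eq_div, le_div_iff₀ hx0]
    nlinarith [sq_nonneg (x ^ 2), sq_nonneg x]
  rw [mul_assoc]
  gcongr

theorem bubble_potential : IntegrableOn (fun x : ℝ => x ^ 2 / (1 + x ^ 2) ^ 3) (Set.Ioi 0) ∧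
    ∫ x in Set.Ioi (0 : ℝ), x ^ 2 / (1 + x ^ 2) ^ 3 = Real.pi / 16 := by
  have ht : Filter.Tendsto
      (fun x : ℝ => 1 / 8 * Real.arctan x + (x ^ 3 - x) / (8 * (1 + x ^ 2) ^ 2)) Filter.atTop
      (nhds (1 / 8 * (Real.pi / 2) + 0)) := by
    refine Filter.Tendsto.add
      ((Real.tendsto_arctan_atTop.mono_right nhdsWithin_le_nhds).const_mul _) ?_
    simpa [sub_eq_add_neg] using tendsto_cubic_div_quartic 1 (-1)
  refine ⟨integrableOn_Ioi_deriv_of_nonneg' (fun x _ => hasDerivAt_bubble_potential x)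
    (fun x _ => by positivity) ht, ?_⟩
  rw [integral_Ioi_of_hasDerivAt_of_nonneg' (fun x _ => hasDerivAt_bubble_potential x)
    (fun x _ => by positivity) ht]
  simp
  ring

theorem bubble_kinetic : IntegrableOn (fun x : ℝ => x ^ 4 / (1 + x ^ 2) ^ 3) (Set.Ioi 0) ∧
    ∫ x in Set.Ioi (0 : ℝ), x ^ 4 / (1 + x ^ 2) ^ 3 = 3 * Real.pi / 16 := by
  have ht : Filter.Tendsto
      (fun x : ℝ => 3 / 8 * Real.arctan x - (5 * x ^ 3 + 3 * x) / (8 * (1 + x ^ 2) ^ 2))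
      Filter.atTop (nhds (3 / 8 * (Real.pi / 2) - 0)) :=
    Filter.Tendsto.sub
      ((Real.tendsto_arctan_atTop.mono_right nhdsWithin_le_nhds).const_mul _)
      (tendsto_cubic_div_quartic 5 3)
  refine ⟨integrableOn_Ioi_deriv_of_nonneg' (fun x _ => hasDerivAt_bubble_kinetic x)
    (fun x _ => by positivity) ht, ?_⟩
  rw [integral_Ioi_of_hasDerivAt_of_nonneg' (fun x _ => hasDerivAt_bubble_kinetic x)
    (fun x _ => by positivity) ht]
  simp
  ring

theorem ground_potential :
    IntegrableOn (fun r : ℝ => r ^ 2 * (1 + r ^ 2 / 3)⁻¹ ^ 3) (Set.Ioi 0) ∧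
    ∫ r in Set.Ioi (0 : ℝ), r ^ 2 * (1 + r ^ 2 / 3)⁻¹ ^ 3 = sob := by
  have h3 : 0 < (√3)⁻¹ := by positivity
  have e : (fun r : ℝ => r ^ 2 * (1 + r ^ 2 / 3)⁻¹ ^ 3) =
      fun r => 3 * (fun x : ℝ => x ^ 2 / (1 + x ^ 2) ^ 3) ((√3)⁻¹ * r) := by
    ext r
    simp only [mul_pow, inv_pow, Real.sq_sqrt (show (0 : ℝ) ≤ 3 by norm_num)]
    field_simp
  obtain ⟨h1, h2⟩ := bubble_potential
  rw [e]
  refine ⟨?_, ?_⟩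
  · refine Integrable.const_mul ?_ 3
    exact (integrableOn_Ioi_comp_mul_left_iff _ 0 h3).2 (by simpa using h1)
  · rw [integral_const_mul, integral_comp_mul_left_Ioi (fun x : ℝ => x ^ 2 / (1 + x ^ 2) ^ 3) 0 h3,
      mul_zero, h2, inv_inv, sob,      smul_eq_mul]
    ring

theorem ground_kinetic :
    IntegrableOn (fun r : ℝ => r ^ 2 * (r ^ 2 / 9 * (1 + r ^ 2 / 3)⁻¹ ^ 3)) (Set.Ioi 0) ∧
    ∫ r in Set.Ioi (0 : ℝ), r ^ 2 * (r ^ 2 / 9 * (1 + r ^ 2 / 3)⁻¹ ^ 3) = sob := by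
  have h3 : 0 < (√3)⁻¹ := by positivity
  have e : (fun r : ℝ => r ^ 2 * (r ^ 2 / 9 * (1 + r ^ 2 / 3)⁻¹ ^ 3)) =
      fun r => (fun x : ℝ => x ^ 4 / (1 + x ^ 2) ^ 3) ((√3)⁻¹ * r) := by
    ext r
    have h4 : √3 ^ 4 = 9 := by
      rw [show (√3) ^ 4 = (√3 ^ 2) ^ 2 by ring, Real.sq_sqrt (by norm_num)]; norm_num
    simp only [mul_pow, inv_pow, Real.sq_sqrt (show (0 : ℝ) ≤ 3 by norm_num), h4]
    field_simp
  obtain ⟨h1, h2⟩ := bubble_kinetic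
  rw [e]
  refine ⟨(integrableOn_Ioi_comp_mul_left_iff _ 0 h3).2 (by simpa using h1), ?_⟩
  rw [integral_comp_mul_left_Ioi (fun x : ℝ => x ^ 4 / (1 + x ^ 2) ^ 3) 0 h3, mul_zero, h2,
    inv_inv, sob, smul_eq_mul]
  ring

theorem hasFDerivAt_W (x : E3) : HasFDerivAt W
    ((-(1 / 3) * (1 + ‖x‖ ^ 2 / 3) ^ (-(3 : ℝ) / 2)) • innerSL ℝ x) x := by
  have h0 : 0 < 1 + ‖x‖ ^ 2 / 3 := by positivity
  have h1 : HasFDerivAt (fun x : E3 => 1 + ‖x‖ ^ 2 / 3) ((2 / 3 : ℝ) • innerSL ℝ x) x := by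
    have := ((hasStrictFDerivAt_norm_sq x).hasFDerivAt.const_mul (1 / 3 : ℝ)).const_add 1
    refine (this.congr_fderiv ?_).congr_of_eventuallyEq (Filter.Eventually.of_forall fun y => ?_)
    · ext y; simp; ring
    · simp; ring
  have h2 := h1.rpow_const (p := -(1 : ℝ) / 2) (Or.inl h0.ne')
  refine h2.congr_fderiv ?_
  rw [smul_smul]
  congr 1
  rw [show -(1 : ℝ) / 2 - 1 = -(3 : ℝ) / 2 by norm_num]
  ring

theorem sum_inner_e3_sq (x : E3) : ∑ i, (inner ℝ x (e3 i)) ^ 2 = ‖x‖ ^ 2 := by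
  simp [e3, EuclideanSpace.norm_sq_eq, EuclideanSpace.inner_single_right]

theorem W_rpow_aux (x : E3) : ((1 + ‖x‖ ^ 2 / 3) ^ (-(3 : ℝ) / 2)) ^ 2 =
    (1 + ‖x‖ ^ 2 / 3)⁻¹ ^ 3 := by
  have h0 : 0 < 1 + ‖x‖ ^ 2 / 3 := by positivity
  rw [← Real.rpow_natCast, ← Real.rpow_mul h0.le, inv_pow, ← Real.rpow_natCast _ 3,
    ← Real.rpow_neg h0.le]
  norm_num

theorem gradSqR_W (x : E3) : gradSqR W x = ‖x‖ ^ 2 / 9 * (1 + ‖x‖ ^ 2 / 3)⁻¹ ^ 3 := by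
  simp only [gradSqR, pdR, (hasFDerivAt_W x).fderiv]
  simp only [smul_apply, innerSL_apply_apply, smul_eq_mul, mul_pow]
  rw [← Finset.mul_sum, sum_inner_e3_sq, W_rpow_aux]
  ring

theorem gradSqC_Wc (x : E3) : gradSqC Wc x = gradSqR W x := by
  simp only [gradSqR, gradSqC, pdR, pdC, (hasFDerivAt_W x).fderiv]
  have h : HasFDerivAt Wc (ofRealCLM.comp
      ((-(1 / 3) * (1 + ‖x‖ ^ 2 / 3) ^ (-(3 : ℝ) / 2)) • innerSL ℝ x)) x :=
    ofRealCLM.hasFDerivAt.comp x (hasFDerivAt_W x)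
  rw [h.fderiv]
  refine Finset.sum_congr rfl fun i _ => ?_
  rw [ContinuousLinearMap.comp_apply, ofRealCLM_apply, norm_real, Real.norm_eq_abs, sq_abs]

theorem norm_Wc_pow (x : E3) : ‖Wc x‖ ^ 6 = (1 + ‖x‖ ^ 2 / 3)⁻¹ ^ 3 := by
  have h0 : 0 < 1 + ‖x‖ ^ 2 / 3 := by positivity
  rw [Wc, norm_real, W, Real.norm_of_nonneg (by positivity), ← W_rpow_aux,
    ← Real.rpow_mul_natCast h0.le, ← Real.rpow_mul_natCast h0.le]
  norm_num

theorem integral_gradSqR_W : ∫ x : E3, gradSqR W x = 4 * Real.pi * sob := by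
  simp only [gradSqR_W]
  rw [integral_radial fun r => r ^ 2 / 9 * (1 + r ^ 2 / 3)⁻¹ ^ 3, ground_kinetic.2]

theorem Ecrit_Wc : Ecrit Wc = 4 * Real.pi * (sob / 3) := by
  simp only [Ecrit, gradSqC_Wc, gradSqR_W, norm_Wc_pow]
  rw [integral_radial fun r => 1 / 2 * (r ^ 2 / 9 * (1 + r ^ 2 / 3)⁻¹ ^ 3)
    - 1 / 6 * (1 + r ^ 2 / 3)⁻¹ ^ 3]
  congr 1
  have e : ∀ r : ℝ, r ^ 2 * (1 / 2 * (r ^ 2 / 9 * (1 + r ^ 2 / 3)⁻¹ ^ 3)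
      - 1 / 6 * (1 + r ^ 2 / 3)⁻¹ ^ 3) =
      1 / 2 * (r ^ 2 * (r ^ 2 / 9 * (1 + r ^ 2 / 3)⁻¹ ^ 3)) -
      1 / 6 * (r ^ 2 * (1 + r ^ 2 / 3)⁻¹ ^ 3) := fun r => by ring
  simp only [e]
  rw [integral_sub (ground_kinetic.1.const_mul _) (ground_potential.1.const_mul _),
    integral_const_mul, integral_const_mul, ground_kinetic.2, ground_potential.2]
  ring

theorem inner_e3 (x : E3) (i : Fin 3) : inner ℝ x (e3 i) = x i := by
  simp [e3, EuclideanSpace.inner_single_right]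

theorem norm_e3 (i : Fin 3) : ‖e3 i‖ = 1 := by simp [e3]

theorem hasFDerivAt_norm_of_ne {x : E3} (hx : x ≠ 0) :
    HasFDerivAt (fun y : E3 => ‖y‖) (‖x‖⁻¹ • innerSL ℝ x) x := by
  have h0 : 0 < ‖x‖ := norm_pos_iff.2 hx
  have h := (hasStrictFDerivAt_norm_sq x).hasFDerivAt.sqrt (by positivity)
  simp only [Real.sqrt_sq (norm_nonneg _)] at h
  refine h.congr_fderiv ?_
  ext y
  simp
  field_simp

section Radial

variable {g : E3 → ℂ} {φ φ1 φ2 : ℝ → ℂ}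

theorem pdC_radial (hg : ∀ y, g y = φ ‖y‖) (h1 : ∀ r, HasDerivAt φ (φ1 r) r) {x : E3} (hx : x ≠ 0)
    (i : Fin 3) : pdC i g x = ((‖x‖⁻¹ * x i : ℝ) : ℂ) * φ1 ‖x‖ := by
  have h : HasFDerivAt g _ x := ((h1 ‖x‖).hasFDerivAt.comp x
    (hasFDerivAt_norm_of_ne hx)).congr_of_eventuallyEq (Filter.Eventually.of_forall hg)
  rw [pdC, h.fderiv]
  simp [inner_e3]
  ring

theorem sum_coord_sq (x : E3) : ∑ i, x i ^ 2 = ‖x‖ ^ 2 := by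
  simp [EuclideanSpace.norm_sq_eq]

theorem gradSqC_radial (hg : ∀ y, g y = φ ‖y‖) (h1 : ∀ r, HasDerivAt φ (φ1 r) r) {x : E3}
    (hx : x ≠ 0) : gradSqC g x = ‖φ1 ‖x‖‖ ^ 2 := by
  have h0 : 0 < ‖x‖ := norm_pos_iff.2 hx
  have e : ∀ i, ‖pdC i g x‖ ^ 2 = x i ^ 2 * (‖x‖⁻¹ ^ 2 * ‖φ1 ‖x‖‖ ^ 2) := fun i => by
    rw [pdC_radial hg h1 hx, norm_mul, norm_real, mul_pow, Real.norm_eq_abs, sq_abs]; ring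
  simp only [gradSqC, e]
  rw [← Finset.sum_mul, sum_coord_sq]
  field_simp

theorem lapC_radial (hg : ∀ y, g y = φ ‖y‖) (h1 : ∀ r, HasDerivAt φ (φ1 r) r)
    (h2 : ∀ r, HasDerivAt φ1 (φ2 r) r) {x : E3} (hx : x ≠ 0) :
    lapC g x = φ2 ‖x‖ + 2 / (‖x‖ : ℂ) * φ1 ‖x‖ := by
  have h0 : 0 < ‖x‖ := norm_pos_iff.2 hx
  have hn := hasFDerivAt_norm_of_ne hx
  have hinv : HasFDerivAt (fun y : E3 => ‖y‖⁻¹) ((-(‖x‖ ^ 2)⁻¹) • (‖x‖⁻¹ • innerSL ℝ x)) x :=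
    (hasDerivAt_inv h0.ne').comp_hasFDerivAt x hn
  have e : ∀ i, pdC i (pdC i g) x = ((‖x‖⁻¹ : ℝ) : ℂ) * φ1 ‖x‖ +
      ((x i ^ 2 : ℝ) : ℂ) * (((-(‖x‖ ^ 2)⁻¹ * ‖x‖⁻¹ : ℝ) : ℂ) * φ1 ‖x‖ +
        ((‖x‖⁻¹ ^ 2 : ℝ) : ℂ) * φ2 ‖x‖) := fun i => by
    have hE : pdC i g =ᶠ[nhds x] fun y => (‖y‖⁻¹ * y i) • φ1 ‖y‖ := by
      filter_upwards [isOpen_ne.mem_nhds hx] with y hy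
      rw [pdC_radial hg h1 hy, real_smul]
    have hc : HasFDerivAt (fun y : E3 => y i) (EuclideanSpace.proj i : E3 →L[ℝ] ℝ) x :=
      (EuclideanSpace.proj i : E3 →L[ℝ] ℝ).hasFDerivAt
    have hd := (hinv.mul hc).smul ((h2 ‖x‖).hasFDerivAt.comp x hn)
    rw [pdC, hE.fderiv_eq]
    have hd' : HasFDerivAt (fun y : E3 => (‖y‖⁻¹ * y i) • φ1 ‖y‖) _ x := hd
    rw [hd'.fderiv]
    simp [e3, EuclideanSpace.inner_single_right]
    ring
  simp only [lapC, e]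
  rw [Finset.sum_add_distrib, Finset.sum_const,
    ← Finset.sum_mul (f := fun i => ((x i ^ 2 : ℝ) : ℂ)), ← ofReal_sum, sum_coord_sq]
  have h0c : (‖x‖ : ℂ) ≠ 0 := by exact_mod_cast h0.ne'
  simp
  field_simp
  ring

end Radial

/-- second partial derivative of a function on the plane -/
def pd2 (F : ℝ × ℝ → ℂ) (p : ℝ × ℝ) : ℂ := fderiv ℝ F p (0, 1)

/-- first partial derivative of a function on the plane -/
def pd1 (F : ℝ × ℝ → ℂ) (p : ℝ × ℝ) : ℂ := fderiv ℝ F p (1, 0)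

section Plane

variable {F : ℝ × ℝ → ℂ}

theorem contDiff_pd2 (hF : ContDiff ℝ (⊤ : ℕ∞) F) : ContDiff ℝ (⊤ : ℕ∞) (pd2 F) :=
  (hF.fderiv_right (m := (⊤ : ℕ∞)) (by simp)).clm_apply contDiff_const

theorem contDiff_pd1 (hF : ContDiff ℝ (⊤ : ℕ∞) F) : ContDiff ℝ (⊤ : ℕ∞) (pd1 F) :=
  (hF.fderiv_right (m := (⊤ : ℕ∞)) (by simp)).clm_apply contDiff_const

theorem hasDerivAt_pd2 (hF : ContDiff ℝ (⊤ : ℕ∞) F) (t r : ℝ) :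
    HasDerivAt (fun s => F (t, s)) (pd2 F (t, r)) r :=
  ((hF.differentiable (by simp)) (t, r)).hasFDerivAt.comp_hasDerivAt r
    ((hasDerivAt_const r t).prodMk (hasDerivAt_id r))

theorem hasDerivAt_pd1 (hF : ContDiff ℝ (⊤ : ℕ∞) F) (t r : ℝ) :
    HasDerivAt (fun s => F (s, r)) (pd1 F (t, r)) t :=
  HasFDerivAt.comp_hasDerivAt (f := fun s => (s, r)) t
    ((hF.differentiable (by simp)) (t, r)).hasFDerivAt
    ((hasDerivAt_id t).prodMk (hasDerivAt_const t r))

theorem pd1_pd2_comm (hF : ContDiff ℝ (⊤ : ℕ∞) F) (p : ℝ × ℝ) :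
    pd1 (pd2 F) p = pd2 (pd1 F) p := by
  have hd : DifferentiableAt ℝ (fderiv ℝ F) p :=
    ((hF.fderiv_right (m := (⊤ : ℕ∞)) (by simp)).differentiable (by simp)) p
  have hs : IsSymmSndFDerivAt ℝ F p := hF.contDiffAt.isSymmSndFDerivAt (by
    rw [minSmoothness_of_isRCLikeNormedField]; exact WithTop.coe_le_coe.2 (le_top : (2 : ℕ∞) ≤ ⊤))
  have e1 : ∀ v w, fderiv ℝ (fun q => fderiv ℝ F q v) p w = fderiv ℝ (fderiv ℝ F) p w v := by
    intro v w
    have := (hd.hasFDerivAt.clm_apply (hasFDerivAt_const v p)).fderiv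
    rw [this]; simp
  unfold pd1 pd2
  rw [e1, e1]
  exact hs _ _

end Plane

/-- radial derivatives of the restriction of `u` to a ray, as functions of time and radius -/
def radialProfile (u : ℝ → E3 → ℂ) : ℕ → ℝ × ℝ → ℂ
  | 0 => fun p => u p.1 (p.2 • e3 0)
  | k + 1 => pd2 (radialProfile u k)

section Profile

variable {u : ℝ → E3 → ℂ}

theorem contDiff_radialProfile (hu : IsRegularSolution Set.univ u) (k : ℕ) :
    ContDiff ℝ (⊤ : ℕ∞) (radialProfile u k) := by
  induction k with
  | zero =>
    have h := hu.1
    rw [Set.univ_prod_univ, contDiffOn_univ] at h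
    have hl : ContDiff ℝ (⊤ : ℕ∞) fun p : ℝ × ℝ => (p.1, p.2 • e3 0) :=
      contDiff_fst.prodMk (contDiff_snd.smul contDiff_const)
    exact h.comp hl
  | succ k ih => exact contDiff_pd2 ih

theorem hasDerivAt_radialProfile (hu : IsRegularSolution Set.univ u) (k : ℕ) (t r : ℝ) :
    HasDerivAt (fun s => radialProfile u k (t, s)) (radialProfile u (k + 1) (t, r)) r :=
  hasDerivAt_pd2 (contDiff_radialProfile hu k) t r

theorem iteratedDeriv_radialProfile (hu : IsRegularSolution Set.univ u) (k : ℕ) (t : ℝ) :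
    iteratedDeriv k (fun r : ℝ => u t (r • e3 0)) = fun r => radialProfile u k (t, r) := by
  induction k with
  | zero => rw [iteratedDeriv_zero]; rfl
  | succ k ih =>
    rw [iteratedDeriv_succ, ih]
    exact funext fun r => (hasDerivAt_radialProfile hu k t r).deriv

theorem contDiff_slice (hu : IsRegularSolution Set.univ u) (t : ℝ) :
    ContDiff ℝ (⊤ : ℕ∞) (u t) := by
  have h := hu.1
  rw [Set.univ_prod_univ, contDiffOn_univ] at h
  exact h.comp (contDiff_const.prodMk contDiff_id)

theorem norm_radialProfile_le (hu : IsRegularSolution Set.univ u) (k : ℕ) (t r : ℝ) :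
    ‖radialProfile u k (t, r)‖ ≤ ‖iteratedFDeriv ℝ k (u t) (r • e3 0)‖ := by
  have h := congrFun (iteratedDeriv_radialProfile hu k t) r
  rw [← h, ← norm_iteratedFDeriv_eq_norm_iteratedDeriv]
  have hc := (ContinuousLinearMap.toSpanSingleton ℝ (e3 0)).iteratedFDeriv_comp_right
    (contDiff_slice hu t) r (i := k) (by exact_mod_cast le_top)
  have he : (u t ∘ (ContinuousLinearMap.toSpanSingleton ℝ (e3 0))) =
      fun r : ℝ => u t (r • e3 0) := by
    ext r; simp
  rw [he] at hc
  rw [hc]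
  refine (ContinuousMultilinearMap.norm_compContinuousLinearMap_le _ _).trans ?_
  have hn : ‖ContinuousLinearMap.toSpanSingleton ℝ (e3 0)‖ = 1 := by
    rw [ContinuousLinearMap.norm_toSpanSingleton, norm_e3]
  simp [hn]

theorem norm_smul_e3 {r : ℝ} (hr : 0 ≤ r) : ‖r • e3 0‖ = r := by
  rw [norm_smul, norm_e3, mul_one, Real.norm_eq_abs, abs_of_nonneg hr]

theorem radialProfile_bound (hu : IsRegularSolution Set.univ u) (k : ℕ) (T : ℝ) (n : ℕ) :
    ∃ C, 0 ≤ C ∧ ∀ t r : ℝ, |t| ≤ T → 0 ≤ r →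
      (1 + r) ^ n * ‖radialProfile u k (t, r)‖ ≤ C := by
  obtain ⟨C, hC⟩ := hu.2.2 (Set.Icc (-T) T) isCompact_Icc (Set.subset_univ _) n k
  refine ⟨max C 0, le_max_right _ _, fun t r ht hr => ?_⟩
  have h := hC t (abs_le.1 ht) (r • e3 0)
  rw [norm_smul_e3 hr] at h
  exact ((mul_le_mul_of_nonneg_left (norm_radialProfile_le hu k t r) (by positivity)).trans
    h).trans (le_max_left _ _)

theorem rapidDecay_re_radialProfile (hu : IsRegularSolution Set.univ u) (k : ℕ) :
    RapidDecay fun t r => (radialProfile u k (t, r)).re := by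
  refine ⟨(continuous_re.comp (contDiff_radialProfile hu k).continuous).continuousOn,
    fun T n => ?_⟩
  obtain ⟨C, h0, hC⟩ := radialProfile_bound hu k T n
  exact ⟨C, h0, fun t r ht hr => (mul_le_mul_of_nonneg_left (abs_re_le_norm _)
    (by positivity)).trans (hC t r ht hr)⟩

theorem rapidDecay_im_radialProfile (hu : IsRegularSolution Set.univ u) (k : ℕ) :
    RapidDecay fun t r => (radialProfile u k (t, r)).im := by
  refine ⟨(continuous_im.comp (contDiff_radialProfile hu k).continuous).continuousOn,
    fun T n => ?_⟩
  obtain ⟨C, h0, hC⟩ := radialProfile_bound hu k T n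
  exact ⟨C, h0, fun t r ht hr => (mul_le_mul_of_nonneg_left (abs_im_le_norm _)
    (by positivity)).trans (hC t r ht hr)⟩

theorem HasDerivAt.re_of_real {F : ℝ → ℂ} {F' : ℂ} {r : ℝ} (h : HasDerivAt F F' r) :
    HasDerivAt (fun s => (F s).re) F'.re r :=
  reCLM.hasFDerivAt.comp_hasDerivAt r h

theorem HasDerivAt.im_of_real {F : ℝ → ℂ} {F' : ℂ} {r : ℝ} (h : HasDerivAt F F' r) :
    HasDerivAt (fun s => (F s).im) F'.im r :=
  imCLM.hasFDerivAt.comp_hasDerivAt r h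

theorem eq_radialProfile_norm (hrad : ∀ (t : ℝ) (x y : E3), ‖x‖ = ‖y‖ → u t x = u t y) (t : ℝ)
    (x : E3) : u t x = radialProfile u 0 (t, ‖x‖) :=
  hrad t _ _ (norm_smul_e3 (norm_nonneg x)).symm

theorem radialProfile_neg (hrad : ∀ (t : ℝ) (x y : E3), ‖x‖ = ‖y‖ → u t x = u t y) (t r : ℝ) :
    radialProfile u 0 (t, -r) = radialProfile u 0 (t, r) :=
  hrad t _ _ (by simp [norm_smul])

/-- time derivative of `r u` expressed through radial derivatives -/
def radialRHS (u : ℝ → E3 → ℂ) (t r : ℝ) : ℂ :=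
  I * (2 * radialProfile u 1 (t, r) + (r : ℂ) * radialProfile u 2 (t, r) -
    (((((radialProfile u 0 (t, r)).re ^ 2 + (radialProfile u 0 (t, r)).im ^ 2) -
      ((radialProfile u 0 (t, r)).re ^ 2 + (radialProfile u 0 (t, r)).im ^ 2) ^ 2 : ℝ) : ℂ)) *
        ((r : ℂ) * radialProfile u 0 (t, r)))

theorem radial_equation (hu : IsRegularSolution Set.univ u)
    (hrad : ∀ (t : ℝ) (x y : E3), ‖x‖ = ‖y‖ → u t x = u t y) (t : ℝ) {r : ℝ} (hr : 0 < r) :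
    (r : ℂ) * pd1 (radialProfile u 0) (t, r) = radialRHS u t r := by
  have hx : r • e3 0 ≠ 0 := by
    rw [← norm_pos_iff, norm_smul_e3 hr.le]; exact hr
  have h := hu.2.1 t trivial (r • e3 0)
  rw [lapC_radial (eq_radialProfile_norm hrad t) (hasDerivAt_radialProfile hu 0 t)
    (hasDerivAt_radialProfile hu 1 t) hx, norm_smul_e3 hr.le] at h
  have hd : deriv (fun s => u s (r • e3 0)) t = pd1 (radialProfile u 0) (t, r) :=
    (hasDerivAt_pd1 (contDiff_radialProfile hu 0) t r).deriv
  have h0 : u t (r • e3 0) = radialProfile u 0 (t, r) := rfl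
  rw [hd, h0] at h
  have hq : ((‖radialProfile u 0 (t, r)‖ : ℝ) : ℂ) ^ 2 =
      (((radialProfile u 0 (t, r)).re ^ 2 + (radialProfile u 0 (t, r)).im ^ 2 : ℝ) : ℂ) := by
    rw [← ofReal_pow, Complex.sq_norm, normSq_apply]; push_cast; ring
  have hq4 : ((‖radialProfile u 0 (t, r)‖ : ℝ) : ℂ) ^ 4 =
      (((radialProfile u 0 (t, r)).re ^ 2 + (radialProfile u 0 (t, r)).im ^ 2 : ℝ) : ℂ) ^ 2 := by
    rw [← hq]; ring
  rw [hq, hq4] at h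
  have hr' : (r : ℂ) ≠ 0 := by exact_mod_cast hr.ne'
  unfold radialRHS
  generalize hm : ((radialProfile u 0 (t, r)).re ^ 2 + (radialProfile u 0 (t, r)).im ^ 2) = m at *
  simp only [Nat.reduceAdd, zero_add] at h
  have e : pd1 (radialProfile u 0) (t, r) = -I * ((m : ℂ) * radialProfile u 0 (t, r) -
      (m : ℂ) ^ 2 * radialProfile u 0 (t, r) -
      (radialProfile u 2 (t, r) + 2 / (r : ℂ) * radialProfile u 1 (t, r))) := by
    rw [← h]
    linear_combination pd1 (radialProfile u 0) (t, r) * I_sq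
  rw [e]
  push_cast
  field_simp
  ring

/-- radial derivative of `radialRHS` -/
def radialRHS' (u : ℝ → E3 → ℂ) (t r : ℝ) : ℂ :=
  I * (3 * radialProfile u 2 (t, r) + (r : ℂ) * radialProfile u 3 (t, r) -
    ((((1 - 2 * ((radialProfile u 0 (t, r)).re ^ 2 + (radialProfile u 0 (t, r)).im ^ 2)) *
      (2 * ((radialProfile u 0 (t, r)).re * (radialProfile u 1 (t, r)).re +
        (radialProfile u 0 (t, r)).im * (radialProfile u 1 (t, r)).im)) : ℝ) : ℂ) *
          ((r : ℂ) * radialProfile u 0 (t, r)) +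
    ((((radialProfile u 0 (t, r)).re ^ 2 + (radialProfile u 0 (t, r)).im ^ 2) -
      ((radialProfile u 0 (t, r)).re ^ 2 + (radialProfile u 0 (t, r)).im ^ 2) ^ 2 : ℝ) : ℂ) *
        (radialProfile u 0 (t, r) + (r : ℂ) * radialProfile u 1 (t, r))))

theorem hasDerivAt_radialRHS (hu : IsRegularSolution Set.univ u) (t r : ℝ) :
    HasDerivAt (radialRHS u t) (radialRHS' u t r) r := by
  have h0 := hasDerivAt_radialProfile hu 0 t r
  have h1 := hasDerivAt_radialProfile hu 1 t r
  have h2 := hasDerivAt_radialProfile hu 2 t r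
  have hid : HasDerivAt (fun s : ℝ => (s : ℂ)) 1 r := (hasDerivAt_id r).ofReal_comp
  have hm := (h0.re_of_real.pow 2).add (h0.im_of_real.pow 2)
  have hF := (hm.sub (hm.pow 2)).ofReal_comp
  refine HasDerivAt.congr_deriv
    ((((h1.const_mul 2).add (hid.mul h2)).sub (hF.mul (hid.mul h0))).const_mul I) ?_
  simp only [radialRHS', Pi.add_apply, Pi.pow_apply, Pi.sub_apply, Pi.mul_apply]
  push_cast
  ring

theorem hasDerivAt_time_radial (hu : IsRegularSolution Set.univ u)
    (hrad : ∀ (t : ℝ) (x y : E3), ‖x‖ = ‖y‖ → u t x = u t y) (t : ℝ) {r : ℝ} (hr : 0 < r) :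
    HasDerivAt (fun s => (r : ℂ) * radialProfile u 0 (s, r)) (radialRHS u t r) t := by
  rw [← radial_equation hu hrad t hr]
  exact (hasDerivAt_pd1 (contDiff_radialProfile hu 0) t r).const_mul _

theorem hasDerivAt_time_radial_deriv (hu : IsRegularSolution Set.univ u)
    (hrad : ∀ (t : ℝ) (x y : E3), ‖x‖ = ‖y‖ → u t x = u t y) (t : ℝ) {r : ℝ} (hr : 0 < r) :
    HasDerivAt (fun s => radialProfile u 0 (s, r) + (r : ℂ) * radialProfile u 1 (s, r))
      (radialRHS' u t r) t := by
  set H : ℝ × ℝ → ℂ := fun p => (p.2 : ℂ) * radialProfile u 0 p with hHdef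
  have hH : ContDiff ℝ (⊤ : ℕ∞) H :=
    (ofRealCLM.contDiff.comp contDiff_snd).mul (contDiff_radialProfile hu 0)
  have e2 : ∀ s ρ, pd2 H (s, ρ) = radialProfile u 0 (s, ρ) + (ρ : ℂ) * radialProfile u 1 (s, ρ) :=
    fun s ρ => by
      have hid : HasDerivAt (fun s : ℝ => (s : ℂ)) 1 ρ := (hasDerivAt_id ρ).ofReal_comp
      have := (hasDerivAt_pd2 hH s ρ).unique (hid.mul (hasDerivAt_radialProfile hu 0 s ρ))
      rw [this]; ring
  have e1 : ∀ ρ, 0 < ρ → pd1 H (t, ρ) = radialRHS u t ρ := fun ρ hρ =>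
    (hasDerivAt_pd1 hH t ρ).unique (hasDerivAt_time_radial hu hrad t hρ)
  have e3 : pd2 (pd1 H) (t, r) = radialRHS' u t r := by
    refine (hasDerivAt_pd2 (contDiff_pd1 hH) t r).unique
      ((hasDerivAt_radialRHS hu t r).congr_of_eventuallyEq ?_)
    filter_upwards [Ioi_mem_nhds hr] with ρ hρ using e1 ρ hρ
  have h := hasDerivAt_pd1 (contDiff_pd2 hH) t r
  rw [pd1_pd2_comm hH, e3] at h
  simpa only [e2] using h

end Profile

/-- the radial flow of a radial regular solution -/
def RadialFlow.ofSolution (u : ℝ → E3 → ℂ) (hu : IsRegularSolution Set.univ u)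
    (hrad : ∀ (t : ℝ) (x y : E3), ‖x‖ = ‖y‖ → u t x = u t y) : RadialFlow where
  f t r := (radialProfile u 0 (t, r)).re
  f1 t r := (radialProfile u 1 (t, r)).re
  f2 t r := (radialProfile u 2 (t, r)).re
  f3 t r := (radialProfile u 3 (t, r)).re
  g t r := (radialProfile u 0 (t, r)).im
  g1 t r := (radialProfile u 1 (t, r)).im
  g2 t r := (radialProfile u 2 (t, r)).im
  g3 t r := (radialProfile u 3 (t, r)).im
  rf := rapidDecay_re_radialProfile hu 0
  rf1 := rapidDecay_re_radialProfile hu 1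
  rf2 := rapidDecay_re_radialProfile hu 2
  rf3 := rapidDecay_re_radialProfile hu 3
  rg := rapidDecay_im_radialProfile hu 0
  rg1 := rapidDecay_im_radialProfile hu 1
  rg2 := rapidDecay_im_radialProfile hu 2
  rg3 := rapidDecay_im_radialProfile hu 3
  hf t r := (hasDerivAt_radialProfile hu 0 t r).re_of_real
  hf1 t r := (hasDerivAt_radialProfile hu 1 t r).re_of_real
  hf2 t r := (hasDerivAt_radialProfile hu 2 t r).re_of_real
  hg t r := (hasDerivAt_radialProfile hu 0 t r).im_of_real
  hg1 t r := (hasDerivAt_radialProfile hu 1 t r).im_of_real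
  hg2 t r := (hasDerivAt_radialProfile hu 2 t r).im_of_real
  f_even t r := by rw [radialProfile_neg hrad]
  g_even t r := by rw [radialProfile_neg hrad]
  f_dt t r hr := by
    have h := (hasDerivAt_time_radial hu hrad t hr).re_of_real
    simp only [re_ofReal_mul] at h
    refine h.congr_deriv ?_
    simp only [radialRHS, mul_re, sub_re, add_re, sub_im, add_im, mul_im, I_re, I_im, ofReal_re,
      ofReal_im, re_ofNat, im_ofNat]
    ring
  g_dt t r hr := by
    have h := (hasDerivAt_time_radial hu hrad t hr).im_of_real
    simp only [im_ofReal_mul] at h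
    refine h.congr_deriv ?_
    simp only [radialRHS, mul_re, sub_re, add_re, sub_im, add_im, mul_im, I_re, I_im, ofReal_re,
      ofReal_im, re_ofNat, im_ofNat]
    ring
  f1_dt t r hr := by
    have h := (hasDerivAt_time_radial_deriv hu hrad t hr).re_of_real
    simp only [re_ofReal_mul, add_re] at h
    refine h.congr_deriv ?_
    simp only [radialRHS', mul_re, sub_re, add_re, sub_im, add_im, mul_im, I_re, I_im, ofReal_re,
      ofReal_im, re_ofNat, im_ofNat]
    ring
  g1_dt t r hr := by
    have h := (hasDerivAt_time_radial_deriv hu hrad t hr).im_of_real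
    simp only [im_ofReal_mul, add_im] at h
    refine h.congr_deriv ?_
    simp only [radialRHS', mul_re, sub_re, add_re, sub_im, add_im, mul_im, I_re, I_im, ofReal_re,
      ofReal_im, re_ofNat, im_ofNat]
    ring

theorem integrable_radial {f : ℝ → ℝ} (h : IntegrableOn (fun r => r ^ 2 * f r) (Set.Ioi 0)) :
    Integrable fun x : E3 => f ‖x‖ := by
  refine (integrable_fun_norm_addHaar (volume : Measure E3) (f := f)).2 ?_
  simpa [finrank_euclideanSpace_fin] using h

namespace RadialFlow

variable {u : ℝ → E3 → ℂ} (hu : IsRegularSolution Set.univ u)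
  (hrad : ∀ (t : ℝ) (x y : E3), ‖x‖ = ‖y‖ → u t x = u t y)

theorem ofSolution_U (t r : ℝ) : (ofSolution u hu hrad).U t r = radialProfile u 0 (t, r) :=
  re_add_im _

theorem ofSolution_U1 (t r : ℝ) : (ofSolution u hu hrad).U1 t r = radialProfile u 1 (t, r) :=
  re_add_im _

theorem norm_sq_ofSolution (t : ℝ) (x : E3) :
    ‖u t x‖ ^ 2 = (ofSolution u hu hrad).q t ‖x‖ := by
  rw [eq_radialProfile_norm hrad, ← ofSolution_U hu hrad, norm_U_sq]

theorem gradSqC_ofSolution (t : ℝ) {x : E3} (hx : x ≠ 0) :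
    gradSqC (u t) x = ‖(ofSolution u hu hrad).U1 t ‖x‖‖ ^ 2 := by
  rw [gradSqC_radial (eq_radialProfile_norm hrad t) (hasDerivAt_radialProfile hu 0 t) hx,
    ofSolution_U1]

theorem ae_gradSqC_ofSolution (t : ℝ) :
    ∀ᵐ x : E3, gradSqC (u t) x = ‖(ofSolution u hu hrad).U1 t ‖x‖‖ ^ 2 := by
  have h : ∀ᵐ x : E3, x ≠ 0 := by simp [ae_iff]
  filter_upwards [h] with x hx using gradSqC_ofSolution hu hrad t hx

theorem integral_gradSqC_ofSolution (t : ℝ) :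
    ∫ x : E3, gradSqC (u t) x = 4 * Real.pi * (ofSolution u hu hrad).B t := by
  rw [integral_congr_ae (ae_gradSqC_ofSolution hu hrad t),
    integral_radial fun r => ‖(ofSolution u hu hrad).U1 t r‖ ^ 2, ← integral_grd]
  rfl

theorem Ecq_ofSolution (t : ℝ) : Ecq (u t) = 4 * Real.pi *
    (1 / 2 * (ofSolution u hu hrad).B t + (1 / 4 * (ofSolution u hu hrad).L4 t
      - 1 / 6 * (ofSolution u hu hrad).L6 t)) := by
  set S := ofSolution u hu hrad
  have e : ∀ᵐ x : E3, (1:ℝ)/2 * gradSqC (u t) x - 1/6 * ‖u t x‖ ^ 6 + 1/4 * ‖u t x‖ ^ 4 =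
      1 / 2 * ‖S.U1 t ‖x‖‖ ^ 2 - 1 / 6 * S.q t ‖x‖ ^ 3 + 1 / 4 * S.q t ‖x‖ ^ 2 := by
    filter_upwards [ae_gradSqC_ofSolution hu hrad t] with x hx
    rw [hx, ← norm_sq_ofSolution hu hrad]
    ring
  rw [Ecq, integral_congr_ae e, integral_radial fun r =>
    1 / 2 * ‖S.U1 t r‖ ^ 2 - 1 / 6 * S.q t r ^ 3 + 1 / 4 * S.q t r ^ 2]
  have e2 : ∀ r, r ^ 2 * (1 / 2 * ‖S.U1 t r‖ ^ 2 - 1 / 6 * S.q t r ^ 3 + 1 / 4 * S.q t r ^ 2) =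
      1 / 2 * S.grd t r + (1 / 4 * S.d4 t r - 1 / 6 * S.d6 t r) := fun r => by
    unfold grd d4 d6; ring
  simp only [e2]
  rw [integral_add ((S.rgrd.integrableOn t).const_mul _)
    ((((S.rd4.const_mul (1 / 4)).sub (S.rd6.const_mul (1 / 6))).integrableOn t)),
    integral_sub ((S.rd4.integrableOn t).const_mul _) ((S.rd6.integrableOn t).const_mul _),
    integral_const_mul, integral_const_mul, integral_const_mul, integral_grd]
  rfl

theorem threshold_ofSolution (hE : Ecq (u 0) = Ecrit Wc)
    (hgrad : (∫ x : E3, gradSqC (u 0) x) < ∫ x : E3, gradSqR W x) :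
    (ofSolution u hu hrad).Threshold := by
  have hpi : 0 < 4 * Real.pi := by positivity
  rw [Ecq_ofSolution hu hrad, Ecrit_Wc] at hE
  rw [integral_gradSqC_ofSolution hu hrad, integral_gradSqR_W] at hgrad
  exact ⟨mul_left_cancel₀ hpi.ne' hE, lt_of_mul_lt_mul_left hgrad hpi.le⟩

theorem lintegral_norm_pow_ten_ofSolution (t : ℝ) :
    ∫⁻ x : E3, (‖u t x‖₊ : ℝ≥0∞) ^ (10:ℕ) =
      ENNReal.ofReal (4 * Real.pi) * ENNReal.ofReal ((ofSolution u hu hrad).L10 t) := by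
  set S := ofSolution u hu hrad
  have e : ∀ x : E3, (‖u t x‖₊ : ℝ≥0∞) ^ (10:ℕ) = ENNReal.ofReal (S.q t ‖x‖ ^ 5) := fun x => by
    rw [← norm_sq_ofSolution hu hrad, ← pow_mul, ENNReal.ofReal_pow (norm_nonneg _), ofReal_norm]
    rfl
  simp only [e]
  rw [← ofReal_integral_eq_lintegral_ofReal
    (integrable_radial (f := fun r => S.q t r ^ 5) (S.rd10.integrableOn t))
    (ae_of_all _ fun x => pow_nonneg (S.q_nonneg t _) 5),
    integral_radial fun r => S.q t r ^ 5, ENNReal.ofReal_mul (by positivity)]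
  rfl

end RadialFlow

/-- Threshold scattering bound: radial threshold solutions below the ground state
gradient norm obey global `L¹⁰_{t,x}` spacetime bounds. -/
theorem threshold_scattering_bound (u : ℝ → E3 → ℂ)
    (hu : IsRegularSolution Set.univ u)
    (hrad : ∀ (t : ℝ) (x y : E3), ‖x‖ = ‖y‖ → u t x = u t y)
    (hE : Ecq (u 0) = Ecrit Wc)
    (hgrad : (∫ x : E3, gradSqC (u 0) x) < ∫ x : E3, gradSqR W x) :
    (∫⁻ p : ℝ × E3, (‖u p.1 p.2‖₊ : ℝ≥0∞) ^ (10:ℕ)) < ⊤ := by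
  have hc : Continuous fun p : ℝ × E3 => u p.1 p.2 := by
    have h := hu.1.continuousOn
    rwa [Set.univ_prod_univ, continuousOn_univ] at h
  have hm : Measurable fun p : ℝ × E3 => (‖u p.1 p.2‖₊ : ℝ≥0∞) ^ (10:ℕ) :=
    hc.enorm.measurable.pow_const 10
  rw [Measure.volume_eq_prod, lintegral_prod _ hm.aemeasurable]
  simp only [RadialFlow.lintegral_norm_pow_ten_ofSolution hu hrad]
  rw [lintegral_const_mul' _ _ ENNReal.ofReal_ne_top]
  exact ENNReal.mul_lt_top ENNReal.ofReal_lt_top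
    (RadialFlow.lintegral_L10_lt_top _ (RadialFlow.threshold_ofSolution hu hrad hE hgrad))
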